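/- There exists a constant c > 0 such that for all integers v ≥ 1, 1 ≤ t ≤ v and t ≤ k ≤ v and for all N satisfying that (C(k,s)/C(v,s))·N is an integer for all 1 ≤ s ≤ t and that min(N, C(v,k) − N) ≥ (c·v/t)^(c·t), the number of simple t-(v,k,λ) designs T of size |T| = N equals [ 1 / ( (2π·p·(1−p))^((1/2)·C(v,t)) · p^N · (1−p)^(C(v,k)−N) ) ] · ∏_{s=0}^{t} [ C(k−s,k−t)/C(v−t−s,k−t) ]^((1/2)·(C(v,s)−C(v,s−1))) · (1+δ), where p := N/C(v,k), |δ| ≤ (c·v/t)^(c·t)/√(min(N, C(v,k)−N)), and C(v,−1) := 0. -/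

import Mathlib

/-- A simple `t-(v,k,λ)` design is a family of distinct `k`-element subsets of `[v]`
such that every `t`-element subset of `[v]` is contained in exactly `λ` members. -/
def IsDesign (v k t lam : ℕ) (T : Finset (Finset (Fin v))) : Prop :=
  (∀ b ∈ T, b.card = k) ∧
    ∀ s : Finset (Fin v), s.card = t → (T.filter fun b => s ⊆ b).card = lam


open Finset in
/-- Möbius inversion turns an expansion on complements into an expansion on the sets themselves. -/
theorem exists_expansion_compl {α : Type*} [DecidableEq α] {V : Finset α}
    {F : Finset (Finset α)} (hV : ∀ S ∈ F, S ⊆ V) (hdown : ∀ S ∈ F, ∀ J ⊆ S, J ∈ F) (g a : Finset α → ℤ)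
    {b : Finset α} (hg : g b = ∑ S ∈ F, if S ⊆ V \ b then a S else 0) :
    g b = ∑ J ∈ F, if J ⊆ b then (-1) ^ #J * ∑ S ∈ F, (if J ⊆ S then a S else 0) else 0 := by
  have key : ∀ S ∈ F, (if S ⊆ V \ b then a S else 0)
      = ∑ J ∈ F, if J ⊆ b ∧ J ⊆ S then (-1) ^ #J * a S else 0 := by
    intro S hS
    have h1 : (∑ J ∈ F, if J ⊆ b ∧ J ⊆ S then (-1) ^ #J * a S else 0)
        = ∑ J ∈ (S ∩ b).powerset, (-1) ^ #J * a S := by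
      rw [← sum_filter]
      refine sum_congr ?_ fun _ _ => rfl
      ext J
      simp only [mem_filter, mem_powerset, subset_inter_iff]
      exact ⟨fun h => ⟨h.2.2, h.2.1⟩, fun h => ⟨hdown S hS J h.1, h.2, h.1⟩⟩
    have h2 : S ⊆ V \ b ↔ S ∩ b = ∅ := by
      rw [subset_sdiff, disjoint_iff_inter_eq_empty]
      exact ⟨fun h => h.2, fun h => ⟨hV S hS, h⟩⟩
    rw [h1, ← sum_mul, sum_powerset_neg_one_pow_card]
    simp only [h2]
    split_ifs <;> simp
  rw [hg, sum_congr rfl key, sum_comm]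
  refine sum_congr rfl fun J _ => ?_
  by_cases hJ : J ⊆ b
  · simp only [hJ, true_and, if_true, mul_sum, mul_ite, mul_zero]
  · simp [hJ]

/-- A down-closed family of subsets of `V` whose containment indicators form an integral basis of
the functions on each slice of `V`. -/
structure StdFamily {α : Type*} [DecidableEq α] (V : Finset α) (F : Finset (Finset α)) : Prop where
  subset : ∀ S ∈ F, S ⊆ V
  two_mul_card : ∀ S ∈ F, 2 * S.card ≤ V.card
  empty_mem : ∅ ∈ F
  down : ∀ S ∈ F, ∀ J ⊆ S, J ∈ F
  card_add : ∀ s, 2 * s ≤ V.card + 1 →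
    (F.filter fun S => S.card = s).card + (if s = 0 then 0 else V.card.choose (s - 1))
      = V.card.choose s
  expand : ∀ k, 2 * k ≤ V.card → ∀ g : Finset α → ℤ, ∃ a : Finset α → ℤ,
    ∀ b ∈ V.powersetCard k, g b = ∑ S ∈ F, if S ⊆ b then a S else 0

open Finset in
theorem StdFamily.expand_compl {α : Type*} [DecidableEq α] {V : Finset α} {F : Finset (Finset α)}
    (h : StdFamily V F) (k : ℕ) (hk : k ≤ #V) (hk2 : #V ≤ 2 * k) (g : Finset α → ℤ) :
    ∃ a : Finset α → ℤ, (∀ S, #V < k + #S → a S = 0) ∧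
      ∀ b ∈ V.powersetCard k, g b = ∑ S ∈ F, if S ⊆ b then a S else 0 := by
  obtain ⟨a, ha⟩ := h.expand (#V - k) (by omega) fun b => g (V \ b)
  refine ⟨fun J => (-1) ^ #J * ∑ S ∈ F, (if J ⊆ S then (if #S ≤ #V - k then a S else 0) else 0),
    ?_, ?_⟩
  · intro J hJ
    simp only [mul_eq_zero]
    right
    refine sum_eq_zero fun S _ => ?_
    split_ifs with h1 h2
    · have := card_le_card h1
      omega
    · rfl
    · rfl
  · intro b hb
    rw [mem_powersetCard] at hb
    refine exists_expansion_compl h.subset h.down g _ ?_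
    have := ha (V \ b) (by
      rw [mem_powersetCard]
      exact ⟨sdiff_subset, by rw [card_sdiff_of_subset hb.1, hb.2]⟩)
    rw [Finset.sdiff_sdiff_eq_self hb.1] at this
    rw [this]
    refine sum_congr rfl fun S _ => ?_
    split_ifs with h1 h2
    · rfl
    · exfalso
      have := card_le_card h1
      rw [card_sdiff_of_subset hb.1, hb.2] at this
      omega
    · rfl

open Finset in
theorem exists_stdFamily {α : Type*} [DecidableEq α] (V : Finset α) :
    ∃ F : Finset (Finset α), StdFamily V F := by
  induction V using Finset.induction_on with
  | empty =>
    refine ⟨{∅}, ⟨by simp, by simp, by simp, ?_, ?_, ?_⟩⟩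
    · intro S hS J hJ
      simp only [mem_singleton] at hS ⊢
      subst hS
      exact subset_empty.1 hJ
    · intro s hs
      have : s = 0 := by simp at hs; omega
      subst this
      simp [filter_singleton]
    · intro k hk g
      have : k = 0 := by simpa using hk
      subst this
      exact ⟨g, by simp⟩
  | insert x V hx ih =>
    obtain ⟨F, hF⟩ := ih
    have hxF : ∀ S ∈ F, x ∉ S := fun S hS h => hx (hF.subset S hS h)
    have hinj : Set.InjOn (fun S : Finset α => insert x S) F := by
      intro S hS T hT h
      have : (insert x S).erase x = (insert x T).erase x := by
        exact congrArg (fun U : Finset α => U.erase x) h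
      rwa [erase_insert (hxF S hS), erase_insert (hxF T hT)] at this
    set E := F.filter fun S => 2 * (#S + 1) ≤ #V + 1 with hE
    have hEF : E ⊆ F := filter_subset _ _
    have hdisj : Disjoint F (E.image fun S => insert x S) := by
      rw [Finset.disjoint_left]
      intro S hS hS'
      obtain ⟨T, -, rfl⟩ := mem_image.1 hS'
      exact hxF _ hS (mem_insert_self _ _)
    refine ⟨F ∪ E.image fun S => insert x S, ⟨?_, ?_, ?_, ?_, ?_, ?_⟩⟩
    · intro S hS
      rcases mem_union.1 hS with hS | hS
      · exact (hF.subset S hS).trans (subset_insert _ _)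
      · obtain ⟨T, hT, rfl⟩ := mem_image.1 hS
        exact insert_subset_insert _ (hF.subset T (hEF hT))
    · intro S hS
      rw [card_insert_of_notMem hx]
      rcases mem_union.1 hS with hS | hS
      · have := hF.two_mul_card S hS
        omega
      · obtain ⟨T, hT, rfl⟩ := mem_image.1 hS
        rw [hE, mem_filter] at hT
        rw [card_insert_of_notMem (hxF T hT.1)]
        exact hT.2
    · exact mem_union_left _ hF.empty_mem
    · intro S hS J hJ
      rcases mem_union.1 hS with hS | hS
      · exact mem_union_left _ (hF.down S hS J hJ)
      · obtain ⟨T, hT, rfl⟩ := mem_image.1 hS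
        have hJT : J.erase x ⊆ T := by
          rw [← subset_insert_iff]
          exact hJ
        have hJF := hF.down T (hEF hT) _ hJT
        by_cases hxJ : x ∈ J
        · refine mem_union_right _ (mem_image.2 ⟨J.erase x, ?_, insert_erase hxJ⟩)
          have := card_le_card hJT
          rw [hE, mem_filter] at hT ⊢
          exact ⟨hJF, by omega⟩
        · rw [erase_eq_of_notMem hxJ] at hJF
          exact mem_union_left _ hJF
    · intro s hs
      rw [card_insert_of_notMem hx] at hs ⊢
      rw [filter_union, card_union_of_disjoint (disjoint_filter_filter hdisj)]
      rcases s with _ | s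
      · have h0 := hF.card_add 0 (by omega)
        have : ((E.image fun S => insert x S).filter fun S => #S = 0) = ∅ := by
          rw [filter_eq_empty_iff]
          intro S hS h
          obtain ⟨T, -, rfl⟩ := mem_image.1 hS
          simp at h
        simp only [if_true, Nat.choose_zero_right] at h0 ⊢
        rw [this]
        simpa using h0
      · simp only [Nat.add_eq_zero_iff, one_ne_zero, and_false, if_false, Nat.add_sub_cancel]
        rcases Nat.lt_or_ge (#V + 1) (2 * (s + 1)) with hlt | hge
        · have h1 : (F.filter fun S => #S = s + 1) = ∅ := by
            rw [filter_eq_empty_iff]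
            intro S hS h
            have := hF.two_mul_card S hS
            omega
          have h2 : ((E.image fun S => insert x S).filter fun S => #S = s + 1) = ∅ := by
            rw [filter_eq_empty_iff]
            intro S hS h
            obtain ⟨T, hT, rfl⟩ := mem_image.1 hS
            rw [hE, mem_filter] at hT
            rw [card_insert_of_notMem (hxF T hT.1)] at h
            omega
          rw [h1, h2, card_empty, add_zero, zero_add,
            ← Nat.choose_symm_of_eq_add (show #V + 1 = s + (s + 1) by omega)]
        have h1 : #((E.image fun S => insert x S).filter fun S => #S = s + 1)
            = #(F.filter fun S => #S = s) := by
          rw [filter_image, card_image_of_injOn]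
          · congr 1
            ext S
            simp only [hE, mem_filter]
            constructor
            · rintro ⟨⟨h, -⟩, h'⟩
              rw [card_insert_of_notMem (hxF S h)] at h'
              exact ⟨h, by omega⟩
            · rintro ⟨h, h'⟩
              rw [card_insert_of_notMem (hxF S h)]
              exact ⟨⟨h, by omega⟩, by omega⟩
          · exact hinj.mono fun S hS => hEF (mem_filter.1 hS).1
        have h3 := hF.card_add s (by omega)
        have h4 : #(F.filter fun S => #S = s + 1) + (#V).choose s = (#V).choose (s + 1) := by
          simpa using hF.card_add (s + 1) hge
        rw [h1, Nat.choose_succ_succ']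
        rcases s with _ | s
        · simp at h3 h4 ⊢
          omega
        · simp only [Nat.add_eq_zero_iff, one_ne_zero, and_false, if_false,
            Nat.add_sub_cancel] at h3
          rw [Nat.choose_succ_succ' (#V) s]
          omega
    · intro k hk g
      rw [card_insert_of_notMem hx] at hk
      obtain ⟨a, ha⟩ : ∃ a : Finset α → ℤ, ∀ b ∈ V.powersetCard k,
          g b = ∑ S ∈ F, if S ⊆ b then a S else 0 := by
        rcases Nat.lt_or_ge (#V) (2 * k) with h | h
        · rcases Nat.lt_or_ge (#V) k with h' | h'
          · refine ⟨0, fun b hb => ?_⟩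
            rw [powersetCard_eq_empty.2 h'] at hb
            simp at hb
          · obtain ⟨a, -, ha⟩ := hF.expand_compl k h' h.le g
            exact ⟨a, ha⟩
        · exact hF.expand k h g
      obtain ⟨c, hc⟩ := hF.expand (k - 1) (by omega)
        fun b => g (insert x b) - ∑ S ∈ F, if S ⊆ b then a S else 0
      refine ⟨fun S => if x ∈ S then c (S.erase x) else a S, fun b hb => ?_⟩
      rw [mem_powersetCard] at hb
      rw [sum_union hdisj, sum_image (hinj.mono (by exact_mod_cast hEF))]
      by_cases hxb : x ∈ b
      · have hb' : b.erase x ∈ V.powersetCard (k - 1) := by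
          rw [mem_powersetCard, card_erase_of_mem hxb, hb.2]
          exact ⟨subset_insert_iff.1 hb.1, rfl⟩
        have h1 := hc _ hb'
        simp only [insert_erase hxb] at h1
        have h2 : ∀ S ∈ F, (if S ⊆ b then (if x ∈ S then c (S.erase x) else a S) else 0)
            = if S ⊆ b.erase x then a S else 0 := by
          intro S hS
          have : S ⊆ b.erase x ↔ S ⊆ b := by
            rw [subset_erase]
            exact ⟨fun h => h.1, fun h => ⟨h, hxF S hS⟩⟩
          simp [this, hxF S hS]
        have h3 : ∑ S ∈ E, (if insert x S ⊆ b then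
              (if x ∈ insert x S then c ((insert x S).erase x) else a (insert x S)) else 0)
            = ∑ S ∈ F, if S ⊆ b.erase x then c S else 0 := by
          rw [hE, sum_filter]
          refine sum_congr rfl fun S hS => ?_
          have : insert x S ⊆ b ↔ S ⊆ b.erase x := by
            rw [subset_erase, insert_subset_iff]
            exact ⟨fun h => ⟨h.2, hxF S hS⟩, fun h => ⟨hxb, h.1⟩⟩
          simp only [this, mem_insert_self, if_true, erase_insert (hxF S hS)]
          split_ifs with h4 h5 h6
          · rfl
          · rfl
          · exfalso
            have := card_le_card h6
            have h7 : 0 < #b := card_pos.2 ⟨x, hxb⟩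
            rw [card_erase_of_mem hxb, hb.2] at this
            omega
          · rfl
        rw [sum_congr rfl h2, h3]
        linarith
      · have hb' : b ∈ V.powersetCard k := by
          rw [mem_powersetCard]
          exact ⟨(subset_insert_iff_of_notMem hxb).1 hb.1, hb.2⟩
        rw [ha b hb']
        have h3 : ∀ S ∈ E, (if insert x S ⊆ b then
              (if x ∈ insert x S then c ((insert x S).erase x) else a (insert x S)) else 0)
            = 0 := by
          intro S _
          rw [if_neg]
          exact fun h => hxb (h (mem_insert_self _ _))
        rw [sum_eq_zero h3, add_zero]
        refine sum_congr rfl fun S hS => ?_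
        simp [hxF S hS]

/-- The indicator of `S ⊆ b`, with values in `R`. -/
def incl (R : Type*) [Zero R] [One R] {α : Type*} [DecidableEq α] (S b : Finset α) : R :=
  if S ⊆ b then 1 else 0

theorem intCast_incl {R : Type*} [Ring R] {α : Type*} [DecidableEq α] (S b : Finset α) :
    ((incl ℤ S b : ℤ) : R) = incl R S b := by
  unfold incl
  split_ifs <;> simp

open Finset in
theorem StdFamily.card_filter_le {α : Type*} [DecidableEq α] {V : Finset α} {F : Finset (Finset α)}
    (h : StdFamily V F) (r : ℕ) (hr : 2 * r ≤ #V) :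
    #(F.filter fun S => #S ≤ r) = (#V).choose r := by
  induction r with
  | zero =>
    have := h.card_add 0 (by omega)
    simpa using this
  | succ r ih =>
    have h1 := ih (by omega)
    have h2 := h.card_add (r + 1) (by omega)
    simp only [Nat.add_eq_zero_iff, one_ne_zero, and_false, if_false, Nat.add_sub_cancel] at h2
    have h3 : (F.filter fun S => #S ≤ r + 1)
        = (F.filter fun S => #S ≤ r) ∪ F.filter fun S => #S = r + 1 := by
      rw [← filter_or]
      refine filter_congr fun S _ => ?_
      omega
    rw [h3, card_union_of_disjoint, h1, add_comm, h2]
    rw [disjoint_filter]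
    intro S _ h4 h5
    omega

open Finset in
theorem StdFamily.expand_filter {α : Type*} [DecidableEq α] {V : Finset α} {F : Finset (Finset α)}
    (h : StdFamily V F) (k : ℕ) (hk : k ≤ #V) (g : Finset α → ℤ) :
    ∃ a : Finset α → ℤ, ∀ b ∈ V.powersetCard k,
      g b = ∑ S ∈ F.filter fun S => #S ≤ min k (#V - k), a S * incl ℤ S b := by
  rcases Nat.lt_or_ge (#V) (2 * k) with hlt | hge
  · obtain ⟨a, ha0, ha⟩ := h.expand_compl k hk hlt.le g
    refine ⟨a, fun b hb => ?_⟩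
    rw [ha b hb, sum_filter]
    refine sum_congr rfl fun S _ => ?_
    unfold incl
    split_ifs with h1 h2 h2
    · simp
    · exact ha0 S (by omega)
    · simp
    · rfl
  · obtain ⟨a, ha⟩ := h.expand k hge g
    refine ⟨a, fun b hb => ?_⟩
    rw [ha b hb, sum_filter]
    refine sum_congr rfl fun S _ => ?_
    unfold incl
    split_ifs with h1 h2 h2
    · simp
    · have := card_le_card h1
      rw [(mem_powersetCard.1 hb).2] at this
      omega
    · simp
    · rfl

open Finset in
/-- The inclusion matrix of a standard family against a slice has an integral inverse. -/
theorem StdFamily.exists_inverse {α : Type*} [DecidableEq α] {V : Finset α}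
    {F : Finset (Finset α)} (h : StdFamily V F) (k : ℕ) (hk : k ≤ #V) :
    ∃ c : Finset α → Finset α → ℤ,
      (∀ b ∈ V.powersetCard k, ∀ b', ∑ S ∈ F.filter fun S => #S ≤ min k (#V - k),
          c b' S * incl ℤ S b = if b' = b then 1 else 0) ∧
      ∀ S ∈ F.filter fun S => #S ≤ min k (#V - k), ∀ S' ∈ F.filter fun S => #S ≤ min k (#V - k),
        ∑ b ∈ V.powersetCard k, incl ℤ S b * c b S' = if S = S' then 1 else 0 := by
  set G := F.filter fun S => #S ≤ min k (#V - k) with hG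
  choose c hc using fun b' => h.expand_filter k hk fun b => if b' = b then 1 else 0
  refine ⟨c, fun b hb b' => (hc b' b hb).symm, fun S hS S' hS' => ?_⟩
  let M : Matrix (V.powersetCard k) G ℤ := fun b S => c b S
  let U : Matrix G (V.powersetCard k) ℤ := fun S b => incl ℤ (S : Finset α) b
  have hMU : M * U = 1 := by
    ext b b'
    rw [Matrix.mul_apply, Matrix.one_apply]
    have := hc b b' b'.2
    rw [← sum_coe_sort] at this
    simp only [Subtype.ext_iff]
    exact this.symm
  have hcard : Fintype.card (V.powersetCard k) = Fintype.card G := by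
    rw [Fintype.card_coe, Fintype.card_coe, card_powersetCard, hG,
      h.card_filter_le _ (by omega)]
    rcases Nat.le_total k (#V - k) with h1 | h1
    · rw [min_eq_left h1]
    · rw [min_eq_right h1, Nat.choose_symm hk]
  have hUM := (Matrix.mul_eq_one_comm_of_card_eq _ _ _ hcard).1 hMU
  have := congrFun (congrFun hUM ⟨S, hS⟩) ⟨S', hS'⟩
  rw [Matrix.mul_apply, Matrix.one_apply] at this
  rw [← sum_coe_sort]
  simpa [M, U, Subtype.ext_iff] using this

theorem sum_neg_one_pow_mul_choose_mul_choose_sub (n : ℕ) : ∀ M r : ℕ, r < n → n ≤ M →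
    ∑ l ∈ Finset.range (n + 1), (-1 : ℝ) ^ l * n.choose l * (M - l).choose r = 0 := by
  induction n with
  | zero => intro M r h; omega
  | succ n ih =>
    intro M r hr hM
    have key : ∑ l ∈ Finset.range (n + 2), (-1 : ℝ) ^ l * (n + 1).choose l * (M - l).choose r
        = ∑ l ∈ Finset.range (n + 1), (-1 : ℝ) ^ l * n.choose l * ((M - l).choose r
          - (M - 1 - l).choose r : ℝ) := by
      have h2 : ∀ l ∈ Finset.range (n + 1), (-1 : ℝ) ^ (l + 1) * (n + 1).choose (l + 1)
            * (M - (l + 1)).choose r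
          = (-1 : ℝ) ^ (l + 1) * n.choose (l + 1) * (M - (l + 1)).choose r
            - (-1 : ℝ) ^ l * n.choose l * (M - 1 - l).choose r := by
        intro l _
        rw [Nat.choose_succ_succ n l, show M - (l + 1) = M - 1 - l by omega]
        push_cast
        ring
      rw [Finset.sum_range_succ', Finset.sum_congr rfl h2, Finset.sum_sub_distrib]
      have h3 := Finset.sum_range_succ'
        (fun l => (-1 : ℝ) ^ l * n.choose l * (M - l).choose r) (n + 1)
      rw [Finset.sum_range_succ] at h3
      simp only [Nat.choose_succ_self, Nat.cast_zero, mul_zero, zero_mul, add_zero] at h3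
      simp only [mul_sub, Finset.sum_sub_distrib]
      rw [h3]
      simp
      ring
    rw [key]
    rcases r with _ | r
    · simp
    · have h4 : ∀ l ∈ Finset.range (n + 1), (-1 : ℝ) ^ l * n.choose l * ((M - l).choose (r + 1)
          - (M - 1 - l).choose (r + 1) : ℝ) = (-1 : ℝ) ^ l * n.choose l * (M - 1 - l).choose r := by
        intro l hl
        rw [Finset.mem_range] at hl
        rw [show M - l = (M - 1 - l) + 1 by omega, Nat.choose_succ_succ]
        push_cast
        ring
      rw [Finset.sum_congr rfl h4]
      exact ih (M - 1) r (by omega) (by omega)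

/-- The coefficients recovering a weight on `t`-sets from its sums over `k`-sets. -/
noncomputable def decodeCoeff (k t j : ℕ) : ℝ :=
  (-1) ^ (t - j) * (k - 1 - j).choose (t - j) / (t.choose j * k.choose t)

theorem sum_choose_mul_decodeCoeff {k t n : ℕ} (htk : t < k) (hn : n ≤ t) :
    ∑ l ∈ Finset.range (n + 1), (n.choose l : ℝ) *
      (decodeCoeff k t (t - n + l) * (k - n).choose (t - n + l)) = if n = 0 then 1 else 0 := by
  rcases Nat.eq_zero_or_pos n with rfl | hpos
  · have : (k.choose t : ℝ) ≠ 0 := by exact_mod_cast (Nat.choose_pos htk.le).ne'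
    simp [decodeCoeff, this]
  rw [if_neg hpos.ne']
  have h1 : ∀ l ∈ Finset.range (n + 1), (n.choose l : ℝ) *
      (decodeCoeff k t (t - n + l) * (k - n).choose (t - n + l))
      = ((-1) ^ n * ((n - 1).factorial * (k - n).factorial)
          / ((k - 1 - t).factorial * t.factorial * k.choose t))
        * ((-1 : ℝ) ^ l * n.choose l * (k - 1 - t + n - l).choose (n - 1)) := by
    intro l hl
    rw [Finset.mem_range] at hl
    set j := t - n + l with hj
    have hk0 : (k.choose t : ℝ) ≠ 0 := by exact_mod_cast (Nat.choose_pos htk.le).ne'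
    have hs : (-1 : ℝ) ^ (t - j) = (-1) ^ n * (-1) ^ l := by
      rw [show t - j = n - l by omega, ← pow_add, show n + l = (n - l) + 2 * l by omega, pow_add,
        pow_mul]
      simp
    have e : k - 1 - t + n - l = k - 1 - j := by omega
    unfold decodeCoeff
    rw [hs, e]
    rcases Nat.lt_or_ge (k - n) j with hlt | hge
    · rw [Nat.choose_eq_zero_of_lt hlt, Nat.choose_eq_zero_of_lt (show k - 1 - j < n - 1 by omega)]
      simp
    · have c1 : ((k - 1 - j).choose (t - j) : ℝ) = (k - 1 - j).factorial
          / ((t - j).factorial * (k - 1 - t).factorial) := by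
        rw [Nat.cast_choose ℝ (by omega), show k - 1 - j - (t - j) = k - 1 - t by omega]
      have c2 : ((k - n).choose j : ℝ) = (k - n).factorial
          / (j.factorial * (k - n - j).factorial) := Nat.cast_choose ℝ hge
      have c3 : (t.choose j : ℝ) = t.factorial / (j.factorial * (t - j).factorial) :=
        Nat.cast_choose ℝ (by omega)
      have c4 : ((k - 1 - j).choose (n - 1) : ℝ) = (k - 1 - j).factorial
          / ((n - 1).factorial * (k - n - j).factorial) := by
        rw [Nat.cast_choose ℝ (by omega), show k - 1 - j - (n - 1) = k - n - j by omega]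
      rw [c1, c2, c3, c4]
      have f : ∀ i : ℕ, (i.factorial : ℝ) ≠ 0 := fun i => by
        exact_mod_cast i.factorial_ne_zero
      have := f (t - j)
      have := f (k - 1 - t)
      have := f j
      have := f (k - n - j)
      have := f t
      have := f (n - 1)
      field_simp
  rw [Finset.sum_congr rfl h1, ← Finset.mul_sum,
    sum_neg_one_pow_mul_choose_mul_choose_sub n _ _ (by omega) (by omega), mul_zero]

open Finset in
theorem sum_powerset_filter_superset {α : Type*} [DecidableEq α] {A P : Finset α} (hP : P ⊆ A)
    (g : ℕ → ℝ) : ∑ a ∈ A.powerset, (if P ⊆ a then g (#a) else 0)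
      = ∑ l ∈ range (#A - #P + 1), ((#A - #P).choose l : ℝ) * g (#P + l) := by
  have h1 : ∑ a ∈ A.powerset, (if P ⊆ a then g (#a) else 0)
      = ∑ a ∈ (A \ P).powerset, g (#P + #a) := by
    rw [← sum_filter]
    refine sum_bij' (fun a _ => a \ P) (fun a _ => P ∪ a) ?_ ?_ ?_ ?_ ?_
    · intro a ha
      rw [mem_filter, mem_powerset] at ha
      exact mem_powerset.2 (sdiff_subset_sdiff ha.1 subset_rfl)
    · intro a ha
      rw [mem_powerset] at ha
      rw [mem_filter, mem_powerset]
      exact ⟨union_subset hP (ha.trans sdiff_subset), subset_union_left⟩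
    · intro a ha
      rw [mem_filter, mem_powerset] at ha
      exact union_sdiff_of_subset ha.2
    · intro a ha
      rw [mem_powerset] at ha
      rw [union_sdiff_left, sdiff_eq_self_of_disjoint (disjoint_of_subset_left ha sdiff_disjoint)]
    · intro a ha
      rw [mem_filter, mem_powerset] at ha
      rw [card_sdiff_of_subset ha.2, Nat.add_sub_cancel' (card_le_card ha.2)]
  rw [h1, sum_powerset_apply_card (fun i => g (#P + i)), card_sdiff_of_subset hP]
  simp [nsmul_eq_mul]

open Finset in
/-- Local decoding: a weight on `t`-sets from the sums over `k`-sets inside `A ∪ C`. -/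
theorem eq_sum_decodeCoeff {α : Type*} [DecidableEq α] {k t : ℕ} (htk : t < k)
    (θ : Finset α → ℝ) {A C : Finset α} (hA : #A = t) (hC : #C = k) (hAC : Disjoint A C) :
    θ A = ∑ a ∈ A.powerset, ∑ e ∈ C.powersetCard #a,
      decodeCoeff k t #a * ∑ A' ∈ (a ∪ C \ e).powersetCard t, θ A' := by
  have h1 : ∀ a ∈ A.powerset, ∀ e ∈ C.powersetCard #a,
      decodeCoeff k t #a * ∑ A' ∈ (a ∪ C \ e).powersetCard t, θ A'
      = ∑ A' ∈ (A ∪ C).powersetCard t, θ A' *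
          (if A' ∩ A ⊆ a then if Disjoint A' e then decodeCoeff k t #a else 0 else 0) := by
    intro a ha e he
    rw [mem_powerset] at ha
    rw [mem_powersetCard] at he
    rw [mul_sum]
    have : (a ∪ C \ e).powersetCard t = ((A ∪ C).powersetCard t).filter
        fun A' => A' ∩ A ⊆ a ∧ Disjoint A' e := by
      ext A'
      simp only [mem_powersetCard, mem_filter]
      constructor
      · rintro ⟨h, h2⟩
        refine ⟨⟨h.trans (union_subset_union ha sdiff_subset), h2⟩, ?_, ?_⟩
        · intro i hi
          rw [mem_inter] at hi
          have := h hi.1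
          rw [mem_union, mem_sdiff] at this
          rcases this with h3 | h3
          · exact h3
          · exact absurd h3.1 (disjoint_left.1 hAC hi.2)
        · rw [disjoint_left]
          intro i hi hie
          have := h hi
          rw [mem_union, mem_sdiff] at this
          rcases this with h3 | h3
          · exact disjoint_left.1 hAC (ha h3) (he.1 hie)
          · exact h3.2 hie
      · rintro ⟨⟨h, h2⟩, h3, h4⟩
        refine ⟨fun i hi => ?_, h2⟩
        rw [mem_union, mem_sdiff]
        rcases mem_union.1 (h hi) with h5 | h5
        · exact Or.inl (h3 (mem_inter.2 ⟨hi, h5⟩))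
        · exact Or.inr ⟨h5, disjoint_left.1 h4 hi⟩
    rw [this, sum_filter]
    refine sum_congr rfl fun A' _ => ?_
    by_cases h3 : A' ∩ A ⊆ a <;> by_cases h4 : Disjoint A' e <;> simp [h3, h4, mul_comm]
  rw [sum_congr rfl fun a ha => sum_congr rfl (h1 a ha)]
  have h2 : ∀ A' ∈ (A ∪ C).powersetCard t,
      ∑ a ∈ A.powerset, ∑ e ∈ C.powersetCard #a,
        (if A' ∩ A ⊆ a then if Disjoint A' e then decodeCoeff k t #a else 0 else 0)
      = if A' = A then 1 else 0 := by
    intro A' hA'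
    rw [mem_powersetCard] at hA'
    have hn : #(A' ∩ C) = t - #(A' ∩ A) := by
      have : #(A' ∩ A) + #(A' ∩ C) = t := by
        rw [← card_union_of_disjoint (disjoint_of_subset_left inter_subset_right
          (disjoint_of_subset_right inter_subset_right hAC)), ← inter_union_distrib_left,
          inter_eq_left.2 hA'.1, hA'.2]
      omega
    have hp : #(A' ∩ A) ≤ t := (card_le_card inter_subset_right).trans hA.le
    have h3 : ∀ a ∈ A.powerset, ∑ e ∈ C.powersetCard #a,
        (if A' ∩ A ⊆ a then if Disjoint A' e then decodeCoeff k t #a else 0 else 0)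
        = if A' ∩ A ⊆ a then (fun j => decodeCoeff k t j
          * ((k - (t - #(A' ∩ A))).choose j : ℝ)) #a else 0 := by
      intro a _
      by_cases h4 : A' ∩ A ⊆ a
      · simp only [h4, if_true]
        rw [← sum_filter, sum_const, nsmul_eq_mul, mul_comm]
        congr 2
        have : (C.powersetCard #a).filter (fun e => Disjoint A' e)
            = (C \ (A' ∩ C)).powersetCard #a := by
          ext e
          simp only [mem_filter, mem_powersetCard, subset_sdiff]
          constructor
          · rintro ⟨⟨h5, h6⟩, h7⟩
            exact ⟨⟨h5, (disjoint_of_subset_left inter_subset_left h7).symm⟩, h6⟩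
          · rintro ⟨⟨h5, h7⟩, h6⟩
            refine ⟨⟨h5, h6⟩, disjoint_left.2 fun i hi hie => ?_⟩
            exact disjoint_left.1 h7 hie (mem_inter.2 ⟨hi, h5 hie⟩)
        rw [this, card_powersetCard, card_sdiff_of_subset inter_subset_right, hC, hn]
      · simp [h4]
    rw [sum_congr rfl h3, sum_powerset_filter_superset inter_subset_right (fun j => decodeCoeff k t j
      * ((k - (t - #(A' ∩ A))).choose j : ℝ)), hA]
    have h5 := sum_choose_mul_decodeCoeff htk (n := t - #(A' ∩ A)) (by omega)
    rw [show t - (t - #(A' ∩ A)) = #(A' ∩ A) by omega] at h5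
    rw [h5]
    have h6 : t - #(A' ∩ A) = 0 ↔ A' = A := by
      constructor
      · intro h
        have h7 : A' ∩ A = A' := eq_of_subset_of_card_le inter_subset_left (by omega)
        have h8 : A' ∩ A = A := eq_of_subset_of_card_le inter_subset_right (by omega)
        rw [← h7, h8]
      · rintro rfl
        simp [hA]
    simp only [h6]
  symm
  calc _ = ∑ A' ∈ (A ∪ C).powersetCard t, θ A' * ∑ a ∈ A.powerset, ∑ e ∈ C.powersetCard #a,
        (if A' ∩ A ⊆ a then if Disjoint A' e then decodeCoeff k t #a else 0 else 0) := by
        simp only [mul_sum]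
        rw [sum_comm]
        exact sum_congr rfl fun a _ => sum_comm
    _ = θ A := by
        rw [sum_congr rfl fun A' hA' => by rw [h2 A' hA']]
        simp only [mul_ite, mul_one, mul_zero]
        rw [sum_ite_eq', if_pos]
        rw [mem_powersetCard]
        exact ⟨subset_union_left, hA⟩

open Finset in
theorem exists_sum_decode_le {α : Type*} [DecidableEq α] {V A : Finset α} {k : ℕ} (hA : A ⊆ V)
    (hk : k + #A ≤ #V) (u : Finset α → ℝ) (hu : ∀ b, 0 ≤ u b) :
    ∃ C ∈ (V \ A).powersetCard k,
      ((#V - #A).choose k : ℝ) * ∑ a ∈ A.powerset, ∑ e ∈ C.powersetCard #a, u (a ∪ C \ e)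
        ≤ #(V.powerset.filter fun e => #e ≤ #A) * ∑ b ∈ V.powersetCard k, u b := by
  have hcard : #((V \ A).powersetCard k) = (#V - #A).choose k := by
    rw [card_powersetCard, card_sdiff_of_subset hA]
  have hmain : ∑ C ∈ (V \ A).powersetCard k,
      ∑ a ∈ A.powerset, ∑ e ∈ C.powersetCard #a, u (a ∪ C \ e)
      ≤ #(V.powerset.filter fun e => #e ≤ #A) * ∑ b ∈ V.powersetCard k, u b := by
    set E := V.powerset.filter fun e => #e ≤ #A
    have h1 : (#E : ℝ) * ∑ b ∈ V.powersetCard k, u b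
        = ∑ y ∈ V.powersetCard k ×ˢ E, u y.1 := by
      rw [sum_product, mul_sum]
      simp
    set s := ((V \ A).powersetCard k).sigma fun C =>
      A.powerset.sigma fun a => C.powersetCard #a with hs
    have h2 : ∑ C ∈ (V \ A).powersetCard k,
        ∑ a ∈ A.powerset, ∑ e ∈ C.powersetCard #a, u (a ∪ C \ e)
        = ∑ x ∈ s, u (x.2.1 ∪ x.1 \ x.2.2) := by
      rw [hs, sum_sigma]
      refine sum_congr rfl fun C _ => ?_
      rw [sum_sigma]
    rw [h1, h2]
    set g : (Σ _ : Finset α, Σ _ : Finset α, Finset α) → Finset α × Finset α :=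
      fun x => (x.2.1 ∪ x.1 \ x.2.2, x.2.2) with hg
    have hmem : ∀ x ∈ s, x.1 ⊆ V ∧ Disjoint x.1 A ∧ #x.1 = k ∧ x.2.1 ⊆ A ∧ x.2.2 ⊆ x.1
        ∧ #x.2.2 = #x.2.1 := by
      intro x hx
      rw [hs, mem_sigma, mem_sigma, mem_powersetCard, mem_powerset, mem_powersetCard,
        subset_sdiff] at hx
      exact ⟨hx.1.1.1, hx.1.1.2, hx.1.2, hx.2.1, hx.2.2.1, hx.2.2.2⟩
    have hinj : Set.InjOn g s := by
      rintro ⟨C, a, e⟩ hx ⟨C', a', e'⟩ hx' h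
      obtain ⟨_, h2, -, h4, h5, -⟩ := hmem _ hx
      obtain ⟨_, h2', -, h4', h5', -⟩ := hmem _ hx'
      simp only [hg, Prod.mk.injEq] at h h2 h4 h5 h2' h4' h5'
      obtain ⟨h6, rfl⟩ := h
      have key : ∀ {C a : Finset α}, Disjoint C A → a ⊆ A → e ⊆ C →
          (a ∪ C \ e) ∩ A = a ∧ (a ∪ C \ e) \ A ∪ e = C := by
        intro C a h7 h8 h9
        constructor
        · rw [union_inter_distrib_right, inter_eq_left.2 h8,
            disjoint_iff_inter_eq_empty.1 (disjoint_of_subset_left sdiff_subset h7), union_empty]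
        · rw [union_sdiff_distrib, sdiff_eq_empty_iff_subset.2 h8, empty_union,
            sdiff_eq_self_of_disjoint (disjoint_of_subset_left sdiff_subset h7),
            sdiff_union_of_subset h9]
      have k1 := key h2 h4 h5
      have k2 := key h2' h4' h5'
      rw [h6] at k1
      obtain rfl : a = a' := k1.1.symm.trans k2.1
      obtain rfl : C = C' := k1.2.symm.trans k2.2
      rfl
    calc _ = ∑ y ∈ s.image g, u y.1 := (sum_image hinj).symm
      _ ≤ _ := by
        refine sum_le_sum_of_subset_of_nonneg ?_ fun _ _ _ => hu _
        intro y hy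
        obtain ⟨x, hx, rfl⟩ := mem_image.1 hy
        obtain ⟨h1, h2, h3, h4, h5, h6⟩ := hmem x hx
        rw [mem_product, mem_powersetCard, mem_filter, mem_powerset]
        refine ⟨⟨union_subset (h4.trans hA) (sdiff_subset.trans h1), ?_⟩, h5.trans h1, ?_⟩
        · rw [card_union_of_disjoint (disjoint_of_subset_left h4 (disjoint_of_subset_right
            sdiff_subset h2.symm)), card_sdiff_of_subset h5, h6, h3]
          have := card_le_card h5
          omega
        · change #x.2.2 ≤ #A
          rw [h6]
          exact card_le_card h4
  have hne : ((V \ A).powersetCard k).Nonempty := by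
    rw [powersetCard_nonempty, card_sdiff_of_subset hA]
    omega
  by_contra! hcon
  have h3 := sum_lt_sum_of_nonempty hne hcon
  rw [← mul_sum, sum_const, nsmul_eq_mul, hcard] at h3
  have : (0 : ℝ) < (#V - #A).choose k := by
    exact_mod_cast Nat.choose_pos (by omega)
  rw [← mul_sum] at h3
  nlinarith

open Finset in
theorem StdFamily.incl_eq_sum {α : Type*} [DecidableEq α] {V : Finset α} {F : Finset (Finset α)}
    (h : StdFamily V F) {t k : ℕ} (ht : 2 * t ≤ #V) :
    ∃ c : Finset α → Finset α → ℤ, ∀ A ∈ V.powersetCard t, ∀ b ∈ V.powersetCard k,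
      incl ℤ A b = ∑ S ∈ F.filter (fun S => #S ≤ t), c A S * incl ℤ S b := by
  obtain ⟨c, hc, -⟩ := h.exists_inverse (k := t) (by omega)
  rw [show min t (#V - t) = t by omega] at hc
  refine ⟨fun A S => c A S * (k - #S).choose (t - #S), fun A hA b hb => ?_⟩
  rw [mem_powersetCard] at hA hb
  have h1 : ∑ b' ∈ b.powersetCard t, ∑ S ∈ F.filter (fun S => #S ≤ t), c A S * incl ℤ S b'
      = incl ℤ A b := by
    rw [sum_congr rfl fun b' hb' => hc b' (mem_powersetCard.2
      ⟨(mem_powersetCard.1 hb').1.trans hb.1, (mem_powersetCard.1 hb').2⟩) A]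
    rw [sum_ite_eq]
    unfold incl
    simp [mem_powersetCard, hA.2]
  rw [← h1, sum_comm]
  refine sum_congr rfl fun S hS => ?_
  rw [← mul_sum, mul_assoc]
  congr 1
  unfold incl
  by_cases hSb : S ⊆ b
  · rw [if_pos hSb, mul_one, ← sum_filter, sum_const, nsmul_eq_mul, mul_one]
    congr 1
    rw [← hb.2]
    exact_mod_cast (card_filter_powersetCard_subset _ _ _ hSb (mem_filter.1 hS).2)
  · rw [if_neg hSb, mul_zero]
    refine sum_eq_zero fun b' hb' => if_neg fun h => hSb (h.trans (mem_powersetCard.1 hb').1)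

open Finset in
theorem exists_sum_powersetCard_eq {α : Type*} [DecidableEq α]
    (F : Finset (Finset α)) {t k : ℕ} (htk : t ≤ k)
    (θ : Finset α → ℝ) : ∃ θ' : Finset α → ℝ, ∀ b : Finset α, #b = k →
      ∑ A ∈ b.powersetCard t, θ' A = ∑ S ∈ F.filter (fun S => #S ≤ t), θ S * incl ℝ S b := by
  refine ⟨fun A => ∑ S ∈ F.filter (fun S => #S ≤ t),
    θ S / (k - #S).choose (t - #S) * incl ℝ S A, fun b hb => ?_⟩
  rw [sum_comm]
  refine sum_congr rfl fun S hS => ?_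
  rw [mem_filter] at hS
  rw [← mul_sum]
  unfold incl
  by_cases hSb : S ⊆ b
  · rw [if_pos hSb, mul_one, ← sum_filter, sum_const, nsmul_eq_mul, mul_one,
      card_filter_powersetCard_subset _ _ _ hSb hS.2, hb, div_mul_cancel₀]
    exact_mod_cast (Nat.choose_pos (by omega)).ne'
  · rw [if_neg hSb, mul_zero, sum_eq_zero, mul_zero]
    exact fun b' hb' => if_neg fun h => hSb (h.trans (mem_powersetCard.1 hb').1)

theorem abs_decodeCoeff_le_one {k t j : ℕ} (htk : t < k) (hj : j ≤ t) :
    |decodeCoeff k t j| ≤ 1 := by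
  unfold decodeCoeff
  rw [abs_div, abs_mul, abs_pow, abs_neg, abs_one, one_pow, one_mul, Nat.abs_cast,
    abs_of_nonneg (by positivity)]
  refine div_le_one_of_le₀ ?_ (by positivity)
  have h1 : (k - 1 - j).choose (t - j) ≤ (k - j).choose (t - j) :=
    Nat.choose_le_choose _ (by omega)
  have h2 : k.choose t * t.choose j = k.choose j * (k - j).choose (t - j) :=
    Nat.choose_mul (n := k) hj
  have h3 : 1 ≤ k.choose j := Nat.choose_pos (by omega)
  have : (k - 1 - j).choose (t - j) ≤ t.choose j * k.choose t := by nlinarith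
  exact_mod_cast this

theorem exists_int_eq_mul_decodeCoeff {k t : ℕ} (htk : t < k) : ∃ z : ℕ → ℤ, ∀ j ≤ t,
    (Nat.lcmUpto t * k.choose t : ℝ) * decodeCoeff k t j = z j := by
  have : ∀ j, ∃ z : ℤ, j ≤ t →
      (Nat.lcmUpto t * k.choose t : ℝ) * decodeCoeff k t j = z := by
    intro j
    by_cases hj : j ≤ t
    · obtain ⟨r, hr⟩ := Chebyshev.choose_dvd_lcmUpto hj
      refine ⟨(-1) ^ (t - j) * (k - 1 - j).choose (t - j) * r, fun _ => ?_⟩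
      unfold decodeCoeff
      have h1 : (t.choose j : ℝ) ≠ 0 := by exact_mod_cast (Nat.choose_pos hj).ne'
      have h2 : (k.choose t : ℝ) ≠ 0 := by exact_mod_cast (Nat.choose_pos htk.le).ne'
      rw [hr]
      push_cast
      field_simp
    · exact ⟨0, fun h => absurd h hj⟩
  choose z hz using this
  exact ⟨z, fun j hj => hz j hj⟩

/-- The functions of degree at most `t` on finite sets with values in the group `M`. -/
def degLE {α : Type*} [DecidableEq α] (M : Type*) [AddCommGroup M] (t : ℕ) :
    AddSubgroup (Finset α → M) :=
  AddSubgroup.closure {h | ∃ (S : Finset α) (m : M), S.card ≤ t ∧ h = fun b => if S ⊆ b then m else 0}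

theorem exists_diff_mem_degLE {α : Type*} [DecidableEq α] {M : Type*} [AddCommGroup M] {t : ℕ}
    {h : Finset α → M} (hh : h ∈ degLE M (t + 1)) {x y : α} (hxy : x ≠ y) :
    ∃ h' ∈ degLE M t, ∀ R : Finset α, x ∉ R → y ∉ R → h (insert x R) - h (insert y R) = h' R := by
  induction hh using AddSubgroup.closure_induction with
  | mem h hh =>
    obtain ⟨S, m, hS, rfl⟩ := hh
    have hmem : ∀ z ∈ S, ∀ m : M, (fun b => if S.erase z ⊆ b then m else 0) ∈ degLE (α := α) M t := by
      intro z hz m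
      refine AddSubgroup.subset_closure ⟨S.erase z, m, ?_, rfl⟩
      rw [Finset.card_erase_of_mem hz]
      omega
    by_cases hx : x ∈ S
    · by_cases hy : y ∈ S
      · refine ⟨0, zero_mem _, fun R hxR hyR => ?_⟩
        have h1 : ¬ S ⊆ insert x R := fun h => by
          have := h hy
          simp [hyR, hxy.symm] at this
        have h2 : ¬ S ⊆ insert y R := fun h => by
          have := h hx
          simp [hxR, hxy] at this
        simp [h1, h2]
      · refine ⟨_, hmem x hx m, fun R hxR hyR => ?_⟩
        have h2 : ¬ S ⊆ insert y R := fun h => by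
          have := h hx
          simp [hxR, hxy] at this
        simp only [h2, if_false, sub_zero, Finset.subset_insert_iff]
    · by_cases hy : y ∈ S
      · refine ⟨_, hmem y hy (-m), fun R hxR hyR => ?_⟩
        have h2 : ¬ S ⊆ insert x R := fun h => by
          have := h hy
          simp [hyR, hxy.symm] at this
        simp only [h2, if_false, zero_sub, Finset.subset_insert_iff]
        split_ifs <;> simp
      · refine ⟨0, zero_mem _, fun R hxR hyR => ?_⟩
        simp [Finset.subset_insert_iff_of_notMem hx, Finset.subset_insert_iff_of_notMem hy]
  | zero => exact ⟨0, zero_mem _, by simp⟩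
  | add f g _ _ hf hg =>
    obtain ⟨f', hf', hf⟩ := hf
    obtain ⟨g', hg', hg⟩ := hg
    refine ⟨f' + g', add_mem hf' hg', fun R hx hy => ?_⟩
    simp only [Pi.add_apply, ← hf R hx hy, ← hg R hx hy]
    abel
  | neg f _ hf =>
    obtain ⟨f', hf', hf⟩ := hf
    refine ⟨-f', neg_mem hf', fun R hx hy => ?_⟩
    simp only [Pi.neg_apply, ← hf R hx hy]
    abel

theorem eq_of_mem_degLE_zero {α : Type*} [DecidableEq α] {M : Type*} [AddCommGroup M]
    {h : Finset α → M} (hh : h ∈ degLE M 0) (b b' : Finset α) : h b = h b' := by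
  induction hh using AddSubgroup.closure_induction with
  | mem h hh =>
    obtain ⟨S, m, hS, rfl⟩ := hh
    obtain rfl : S = ∅ := Finset.card_eq_zero.1 (by omega)
    simp
  | zero => rfl
  | add f g _ _ hf hg => simp [hf, hg]
  | neg f _ hf => simp [hf]

open Finset in
/-- A function on a slice that is invariant under swaps is constant. -/
theorem eq_of_swap_invariant {α : Type*} [DecidableEq α] {M : Type*} {V : Finset α} {k : ℕ}
    {h : Finset α → M}
    (hh : ∀ x ∈ V, ∀ y ∈ V, x ≠ y → ∀ R ∈ (V \ {x, y}).powersetCard (k - 1),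
      h (insert x R) = h (insert y R)) :
    ∀ n, ∀ b ∈ V.powersetCard k, ∀ b' ∈ V.powersetCard k, #(b \ b') = n → h b = h b' := by
  intro n
  induction n with
  | zero =>
    intro b hb b' hb' h0
    rw [card_eq_zero, sdiff_eq_empty_iff_subset] at h0
    rw [mem_powersetCard] at hb hb'
    rw [eq_of_subset_of_card_le h0 (by omega)]
  | succ n ih =>
    intro b hb b' hb' hn
    have hb1 := mem_powersetCard.1 hb
    have hb1' := mem_powersetCard.1 hb'
    obtain ⟨x, hx⟩ : (b \ b').Nonempty := card_pos.1 (by omega)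
    have hn' : #(b' \ b) = n + 1 := by
      rw [← hn]
      exact card_sdiff_comm (by omega)
    obtain ⟨y, hy⟩ : (b' \ b).Nonempty := card_pos.1 (by omega)
    rw [mem_sdiff] at hx hy
    have hxy : x ≠ y := fun e => hy.2 (e ▸ hx.1)
    have hyb : y ∉ b.erase x := fun h => hy.2 (mem_of_mem_erase h)
    have hkpos : 0 < #b := card_pos.2 ⟨x, hx.1⟩
    have h1 := hh x (hb1.1 hx.1) y (hb1'.1 hy.1) hxy (b.erase x) (by
      rw [mem_powersetCard, card_erase_of_mem hx.1, hb1.2]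
      refine ⟨fun z hz => ?_, rfl⟩
      have hz' := mem_erase.1 hz
      simp only [mem_sdiff, mem_insert, mem_singleton, not_or]
      exact ⟨hb1.1 hz'.2, hz'.1, fun e => hyb (e ▸ hz)⟩)
    rw [insert_erase hx.1] at h1
    rw [h1]
    refine ih _ ?_ b' hb' ?_
    · rw [mem_powersetCard, card_insert_of_notMem hyb, card_erase_of_mem hx.1]
      refine ⟨insert_subset (hb1'.1 hy.1) ((erase_subset _ _).trans hb1.1), by omega⟩
    · rw [insert_sdiff_of_mem _ hy.1, erase_sdiff_comm, card_erase_of_mem (mem_sdiff.2 hx), hn]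
      rfl

theorem choose_sub_two_mul_le {v k t : ℕ} (htk : t ≤ k) (htv : 2 * t ≤ v) :
    (v - 2 * t).choose (k - t) ≤ v.choose k := by
  have h : ∀ n m s : ℕ, n.choose m ≤ (n + s).choose (m + s) := by
    intro n m s
    induction s with
    | zero => rfl
    | succ s ih =>
      rw [← add_assoc, ← add_assoc, Nat.choose_succ_succ']
      omega
  calc (v - 2 * t).choose (k - t) ≤ (v - t).choose (k - t) := Nat.choose_le_choose _ (by omega)
    _ ≤ (v - t + t).choose (k - t + t) := h _ _ _
    _ = v.choose k := by rw [Nat.sub_add_cancel (by omega), Nat.sub_add_cancel htk]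

open Finset in
/-- A Schwartz–Zippel bound on a slice: a nonzero function of degree at most `t` has many
nonzero values. -/
theorem choose_le_card_ne_zero {α : Type*} [DecidableEq α] {M : Type*} [AddCommGroup M]
    [DecidableEq M] (t : ℕ) : ∀ (V : Finset α) (k : ℕ) (h : Finset α → M), h ∈ degLE M t → t ≤ k →
      2 * t ≤ #V → (∃ b ∈ V.powersetCard k, h b ≠ 0) →
      (#V - 2 * t).choose (k - t) ≤ #{b ∈ V.powersetCard k | h b ≠ 0} := by
  have hconst : ∀ (t : ℕ) (V : Finset α) (k : ℕ) (h : Finset α → M), t ≤ k → 2 * t ≤ #V →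
      (∃ b ∈ V.powersetCard k, h b ≠ 0) →
      (∀ b ∈ V.powersetCard k, ∀ b' ∈ V.powersetCard k, h b = h b') →
      (#V - 2 * t).choose (k - t) ≤ #{b ∈ V.powersetCard k | h b ≠ 0} := by
    rintro t V k h htk htV ⟨b, hb, hne⟩ hc
    rw [filter_true_of_mem fun b' hb' => by rwa [hc b' hb' b hb], card_powersetCard]
    exact choose_sub_two_mul_le htk htV
  induction t with
  | zero =>
    intro V k h hh htk htV hne
    exact hconst 0 V k h htk htV hne fun b _ b' _ => eq_of_mem_degLE_zero hh b b'
  | succ t ih =>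
    intro V k h hh htk htV hne
    by_cases hsw : ∀ x ∈ V, ∀ y ∈ V, x ≠ y → ∀ R ∈ (V \ {x, y}).powersetCard (k - 1),
      h (insert x R) = h (insert y R)
    · exact hconst _ V k h htk htV hne fun b hb b' hb' =>
        eq_of_swap_invariant hsw _ b hb b' hb' rfl
    push Not at hsw
    obtain ⟨x, hx, y, hy, hxy, R, hR, hneq⟩ := hsw
    obtain ⟨h', hh', hdiff⟩ := exists_diff_mem_degLE hh hxy
    have hnot : ∀ R ∈ (V \ {x, y}).powersetCard (k - 1), x ∉ R ∧ y ∉ R := by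
      intro R hR
      have := (mem_powersetCard.1 hR).1
      exact ⟨fun h => by simpa using this h, fun h => by simpa using this h⟩
    have hcV : #(V \ {x, y}) = #V - 2 := by
      rw [card_sdiff_of_subset (by simp [insert_subset_iff, hx, hy]), card_pair hxy]
    have h1 := ih (V \ {x, y}) (k - 1) h' hh' (by omega) (by omega)
      ⟨R, hR, by rw [← hdiff R (hnot R hR).1 (hnot R hR).2]; exact sub_ne_zero.2 hneq⟩
    rw [hcV, show #V - 2 - 2 * t = #V - 2 * (t + 1) by omega,
      show k - 1 - t = k - (t + 1) by omega] at h1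
    refine h1.trans ?_
    refine card_le_card_of_injOn
      (fun R => if h (insert x R) ≠ 0 then insert x R else insert y R) ?_ ?_
    · intro R hR
      obtain ⟨hR, hne'⟩ := mem_filter.1 (mem_coe.1 hR)
      obtain ⟨hxR, hyR⟩ := hnot R hR
      rw [← hdiff R hxR hyR] at hne'
      have hR' := mem_powersetCard.1 hR
      have hRV : R ⊆ V := hR'.1.trans sdiff_subset
      refine mem_coe.2 (mem_filter.2 ?_)
      by_cases h0 : h (insert x R) = 0
      · simp only [h0, ne_eq, not_true_eq_false, if_false]
        refine ⟨mem_powersetCard.2 ⟨insert_subset hy hRV, ?_⟩, fun h2 => hne' (by rw [h0, h2, sub_zero])⟩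
        rw [card_insert_of_notMem hyR, hR'.2]
        omega
      · simp only [h0, ne_eq, not_false_eq_true, if_true, and_true]
        refine mem_powersetCard.2 ⟨insert_subset hx hRV, ?_⟩
        rw [card_insert_of_notMem hxR, hR'.2]
        omega
    · intro R hR R' hR' heq
      obtain ⟨hxR, hyR⟩ := hnot R (mem_filter.1 (mem_coe.1 hR)).1
      obtain ⟨hxR', hyR'⟩ := hnot R' (mem_filter.1 (mem_coe.1 hR')).1
      have hrec : ∀ R : Finset α, x ∉ R → y ∉ R →
          ((if h (insert x R) ≠ 0 then insert x R else insert y R).erase x).erase y = R := by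
        intro R hxR hyR
        split_ifs
        · rw [erase_insert hxR, erase_eq_of_notMem hyR]
        · rw [erase_right_comm, erase_insert hyR, erase_eq_of_notMem hxR]
      rw [← hrec R hxR hyR, ← hrec R' hxR' hyR']
      exact congrArg (fun U : Finset α => (U.erase x).erase y) heq

/-- The range of parameters in which `Y` dominates all the auxiliary quantities. -/
structure Regime (v k t : ℕ) (Y : ℝ) : Prop where
  two_le : 2 ≤ Y
  lt : t < k
  add_le : k + t ≤ v
  lcm_le : (Nat.lcmUpto t : ℝ) ≤ Y ^ 4
  sum_choose_le : ∑ j ∈ Finset.range (t + 1), (v.choose j : ℝ) ≤ Y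
  choose_le : (v.choose (2 * t) * (2 * t).choose t : ℝ) ≤ Y ^ 3

theorem Regime.one_le {v k t : ℕ} {Y : ℝ} (R : Regime v k t Y) : 1 ≤ Y :=
  one_le_two.trans R.two_le

theorem Nat.choose_mul_choose_sub_comm {n a b : ℕ} (h : a + b ≤ n) :
    n.choose a * (n - a).choose b = n.choose b * (n - b).choose a := by
  have h2 := Nat.choose_mul (n := n) (k := a + b) (s := a) (by omega)
  have h3 := Nat.choose_mul (n := n) (k := a + b) (s := b) (by omega)
  rw [show a + b - a = b by omega] at h2
  rw [show a + b - b = a by omega] at h3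
  rw [← h2, ← h3, ← Nat.choose_symm_add]

theorem Regime.choose_le_self {v k t : ℕ} {Y : ℝ} (R : Regime v k t Y) :
    (v.choose t : ℝ) ≤ Y :=
  (Finset.single_le_sum (f := fun j => (v.choose j : ℝ)) (fun _ _ => by positivity)
    (Finset.self_mem_range_succ t)).trans R.sum_choose_le

open Finset in
theorem card_powerset_filter_card_le {α : Type*} [DecidableEq α] (V : Finset α) (t : ℕ) :
    #(V.powerset.filter fun e => #e ≤ t) = ∑ j ∈ range (t + 1), (#V).choose j := by
  rw [card_eq_sum_card_fiberwise (f := card) (t := range (t + 1))]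
  · refine sum_congr rfl fun j hj => ?_
    rw [← card_powersetCard]
    congr 1
    ext e
    simp only [mem_filter, mem_powerset, mem_powersetCard, mem_range] at hj ⊢
    constructor
    · rintro ⟨⟨h, -⟩, h2⟩
      exact ⟨h, h2⟩
    · rintro ⟨h, h2⟩
      exact ⟨⟨h, by omega⟩, h2⟩
  · intro e he
    have := (mem_filter.1 (mem_coe.1 he)).2
    simpa [Nat.lt_succ_iff] using this

open Finset in
theorem Regime.exists_sum_abs_le {α : Type*} [DecidableEq α] {V : Finset α} {k t : ℕ} {Y η : ℝ}
    (R : Regime #V k t Y) (hη : 0 ≤ η) (y : Finset α → ℝ)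
    (hy : ∑ b ∈ V.powersetCard k, y b ^ 2 ≤ η * (#V).choose k)
    {A : Finset α} (hA : A ∈ V.powersetCard t) :
    ∃ C ∈ (V \ A).powersetCard k,
      ∑ a ∈ A.powerset, ∑ e ∈ C.powersetCard #a, |y (a ∪ C \ e)| ≤ Y ^ 2 * √η := by
  rw [mem_powersetCard] at hA
  set u : Finset α → ℝ := fun b => y b ^ 2 with hu
  have hlt := R.lt
  have hle := R.add_le
  have hE : (#(V.powerset.filter fun e => #e ≤ t) : ℝ) ≤ Y := by
    rw [card_powerset_filter_card_le]
    exact_mod_cast R.sum_choose_le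
  obtain ⟨C, hC, hCle⟩ := exists_sum_decode_le (k := k) hA.1 (by omega) u fun b => sq_nonneg _
  rw [hA.2] at hCle
  refine ⟨C, hC, ?_⟩
  rw [mem_powersetCard, subset_sdiff] at hC
  have hY := R.one_le
  have hpos : (0 : ℝ) < (#V - t).choose k := by
    exact_mod_cast Nat.choose_pos (by omega)
  have hratio : ((#V).choose k : ℝ) ≤ Y * (#V - t).choose k := by
    have h1 := Nat.choose_mul_choose_sub_comm hle
    have h4 : 1 ≤ (#V - k).choose t := Nat.choose_pos (by omega)
    have h5 : (#V).choose k ≤ (#V).choose t * (#V - t).choose k := by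
      rw [← h1]
      exact Nat.le_mul_of_pos_right _ h4
    calc ((#V).choose k : ℝ) ≤ (#V).choose t * (#V - t).choose k := by exact_mod_cast h5
      _ ≤ _ := by
        gcongr
        exact R.choose_le_self
  have hsum : ∑ a ∈ A.powerset, ∑ e ∈ C.powersetCard #a, u (a ∪ C \ e) ≤ Y ^ 2 * η := by
    have h1 : ((#V - t).choose k : ℝ) *
        ∑ a ∈ A.powerset, ∑ e ∈ C.powersetCard #a, u (a ∪ C \ e)
        ≤ (#V - t).choose k * (Y ^ 2 * η) := by
      calc _ ≤ _ := hCle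
        _ ≤ Y * (η * (#V).choose k) := by
          gcongr
        _ ≤ Y * (η * (Y * (#V - t).choose k)) := by gcongr
        _ = _ := by ring
    exact le_of_mul_le_mul_left h1 hpos
  set s := A.powerset.sigma fun a => C.powersetCard #a with hs
  have hcard : (#s : ℝ) ≤ Y ^ 2 := by
    have h1 : #s ≤ #(V.powerset.filter fun e => #e ≤ t) * #(V.powerset.filter fun e => #e ≤ t) := by
      rw [← card_product]
      refine card_le_card_of_injOn (fun x => (x.1, x.2)) ?_ ?_
      · rintro ⟨a, e⟩ hx
        rw [mem_coe, hs, mem_sigma, mem_powerset, mem_powersetCard] at hx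
        simp only at hx
        rw [mem_coe, mem_product, mem_filter, mem_filter, mem_powerset, mem_powerset]
        have := card_le_card hx.1
        exact ⟨⟨hx.1.trans hA.1, by change #a ≤ t; omega⟩, hx.2.1.trans hC.1.1,
          by change #e ≤ t; omega⟩
      · rintro ⟨a, e⟩ _ ⟨a', e'⟩ _ h
        simp only [Prod.mk.injEq] at h
        obtain ⟨rfl, rfl⟩ := h
        rfl
    calc (#s : ℝ) ≤ #(V.powerset.filter fun e => #e ≤ t) * #(V.powerset.filter fun e => #e ≤ t) := by
          exact_mod_cast h1
      _ ≤ Y * Y := by gcongr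
      _ = Y ^ 2 := by ring
  rw [sum_sigma' A.powerset (fun a => C.powersetCard #a) fun a e => |y (a ∪ C \ e)|]
  refine abs_le_of_sq_le_sq' ?_ (by positivity) |>.2
  calc (∑ x ∈ s, |y (x.1 ∪ C \ x.2)|) ^ 2
      ≤ #s * ∑ x ∈ s, |y (x.1 ∪ C \ x.2)| ^ 2 :=
        sq_sum_le_card_mul_sum_sq
    _ ≤ Y ^ 2 * (Y ^ 2 * η) := by
        refine mul_le_mul hcard ?_ (sum_nonneg fun _ _ => by positivity) (by positivity)
        refine le_trans (le_of_eq ?_) hsum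
        rw [hs, sum_sigma]
        refine sum_congr rfl fun a _ => sum_congr rfl fun e _ => ?_
        rw [sq_abs]
    _ = (Y ^ 2 * √η) ^ 2 := by
        rw [mul_pow, Real.sq_sqrt hη]
        ring

open Finset in
/-- A function on `k`-sets that is close to an integer on average has `t`-set weights close to
rationals with a fixed denominator. -/
theorem Regime.abs_sub_round_le {α : Type*} [DecidableEq α] {V : Finset α} {k t : ℕ} {Y η : ℝ}
    (R : Regime #V k t Y) (hη : 0 ≤ η) (θ : Finset α → ℝ)
    (hθ : ∑ b ∈ V.powersetCard k, (∑ A ∈ b.powersetCard t, θ A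
      - round (∑ A ∈ b.powersetCard t, θ A)) ^ 2 ≤ η * (#V).choose k)
    {A : Finset α} (hA : A ∈ V.powersetCard t) :
    |(Nat.lcmUpto t * k.choose t : ℝ) * θ A
      - round ((Nat.lcmUpto t * k.choose t : ℝ) * θ A)|
      ≤ (Nat.lcmUpto t * k.choose t : ℝ) * (Y ^ 2 * √η) := by
  have hA' := hA
  rw [mem_powersetCard] at hA
  set m : ℝ := Nat.lcmUpto t * k.choose t with hm
  have hm0 : 0 ≤ m := by positivity
  set x : Finset α → ℝ := fun b => ∑ A ∈ b.powersetCard t, θ A with hx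
  have hlt := R.lt
  have hle := R.add_le
  obtain ⟨C, hC, hCle⟩ := R.exists_sum_abs_le hη (fun b => x b - round (x b)) hθ hA'
  rw [mem_powersetCard, subset_sdiff] at hC
  rw [sum_sigma' A.powerset (fun a => C.powersetCard #a)
    fun a e => |x (a ∪ C \ e) - round (x (a ∪ C \ e))|] at hCle
  set s := A.powerset.sigma fun a => C.powersetCard #a with hs
  obtain ⟨z, hz⟩ := exists_int_eq_mul_decodeCoeff hlt
  have hdec := eq_sum_decodeCoeff hlt θ hA.2 hC.2 hC.1.2.symm
  set Z : ℤ := ∑ a ∈ A.powerset, ∑ e ∈ C.powersetCard #a, z #a * round (x (a ∪ C \ e)) with hZ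
  have hdiff : m * θ A - Z = ∑ y ∈ s, m * decodeCoeff k t #y.1
      * (x (y.1 ∪ C \ y.2) - round (x (y.1 ∪ C \ y.2))) := by
    rw [hs, sum_sigma, hdec, hZ, mul_sum]
    push_cast
    rw [← sum_sub_distrib]
    refine sum_congr rfl fun a ha => ?_
    rw [mul_sum, ← sum_sub_distrib]
    refine sum_congr rfl fun e _ => ?_
    have := card_le_card (mem_powerset.1 ha)
    rw [← hz _ (by omega)]
    ring
  refine (round_le _ Z).trans ?_
  rw [hdiff]
  have habs : |∑ y ∈ s, m * decodeCoeff k t #y.1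
      * (x (y.1 ∪ C \ y.2) - round (x (y.1 ∪ C \ y.2)))|
      ≤ m * ∑ y ∈ s, |x (y.1 ∪ C \ y.2) - round (x (y.1 ∪ C \ y.2))| := by
    refine (abs_sum_le_sum_abs _ _).trans ?_
    rw [mul_sum]
    refine sum_le_sum fun y hy => ?_
    rw [hs, mem_sigma, mem_powerset] at hy
    have := card_le_card hy.1
    rw [abs_mul, abs_mul, abs_of_nonneg hm0]
    have := abs_decodeCoeff_le_one hlt (show #y.1 ≤ t by omega)
    have h0 := abs_nonneg (x (y.1 ∪ C \ y.2) - round (x (y.1 ∪ C \ y.2)))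
    calc _ ≤ m * 1 * |x (y.1 ∪ C \ y.2) - round (x (y.1 ∪ C \ y.2))| := by gcongr
      _ = _ := by ring
  exact habs.trans (mul_le_mul_of_nonneg_left hCle hm0)

open Finset in
theorem StdFamily.exists_int_eq {α : Type*} [DecidableEq α] {V : Finset α}
    {F : Finset (Finset α)} (h : StdFamily V F) {t k : ℕ} (htk : t ≤ k) (hkt : k + t ≤ #V)
    (γ : Finset α → ℝ) (w : Finset α → ℤ)
    (hw : ∀ b ∈ V.powersetCard k, ∑ S ∈ F.filter (fun S => #S ≤ t), γ S * incl ℝ S b = w b) :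
    ∃ z : Finset α → ℤ, ∀ S ∈ F.filter (fun S => #S ≤ t), γ S = z S := by
  obtain ⟨c, -, hc⟩ := h.exists_inverse k (by omega)
  refine ⟨fun S => ∑ b ∈ V.powersetCard k, w b * c b S, fun S' hS' => ?_⟩
  have hsub : ∀ S ∈ F.filter (fun S => #S ≤ t), S ∈ F.filter fun S => #S ≤ min k (#V - k) := by
    intro S hS
    rw [mem_filter] at hS ⊢
    exact ⟨hS.1, by omega⟩
  push_cast
  rw [sum_congr rfl fun b hb => by rw [← hw b hb, sum_mul], sum_comm]
  have : ∀ S ∈ F.filter (fun S => #S ≤ t), ∑ b ∈ V.powersetCard k, γ S * incl ℝ S b * (c b S' : ℝ)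
      = if S = S' then γ S else 0 := by
    intro S hS
    have h1 := congrArg (Int.cast (R := ℝ)) (hc S (hsub S hS) S' (hsub S' hS'))
    push_cast [intCast_incl] at h1
    simp only [mul_assoc]
    rw [← mul_sum, h1]
    simp
  rw [sum_congr rfl this, sum_ite_eq', if_pos hS']

open Finset in
theorem sum_powersetCard_mem_degLE {α : Type*} [DecidableEq α] {M : Type*} [AddCommGroup M]
    (t : ℕ) (V : Finset α) (g : Finset α → M) :
    (fun b => ∑ A ∈ V.powersetCard t, if A ⊆ b then g A else 0) ∈ degLE M t := by
  have : (fun b => ∑ A ∈ V.powersetCard t, if A ⊆ b then g A else 0)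
      = ∑ A ∈ V.powersetCard t, fun b => if A ⊆ b then g A else 0 := by
    ext b
    simp
  rw [this]
  refine AddSubgroup.sum_mem _ fun A hA => AddSubgroup.subset_closure ?_
  exact ⟨A, g A, (mem_powersetCard.1 hA).2.le, rfl⟩

open Finset in
/-- If a low-degree function on the slice is close to an integer on average, it is uniformly
close to an integral low-degree function. -/
theorem StdFamily.exists_int_approx {α : Type*} [DecidableEq α] {V : Finset α}
    {F : Finset (Finset α)} (h : StdFamily V F) {t k : ℕ} {Y : ℝ} (R : Regime #V k t Y)
    (θ : Finset α → ℝ)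
    (hθ : ∑ b ∈ V.powersetCard k, (∑ S ∈ F.filter (fun S => #S ≤ t), θ S * incl ℝ S b
      - round (∑ S ∈ F.filter (fun S => #S ≤ t), θ S * incl ℝ S b)) ^ 2
      ≤ 1 / (16 * Y ^ 40) * (#V).choose k) :
    ∃ z : Finset α → ℤ, ∀ b ∈ V.powersetCard k,
      |∑ S ∈ F.filter (fun S => #S ≤ t), (θ S - z S) * incl ℝ S b| ≤ 1 / (4 * Y ^ 17) := by
  have hlt := R.lt
  have hle := R.add_le
  have hY := R.one_le
  have hY0 : 0 < Y := by linarith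
  set I := F.filter fun S => #S ≤ t with hI
  obtain ⟨θ', hθ'⟩ := exists_sum_powersetCard_eq F hlt.le θ
  set x : Finset α → ℝ := fun b => ∑ S ∈ I, θ S * incl ℝ S b with hx
  have hx' : ∀ b ∈ V.powersetCard k, ∑ A ∈ b.powersetCard t, θ' A = x b :=
    fun b hb => hθ' b (mem_powersetCard.1 hb).2
  set m : ℕ := Nat.lcmUpto t * k.choose t with hm
  have hm0 : 0 < m := Nat.mul_pos (Nat.lcmUpto_pos t) (Nat.choose_pos hlt.le)
  have hmR : (0 : ℝ) < m := by exact_mod_cast hm0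
  have hkY : (k.choose t : ℝ) ≤ Y :=
    le_trans (by exact_mod_cast Nat.choose_le_choose t (by omega)) R.choose_le_self
  have hmY : (m : ℝ) ≤ Y ^ 5 := by
    rw [hm]
    push_cast
    calc _ ≤ Y ^ 4 * Y := mul_le_mul R.lcm_le hkY (by positivity) (by positivity)
      _ = Y ^ 5 := by ring
  have hsqrt : √(1 / (16 * Y ^ 40)) = 1 / (4 * Y ^ 20) := by
    rw [show 1 / (16 * Y ^ 40) = (1 / (4 * Y ^ 20)) ^ 2 by ring, Real.sqrt_sq (by positivity)]
  have hround : ∀ A ∈ V.powersetCard t, |m * θ' A - round (m * θ' A)| ≤ m * (1 / (4 * Y ^ 18)) := by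
    intro A hA
    have h1 := R.abs_sub_round_le (η := 1 / (16 * Y ^ 40)) (by positivity) θ' (by
      rw [sum_congr rfl fun b hb => by rw [hx' b hb]]
      exact hθ) hA
    rw [hsqrt] at h1
    rw [hm]
    push_cast
    refine h1.trans (le_of_eq ?_)
    congr 1
    field_simp
  set a : Finset α → ℤ := fun A => round (m * θ' A) with ha
  set β : Finset α → ℤ := fun b => ∑ A ∈ b.powersetCard t, a A with hβ
  have hβx : ∀ b ∈ V.powersetCard k, |m * x b - β b| ≤ m * (1 / (4 * Y ^ 17)) := by
    intro b hb
    rw [← hx' b hb, hβ, mul_sum]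
    push_cast
    rw [← sum_sub_distrib]
    rw [mem_powersetCard] at hb
    calc _ ≤ ∑ A ∈ b.powersetCard t, |m * θ' A - a A| := abs_sum_le_sum_abs _ _
      _ ≤ ∑ A ∈ b.powersetCard t, m * (1 / (4 * Y ^ 18)) := by
        refine sum_le_sum fun A hA => hround A ?_
        rw [mem_powersetCard] at hA ⊢
        exact ⟨hA.1.trans hb.1, hA.2⟩
      _ = k.choose t * (m * (1 / (4 * Y ^ 18))) := by
        rw [sum_const, card_powersetCard, hb.2, nsmul_eq_mul]
      _ ≤ Y * (m * (1 / (4 * Y ^ 18))) := by gcongr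
      _ = m * (1 / (4 * Y ^ 17)) := by field_simp
  have hdvd : ∀ b ∈ V.powersetCard k, |x b - round (x b)| < 1 / (4 * m) → (m : ℤ) ∣ β b := by
    intro b hb hlt'
    have h1 := hβx b hb
    have h2 : |m * x b - m * round (x b)| < 1 / 4 := by
      rw [← mul_sub, abs_mul, abs_of_pos hmR]
      calc (m : ℝ) * |x b - round (x b)| < m * (1 / (4 * m)) := by gcongr
        _ = 1 / 4 := by field_simp
    have h3 : (m : ℝ) * (1 / (4 * Y ^ 17)) ≤ 1 / 4 := by
      rw [mul_one_div, div_le_iff₀ (by positivity)]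
      calc (m : ℝ) ≤ Y ^ 5 := hmY
        _ ≤ Y ^ 17 := pow_le_pow_right₀ hY (by norm_num)
        _ = _ := by ring
    have h4 : |((β b - m * round (x b) : ℤ) : ℝ)| < 1 := by
      push_cast
      have : (β b : ℝ) - m * round (x b)
        = (m * x b - m * round (x b)) - (m * x b - β b) := by ring
      rw [this]
      refine (abs_sub _ _).trans_lt ?_
      linarith
    have h5 : β b - m * round (x b) = 0 := by
      rw [← Int.abs_lt_one_iff]
      exact_mod_cast h4
    exact ⟨round (x b), by linarith⟩
  have hbad : (#{b ∈ V.powersetCard k | ¬ |x b - round (x b)| < 1 / (4 * m)} : ℝ)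
      ≤ 16 * m ^ 2 * (1 / (16 * Y ^ 40) * (#V).choose k) := by
    have h1 : (#{b ∈ V.powersetCard k | ¬ |x b - round (x b)| < 1 / (4 * m)} : ℝ)
        * (1 / (4 * m)) ^ 2 ≤ 1 / (16 * Y ^ 40) * (#V).choose k := by
      refine le_trans ?_ hθ
      rw [← nsmul_eq_mul, ← sum_const]
      refine (sum_le_sum fun b hb => ?_).trans (sum_le_sum_of_subset_of_nonneg
        (filter_subset (fun b => ¬ |x b - round (x b)| < 1 / (4 * m)) _) fun _ _ _ => sq_nonneg _)
      have h2 := not_lt.1 (mem_filter.1 hb).2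
      rw [← sq_abs (_ - _)]
      exact pow_le_pow_left₀ (by positivity) h2 2
    have h2 : (1 / (4 * (m : ℝ))) ^ 2 * (16 * m ^ 2) = 1 := by
      field_simp
      norm_num
    calc _ = (#{b ∈ V.powersetCard k | ¬ |x b - round (x b)| < 1 / (4 * m)} : ℝ)
        * (1 / (4 * m)) ^ 2 * (16 * m ^ 2) := by rw [mul_assoc, h2, mul_one]
      _ ≤ 1 / (16 * Y ^ 40) * (#V).choose k * (16 * m ^ 2) := by gcongr
      _ = _ := by ring
  have hslice : ((#V).choose k : ℝ) ≤ Y ^ 3 * (#V - 2 * t).choose (k - t) := by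
    have h1 : (#V).choose k * (k.choose t * (#V - k).choose t)
        = (#V).choose (2 * t) * (2 * t).choose t * (#V - 2 * t).choose (k - t) := by
      rw [← mul_assoc, Nat.choose_mul (n := #V) (k := k) (s := t) hlt.le,
        Nat.choose_mul (n := #V) (k := 2 * t) (s := t) (by omega), show 2 * t - t = t by omega,
        mul_assoc, mul_assoc]
      have := Nat.choose_mul_choose_sub_comm (n := #V - t) (a := k - t) (b := t) (by omega)
      rw [show #V - t - (k - t) = #V - k by omega, show #V - t - t = #V - 2 * t by omega] at this
      rw [this]
    have h2 : 1 ≤ k.choose t * (#V - k).choose t :=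
      Nat.mul_pos (Nat.choose_pos hlt.le) (Nat.choose_pos (by omega))
    calc ((#V).choose k : ℝ) ≤ ((#V).choose k * (k.choose t * (#V - k).choose t) : ℕ) := by
          exact_mod_cast Nat.le_mul_of_pos_right _ h2
      _ = (#V).choose (2 * t) * (2 * t).choose t * (#V - 2 * t).choose (k - t) := by
          rw [h1]; push_cast; ring
      _ ≤ _ := by
          gcongr
          exact R.choose_le
  have hspos : (0 : ℝ) < (#V - 2 * t).choose (k - t) := by
    exact_mod_cast Nat.choose_pos (by omega)
  have hall : ∀ b ∈ V.powersetCard k, (m : ℤ) ∣ β b := by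
    classical
    by_contra! hcon
    set g : Finset α → ZMod m := fun b => ∑ A ∈ V.powersetCard t, if A ⊆ b then (a A : ZMod m) else 0
      with hg
    have hgβ : ∀ b ∈ V.powersetCard k, (g b = 0 ↔ (m : ℤ) ∣ β b) := by
      intro b hb
      rw [← CharP.intCast_eq_zero_iff (ZMod m) m]
      simp only [hβ, hg]
      rw [← sum_filter]
      push_cast
      have : (V.powersetCard t).filter (fun A => A ⊆ b) = b.powersetCard t := by
        ext A
        simp only [mem_filter, mem_powersetCard]
        exact ⟨fun h => ⟨h.2, h.1.2⟩, fun h =>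
          ⟨⟨h.1.trans (mem_powersetCard.1 hb).1, h.2⟩, h.1⟩⟩
      rw [this]
    obtain ⟨b, hb, hb2⟩ := hcon
    have h1 := choose_le_card_ne_zero t V k g (sum_powersetCard_mem_degLE t V _) hlt.le (by omega)
      ⟨b, hb, fun h0 => hb2 ((hgβ b hb).1 h0)⟩
    have h2 : #{b ∈ V.powersetCard k | g b ≠ 0}
        ≤ #{b ∈ V.powersetCard k | ¬ |x b - round (x b)| < 1 / (4 * m)} := by
      refine card_le_card fun b hb => ?_
      rw [mem_filter] at hb ⊢
      exact ⟨hb.1, fun h0 => hb.2 ((hgβ b hb.1).2 (hdvd b hb.1 h0))⟩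
    have h3 : ((#V - 2 * t).choose (k - t) : ℝ)
        ≤ 16 * m ^ 2 * (1 / (16 * Y ^ 40) * (#V).choose k) :=
      le_trans (by exact_mod_cast h1.trans h2) hbad
    have h4 : 16 * (m : ℝ) ^ 2 * (1 / (16 * Y ^ 40) * (#V).choose k)
        ≤ 16 * (Y ^ 5) ^ 2 * (1 / (16 * Y ^ 40) * (Y ^ 3 * (#V - 2 * t).choose (k - t))) := by
      gcongr
    have h5 : 16 * (Y ^ 5) ^ 2 * (1 / (16 * Y ^ 40) * (Y ^ 3 * (#V - 2 * t).choose (k - t)))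
        = (#V - 2 * t).choose (k - t) / Y ^ 27 := by
      field_simp
    have h6 : ((#V - 2 * t).choose (k - t) : ℝ) / Y ^ 27 < (#V - 2 * t).choose (k - t) :=
      div_lt_self hspos (one_lt_pow₀ (by linarith [R.two_le]) (by norm_num))
    linarith
  choose! w hw using hall
  obtain ⟨c, hc⟩ := h.incl_eq_sum (t := t) (k := k) (by omega)
  set γ : Finset α → ℝ := fun S => ∑ A ∈ V.powersetCard t, (a A : ℝ) / m * c A S with hγ
  have hγw : ∀ b ∈ V.powersetCard k, ∑ S ∈ I, γ S * incl ℝ S b = w b := by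
    intro b hb
    have h1 : (w b : ℝ) = (β b : ℝ) / m := by
      rw [hw b hb]
      push_cast
      field_simp
    rw [h1, hγ, hβ]
    simp only [sum_mul]
    rw [sum_comm]
    have h2 : (V.powersetCard t).filter (fun A => A ⊆ b) = b.powersetCard t := by
      ext A
      simp only [mem_filter, mem_powersetCard]
      exact ⟨fun h => ⟨h.2, h.1.2⟩, fun h => ⟨⟨h.1.trans (mem_powersetCard.1 hb).1, h.2⟩, h.1⟩⟩
    rw [← h2, sum_filter]
    push_cast
    rw [sum_div]
    refine sum_congr rfl fun A hA => ?_
    have h3 := congrArg (Int.cast (R := ℝ)) (hc A hA b hb)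
    push_cast [intCast_incl] at h3
    simp only [mul_assoc]
    rw [← mul_sum, ← h3]
    unfold incl
    split_ifs <;> simp
  obtain ⟨z, hz⟩ := h.exists_int_eq hlt.le hle γ w hγw
  refine ⟨z, fun b hb => ?_⟩
  have h1 : ∑ S ∈ I, (θ S - z S) * incl ℝ S b = x b - w b := by
    rw [← hγw b hb, hx, ← sum_sub_distrib]
    refine sum_congr rfl fun S hS => ?_
    rw [hz S hS]
    ring
  rw [h1]
  have h2 := hβx b hb
  rw [hw b hb] at h2
  push_cast at h2
  rw [← mul_sub, abs_mul, abs_of_pos hmR] at h2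
  exact le_of_mul_le_mul_left h2 hmR

theorem Matrix.det_eq_prod_of_forall_not_subset {α R : Type*} [DecidableEq α] [CommRing R]
    {I : Finset (Finset α)} (M : Matrix I I R)
    (h : ∀ S J : I, ¬ (J : Finset α) ⊆ S → M S J = 0) : M.det = ∏ S, M S S := by
  rw [Matrix.det_apply, Finset.sum_eq_single 1]
  · simp
  · intro σ _ hσ
    suffices ∃ J : I, ¬ (J : Finset α) ⊆ σ J by
      obtain ⟨J, hJ⟩ := this
      rw [Finset.prod_eq_zero (f := fun i => M (σ i) i) (Finset.mem_univ J) (h _ _ hJ), smul_zero]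
    by_contra! hsub
    have h1 : ∑ J : I, (σ J : Finset α).card = ∑ J : I, (J : Finset α).card :=
      Equiv.sum_comp σ fun J => (J : Finset α).card
    have h2 := (Finset.sum_eq_sum_iff_of_le fun J _ => Finset.card_le_card (hsub J)).1 h1.symm
    refine hσ (Equiv.ext fun J => Subtype.ext ?_)
    exact (Finset.eq_of_subset_of_card_le (hsub J) (h2 J (Finset.mem_univ J)).ge).symm
  · simp

open Finset in
theorem card_filter_union_subset {α : Type*} [DecidableEq α] {V S A : Finset α} {k : ℕ}
    (hS : S ⊆ V) (hA : A ⊆ V) (hSA : #S ≤ #A) (hk : #A ≤ k) (hkv : k + #A ≤ #V) :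
    #((V.powersetCard k).filter fun b => S ⊆ b ∧ A ⊆ b)
      = ∑ J ∈ S.powerset, (if J ⊆ A then (#V - #A - #S).choose (#V - k - #J) else 0) := by
  have h1 : #((V.powersetCard k).filter fun b => S ⊆ b ∧ A ⊆ b)
      = (#V - #(S ∪ A)).choose (#V - k) := by
    have hle := card_le_card (union_subset hS hA)
    rcases Nat.lt_or_ge k #(S ∪ A) with hlt | hge
    · rw [Nat.choose_eq_zero_of_lt (by omega), card_eq_zero, filter_eq_empty_iff]
      rintro b hb ⟨hb1, hb2⟩
      have := card_le_card (union_subset hb1 hb2)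
      rw [(mem_powersetCard.1 hb).2] at this
      omega
    · rw [← Nat.choose_symm (by omega), show #V - #(S ∪ A) - (#V - k) = k - #(S ∪ A) by omega,
        ← card_filter_powersetCard_subset _ _ _ (union_subset hS hA) hge]
      simp only [union_subset_iff]
  have h2 : ∑ J ∈ S.powerset, (if J ⊆ A then (#V - #A - #S).choose (#V - k - #J) else 0)
      = ∑ J ∈ (S ∩ A).powerset, (#V - #A - #S).choose (#V - k - #J) := by
    rw [← sum_filter]
    refine sum_congr ?_ fun _ _ => rfl
    ext J
    simp only [mem_filter, mem_powerset, subset_inter_iff]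
  have h3 := card_union_add_card_inter S A
  have hle := card_le_card (union_subset hS hA)
  have hi : #(S ∩ A) ≤ #S := card_le_card inter_subset_left
  rw [h1, h2, sum_powerset_apply_card fun j => (#V - #A - #S).choose (#V - k - j),
    show #V - #(S ∪ A) = #(S ∩ A) + (#V - #A - #S) by omega, Nat.add_choose_eq,
    Nat.sum_antidiagonal_eq_sum_range_succ
      (fun i j => (#(S ∩ A)).choose i * (#V - #A - #S).choose j)]
  simp only [smul_eq_mul]
  symm
  refine sum_subset (fun i hi => ?_) fun i _ hi => ?_
  · rw [mem_range] at hi ⊢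
    omega
  · rw [mem_range] at hi
    rw [Nat.choose_eq_zero_of_lt (by omega), zero_mul]

open Finset in
/-- The determinant of the Gram matrix of the standard basis of low-degree functions. -/
theorem StdFamily.det_gram {α : Type*} [DecidableEq α] {V : Finset α}
    {F : Finset (Finset α)} (h : StdFamily V F) {t k : ℕ} (htk : t ≤ k) (hkt : k + t ≤ #V) :
    (Matrix.of fun S S' : F.filter (fun S => #S ≤ t) =>
      ∑ b ∈ V.powersetCard k, incl ℝ (S : Finset α) b * incl ℝ (S' : Finset α) b).det
    = ∏ S ∈ F.filter (fun S => #S ≤ t),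
        ((#V - t - #S).choose (k - t) : ℝ) / (k - #S).choose (k - t) := by
  set I := F.filter fun S => #S ≤ t with hI
  have hIF : ∀ S ∈ I, S ⊆ V ∧ #S ≤ t := fun S hS =>
    ⟨h.subset S (mem_filter.1 hS).1, (mem_filter.1 hS).2⟩
  let U : Matrix I (V.powersetCard t) ℝ := fun S A => incl ℝ (S : Finset α) A
  let W : Matrix I (V.powersetCard k) ℝ := fun S b => incl ℝ (S : Finset α) b
  let X : Matrix (V.powersetCard t) (V.powersetCard k) ℝ := fun A b => incl ℝ (A : Finset α) b
  let D : Matrix I I ℝ := Matrix.diagonal fun S => ((k - #(S : Finset α)).choose (k - t) : ℝ)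
  let T : Matrix I I ℝ := fun S J => if (J : Finset α) ⊆ S then
    ((#V - t - #(S : Finset α)).choose (#V - k - #(J : Finset α)) : ℝ) else 0
  have hG : (Matrix.of fun S S' : I =>
      ∑ b ∈ V.powersetCard k, incl ℝ (S : Finset α) b * incl ℝ (S' : Finset α) b)
      = W * W.transpose := by
    ext S S'
    rw [Matrix.mul_apply, Matrix.of_apply, ← sum_coe_sort]
    rfl
  have hWX : W * X.transpose = T * U := by
    ext S A
    obtain ⟨hA, hAc⟩ := mem_powersetCard.1 A.2
    obtain ⟨hS, hSc⟩ := hIF _ S.2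
    rw [Matrix.mul_apply, Matrix.mul_apply]
    have h1 := card_filter_union_subset (k := k) hS hA (by omega) (by omega) (by omega)
    have h2 : ∑ b : V.powersetCard k, W S b * X.transpose b A
        = (#((V.powersetCard k).filter fun b => (S : Finset α) ⊆ b ∧ (A : Finset α) ⊆ b) : ℝ) := by
      refine (sum_coe_sort (V.powersetCard k)
        fun b => incl ℝ (S : Finset α) b * incl ℝ (A : Finset α) b).trans ?_
      rw [card_filter]
      push_cast
      refine sum_congr rfl fun b _ => ?_
      unfold incl
      by_cases h3 : (S : Finset α) ⊆ b <;> by_cases h4 : (A : Finset α) ⊆ b <;> simp [h3, h4]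
    have h3 : ∑ J : I, T S J * U J A = ∑ J ∈ I, if J ⊆ S then (if J ⊆ A then
        ((#V - t - #(S : Finset α)).choose (#V - k - #J) : ℝ) else 0) else 0 := by
      rw [← sum_coe_sort I]
      refine sum_congr rfl fun J _ => ?_
      simp only [T, U, incl]
      split_ifs <;> simp
    rw [← sum_filter] at h3
    rw [h2, h1, h3, hAc]
    push_cast
    refine sum_congr ?_ fun _ _ => rfl
    ext J
    rw [mem_powerset, mem_filter]
    refine ⟨fun hJ => ⟨?_, hJ⟩, fun hJ => hJ.2⟩
    rw [hI, mem_filter]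
    exact ⟨h.down _ (mem_filter.1 S.2).1 J hJ, (card_le_card hJ).trans hSc⟩
  have hDW : D * W = U * X := by
    ext S b
    obtain ⟨hS, hSc⟩ := hIF _ S.2
    obtain ⟨hb, hbc⟩ := mem_powersetCard.1 b.2
    rw [Matrix.diagonal_mul, Matrix.mul_apply]
    have h1 : ∑ A : V.powersetCard t, U S A * X A b
        = ∑ A ∈ V.powersetCard t, if (S : Finset α) ⊆ A ∧ A ⊆ b then (1 : ℝ) else 0 := by
      refine Eq.trans (sum_congr rfl fun A _ => ?_) (sum_coe_sort (V.powersetCard t) _)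
      simp only [U, X, incl]
      split_ifs <;> simp_all
    rw [h1, ← sum_filter, sum_const, nsmul_eq_mul, mul_one]
    have h2 : (V.powersetCard t).filter (fun A => (S : Finset α) ⊆ A ∧ A ⊆ b)
        = ((b : Finset α).powersetCard t).filter fun A => (S : Finset α) ⊆ A := by
      ext A
      simp only [mem_filter, mem_powersetCard]
      exact ⟨fun h => ⟨⟨h.2.2, h.1.2⟩, h.2.1⟩, fun h => ⟨⟨h.1.1.trans hb, h.1.2⟩, h.2, h.1.1⟩⟩
    rw [h2]
    by_cases hSb : (S : Finset α) ⊆ b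
    · rw [card_filter_powersetCard_subset _ _ _ hSb hSc, hbc, ← Nat.choose_symm (by omega),
        show k - #(S : Finset α) - (k - t) = t - #(S : Finset α) by omega]
      simp [W, incl, hSb]
    · rw [filter_eq_empty_iff.2]
      · simp [W, incl, hSb]
      · exact fun A hA hSA => hSb (hSA.trans (mem_powersetCard.1 hA).1)
  have hdetU : (U * U.transpose).det = 1 := by
    obtain ⟨c, hc1, hc2⟩ := h.exists_inverse t (by omega)
    rw [show min t (#V - t) = t by omega, ← hI] at hc1 hc2
    let Uz : Matrix I (V.powersetCard t) ℤ := fun S A => incl ℤ (S : Finset α) A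
    let M : Matrix (V.powersetCard t) I ℤ := fun A S => c A S
    have hMU : M * Uz = 1 := by
      ext A A'
      rw [Matrix.mul_apply, Matrix.one_apply]
      simp only [Subtype.ext_iff]
      rw [← hc1 A' A'.2 A]
      exact sum_coe_sort I fun S => c A S * incl ℤ S A'
    have hUM : Uz * M = 1 := by
      ext S S'
      rw [Matrix.mul_apply, Matrix.one_apply]
      simp only [Subtype.ext_iff]
      rw [← hc2 S S.2 S' S'.2]
      exact sum_coe_sort (V.powersetCard t) fun A => incl ℤ (S : Finset α) A * c A S'
    have hinv : (Uz * Uz.transpose) * (M.transpose * M) = 1 := by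
      rw [Matrix.mul_assoc, ← Matrix.mul_assoc Uz.transpose, ← Matrix.transpose_mul, hMU,
        Matrix.transpose_one, Matrix.one_mul, hUM]
    have hunit : IsUnit (Uz * Uz.transpose).det := by
      refine IsUnit.of_mul_eq_one (M.transpose * M).det ?_
      rw [← Matrix.det_mul, hinv, Matrix.det_one]
    have hcast : (U * U.transpose) = (Uz * Uz.transpose).map (Int.castRingHom ℝ) := by
      rw [Matrix.map_mul, Matrix.transpose_map]
      have : U = Uz.map (Int.castRingHom ℝ) := by
        ext S A
        exact (intCast_incl _ _).symm
      rw [this]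
    have hdet : (U * U.transpose).det = ((Uz * Uz.transpose).det : ℤ) := by
      rw [hcast]
      exact (RingHom.map_det (Int.castRingHom ℝ) _).symm
    have hnonneg : 0 ≤ (U * U.transpose).det := by
      have := (Matrix.posSemidef_self_mul_conjTranspose U).det_nonneg
      rwa [Matrix.conjTranspose_eq_transpose_of_trivial] at this
    rcases Int.isUnit_iff.1 hunit with h1 | h1
    · rw [hdet, h1, Int.cast_one]
    · rw [hdet, h1] at hnonneg
      norm_num at hnonneg
  have hmul : (W * W.transpose) * D = T * (U * U.transpose) := by
    have : W.transpose * D = (D * W).transpose := by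
      rw [Matrix.transpose_mul, Matrix.diagonal_transpose]
    rw [Matrix.mul_assoc, this, hDW, Matrix.transpose_mul, ← Matrix.mul_assoc, hWX,
      Matrix.mul_assoc]
  have hdet := congrArg Matrix.det hmul
  rw [Matrix.det_mul, Matrix.det_mul, hdetU, mul_one, Matrix.det_diagonal,
    Matrix.det_eq_prod_of_forall_not_subset T fun S J hJ => if_neg hJ] at hdet
  have hpos : ∀ S ∈ I, ((k - #S).choose (k - t) : ℝ) ≠ 0 := by
    intro S hS
    have := (hIF S hS).2
    exact_mod_cast (Nat.choose_pos (by omega)).ne'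
  rw [hG, prod_div_distrib, eq_div_iff (prod_ne_zero_iff.2 hpos), ← prod_coe_sort I, hdet,
    ← prod_coe_sort I]
  refine prod_congr rfl fun S _ => ?_
  have := (hIF _ S.2).2
  simp only [T, Subset.refl, if_true]
  rw [← Nat.choose_symm (by omega)]
  congr 2
  omega

open Finset in
/-- No value of a function spanned by `t`-set indicators exceeds its quadratic mean by much. -/
theorem StdFamily.sq_sum_le {α : Type*} [DecidableEq α] {V : Finset α} {F : Finset (Finset α)}
    {k t : ℕ} {Y : ℝ} (R : Regime #V k t Y) (θ : Finset α → ℝ) {b : Finset α}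
    (hb : b ∈ V.powersetCard k) :
    (∑ S ∈ F.filter (#· ≤ t), θ S * incl ℝ S b) ^ 2
      ≤ Y ^ 6 / (#V).choose k
        * ∑ b ∈ V.powersetCard k, (∑ S ∈ F.filter (#· ≤ t), θ S * incl ℝ S b) ^ 2 := by
  have hlt := R.lt
  have hle := R.add_le
  have hY := R.one_le
  obtain ⟨θ', hθ'⟩ := exists_sum_powersetCard_eq F hlt.le θ
  set x : Finset α → ℝ := fun b => ∑ S ∈ F.filter (#· ≤ t), θ S * incl ℝ S b with hx
  set Q : ℝ := ∑ b ∈ V.powersetCard k, x b ^ 2 with hQ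
  change x b ^ 2 ≤ _ * Q
  have hn : (0 : ℝ) < (#V).choose k := by exact_mod_cast Nat.choose_pos (by omega)
  have hQ0 : 0 ≤ Q := sum_nonneg fun _ _ => sq_nonneg _
  set η := Q / (#V).choose k with hη
  have hη0 : 0 ≤ η := by positivity
  have hA : ∀ A ∈ V.powersetCard t, |θ' A| ≤ Y ^ 2 * √η := by
    intro A hA
    obtain ⟨C, hC, hCle⟩ := R.exists_sum_abs_le hη0 x (by rw [hη]; field_simp; rfl) hA
    rw [mem_powersetCard] at hA hC
    rw [subset_sdiff] at hC
    rw [eq_sum_decodeCoeff hlt θ' hA.2 hC.2 hC.1.2.symm]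
    refine (abs_sum_le_sum_abs _ _).trans (le_trans (sum_le_sum fun a ha => ?_) hCle)
    refine (abs_sum_le_sum_abs _ _).trans (sum_le_sum fun e he => ?_)
    have ha' := mem_powerset.1 ha
    rw [mem_powersetCard] at he
    have h1 := card_le_card ha'
    have h2 : #(a ∪ C \ e) = k := by
      rw [card_union_of_disjoint, card_sdiff_of_subset he.1]
      · have := card_le_card he.1
        omega
      · exact (hC.1.2.symm.mono_left ha').mono_right sdiff_subset
    rw [hθ' _ h2, abs_mul]
    exact (mul_le_mul_of_nonneg_right (abs_decodeCoeff_le_one hlt (by omega))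
      (abs_nonneg _)).trans_eq (one_mul _)
  rw [mem_powersetCard] at hb
  have hxb : |x b| ≤ Y ^ 3 * √η := by
    rw [show x b = _ from (hθ' b hb.2).symm]
    calc |∑ A ∈ b.powersetCard t, θ' A| ≤ ∑ A ∈ b.powersetCard t, |θ' A| := abs_sum_le_sum_abs _ _
      _ ≤ ∑ A ∈ b.powersetCard t, Y ^ 2 * √η :=
        sum_le_sum fun A h => hA A (powersetCard_mono hb.1 h)
      _ = (k.choose t : ℝ) * (Y ^ 2 * √η) := by
        rw [sum_const, card_powersetCard, hb.2, nsmul_eq_mul]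
      _ ≤ Y * (Y ^ 2 * √η) := by
        gcongr
        refine le_trans ?_ R.choose_le_self
        exact_mod_cast Nat.choose_le_choose t (by omega)
      _ = _ := by ring
  calc x b ^ 2 ≤ (Y ^ 3 * √η) ^ 2 :=
        sq_le_sq.2 (by rwa [abs_of_nonneg (a := Y ^ 3 * √η) (by positivity)])
    _ = Y ^ 6 * η := by
        rw [mul_pow, Real.sq_sqrt hη0]
        ring
    _ = _ := by rw [hη]; ring

theorem Nat.sum_choose_le_exp_mul_div_pow {v t : ℕ} (ht : 1 ≤ t) (htv : t ≤ v) :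
    ∑ j ∈ Finset.range (t + 1), (v.choose j : ℝ) ≤ (Real.exp 1 * v / t) ^ t := by
  have ht0 : (0 : ℝ) < t := by exact_mod_cast ht
  have hv0 : (0 : ℝ) < v := by exact_mod_cast ht.trans htv
  have hr : (t : ℝ) / v ≤ 1 := by
    rw [div_le_one hv0]
    exact_mod_cast htv
  have h1 : (∑ j ∈ Finset.range (t + 1), (v.choose j : ℝ)) * ((t : ℝ) / v) ^ t
      ≤ Real.exp 1 ^ t := by
    calc (∑ j ∈ Finset.range (t + 1), (v.choose j : ℝ)) * ((t : ℝ) / v) ^ t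
        ≤ ∑ j ∈ Finset.range (t + 1), ((t : ℝ) / v) ^ j * 1 ^ (v - j) * v.choose j := by
          rw [Finset.sum_mul]
          refine Finset.sum_le_sum fun j hj => ?_
          rw [Finset.mem_range, Nat.lt_succ_iff] at hj
          have := pow_le_pow_of_le_one (by positivity) hr hj
          rw [one_pow, mul_one, mul_comm]
          gcongr
      _ ≤ ∑ j ∈ Finset.range (v + 1), ((t : ℝ) / v) ^ j * 1 ^ (v - j) * v.choose j := by
          refine Finset.sum_le_sum_of_subset_of_nonneg ?_ fun _ _ _ => by positivity
          exact Finset.range_subset_range.2 (by omega)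
      _ = ((t : ℝ) / v + 1) ^ v := (add_pow _ _ _).symm
      _ ≤ Real.exp ((t : ℝ) / v) ^ v := by
          gcongr
          exact Real.add_one_le_exp _
      _ = Real.exp 1 ^ t := by
          rw [← Real.exp_nat_mul, ← Real.exp_nat_mul]
          congr 1
          field_simp
  have h2 : (0 : ℝ) < ((t : ℝ) / v) ^ t := by positivity
  refine le_of_mul_le_mul_right (h1.trans_eq ?_) h2
  rw [← mul_pow]
  congr 1
  field_simp

theorem Nat.lcmUpto_le_pow (t : ℕ) : (Nat.lcmUpto t : ℝ) ≤ (4 * Real.exp 4) ^ t := by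
  have h1 := Chebyshev.psi_le_const_mul_self (x := t) (by positivity)
  rw [Chebyshev.psi_eq_log_lcmUpto] at h1
  have h2 : (0 : ℝ) < Nat.lcmUpto t := by exact_mod_cast Nat.lcmUpto_pos t
  rw [← Real.exp_log h2]
  refine (Real.exp_le_exp.2 h1).trans_eq ?_
  rw [mul_comm, Real.exp_nat_mul, Real.exp_add, Real.exp_log (by norm_num)]

theorem Regime.of_lt {v k t : ℕ} (ht : 1 ≤ t) (htk : t < k) (hkt : k + t ≤ v) :
    Regime v k t ((3 * v / t) ^ t) := by
  have ht0 : (0 : ℝ) < t := by exact_mod_cast ht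
  have hv0 : (0 : ℝ) < v := by exact_mod_cast (show 0 < v by omega)
  have hr : (2 : ℝ) ≤ v / t := by
    rw [le_div_iff₀ ht0]
    exact_mod_cast (show 2 * t ≤ v by omega)
  have h6 : (6 : ℝ) ≤ 3 * v / t := by
    rw [mul_div_assoc]
    linarith
  have he : Real.exp 1 ≤ 3 := (Real.exp_one_lt_d9.trans (by norm_num)).le
  have hsum := Nat.sum_choose_le_exp_mul_div_pow ht (show t ≤ v by omega)
  refine ⟨?_, htk, hkt, ?_, ?_, ?_⟩
  · calc (2 : ℝ) ≤ 6 ^ 1 := by norm_num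
      _ ≤ 6 ^ t := pow_le_pow_right₀ (by norm_num) ht
      _ ≤ _ := by gcongr
  · refine (Nat.lcmUpto_le_pow t).trans ?_
    rw [← pow_mul, mul_comm t, pow_mul]
    gcongr
    calc 4 * Real.exp 4 = 4 * Real.exp 1 ^ 4 := by
          rw [← Real.exp_nat_mul]
          norm_num
      _ ≤ 4 * 3 ^ 4 := by gcongr
      _ ≤ 6 ^ 4 := by norm_num
      _ ≤ _ := by gcongr
  · exact hsum.trans (by gcongr)
  · have h2 := Nat.sum_choose_le_exp_mul_div_pow (v := v) (t := 2 * t) (by omega) (by omega)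
    have h3 : (v.choose (2 * t) : ℝ) ≤ (Real.exp 1 * v / (2 * t : ℕ)) ^ (2 * t) :=
      (Finset.single_le_sum (f := fun j => (v.choose j : ℝ)) (fun _ _ => by positivity)
        (Finset.self_mem_range_succ (2 * t))).trans h2
    have h4 : ((2 * t).choose t : ℝ) ≤ 4 ^ t := by
      have := Nat.choose_le_two_pow (2 * t) t
      rw [pow_mul] at this
      exact_mod_cast this
    calc (v.choose (2 * t) * (2 * t).choose t : ℝ)
        ≤ (Real.exp 1 * v / (2 * t : ℕ)) ^ (2 * t) * 4 ^ t := by gcongr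
      _ = ((Real.exp 1 * v / t) ^ t) ^ 2 := by
          rw [pow_mul, ← mul_pow, ← pow_mul, mul_comm t 2, pow_mul]
          congr 1
          push_cast
          field_simp
          norm_num
      _ ≤ ((3 * v / t) ^ t) ^ 2 := by gcongr
      _ ≤ ((3 * v / t) ^ t) ^ 3 := by
          refine pow_le_pow_right₀ ?_ (by norm_num)
          exact one_le_pow₀ (by linarith)

/-- The characteristic function of a centred Bernoulli variable of parameter `p`. -/
noncomputable def bernoulliChar (p y : ℝ) : ℂ :=
  (1 - p) * Complex.exp (-(p * y) * Complex.I) + p * Complex.exp ((1 - p) * y * Complex.I)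

theorem bernoulliChar_eq (p y : ℝ) :
    bernoulliChar p y
      = Complex.exp (-(p * y) * Complex.I) * ((1 - p) + p * Complex.exp (y * Complex.I)) := by
  rw [mul_add, mul_left_comm _ (p : ℂ), ← Complex.exp_add, bernoulliChar]
  ring_nf

theorem norm_sq_bernoulliChar (p y : ℝ) :
    ‖bernoulliChar p y‖ ^ 2 = 1 - 2 * (p * (1 - p)) * (1 - Real.cos y) := by
  have h1 : ‖Complex.exp (-(p * y) * Complex.I)‖ = 1 := by
    have := Complex.norm_exp_ofReal_mul_I (-(p * y))
    push_cast at this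
    exact this
  rw [bernoulliChar_eq, norm_mul, h1, one_mul, ← Complex.normSq_eq_norm_sq, Complex.normSq_apply]
  simp only [Complex.add_re, Complex.add_im, Complex.mul_re, Complex.mul_im, Complex.sub_re,
    Complex.sub_im, Complex.one_re, Complex.one_im, Complex.ofReal_re, Complex.ofReal_im,
    Complex.exp_ofReal_mul_I_re, Complex.exp_ofReal_mul_I_im]
  linear_combination p ^ 2 * Real.sin_sq_add_cos_sq y

theorem le_exp_neg_of_sq_le {a u : ℝ} (h : a ^ 2 ≤ 1 - 2 * u) : a ≤ Real.exp (-u) := by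
  refine le_of_sq_le_sq (h.trans ?_) (Real.exp_pos _).le
  rw [← Real.exp_nat_mul]
  refine le_trans (le_of_eq ?_) (Real.add_one_le_exp _)
  push_cast
  ring

theorem norm_bernoulliChar_le_of_abs_le {p y ε : ℝ} (h0 : 0 ≤ p) (h1 : p ≤ 1) (hy : |y| ≤ 1)
    (hε : y ^ 2 ≤ 8 * ε) :
    ‖bernoulliChar p y‖ ≤ Real.exp (-((1 - ε) * (p * (1 - p) * y ^ 2 / 2))) := by
  refine le_exp_neg_of_sq_le ?_
  rw [norm_sq_bernoulliChar]
  have hpq : 0 ≤ p * (1 - p) := mul_nonneg h0 (by linarith)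
  have h2 := abs_le.1 (Real.cos_bound hy)
  have h3 : |y| ^ 4 = y ^ 2 * y ^ 2 := by
    rw [show |y| ^ 4 = (|y| ^ 2) ^ 2 by ring, sq_abs]
    ring
  rw [h3] at h2
  have h4 : (1 - ε) * y ^ 2 ≤ 2 * (1 - Real.cos y) := by
    nlinarith [h2.2, mul_nonneg (sq_nonneg y) (sub_nonneg.2 hε)]
  nlinarith [mul_le_mul_of_nonneg_left h4 hpq]

theorem two_mul_abs_sub_round_le_abs_sin (x : ℝ) :
    2 * |x - round x| ≤ |Real.sin (Real.pi * x)| := by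
  have h1 : |Real.sin (Real.pi * x)| = |Real.sin (Real.pi * (x - round x))| := by
    rw [mul_sub, mul_comm Real.pi (round x : ℝ), Real.sin_sub_int_mul_pi, abs_mul, abs_zpow]
    simp
  have h2 : |Real.sin (Real.pi * (x - round x))| = |Real.sin (Real.pi * |x - round x|)| := by
    rcases abs_choice (x - round x) with h | h <;> rw [h]
    rw [mul_neg, Real.sin_neg, abs_neg]
  have h3 := abs_sub_round x
  have h4 := Real.mul_le_sin (x := Real.pi * |x - round x|) (by positivity)
    (by nlinarith [Real.pi_pos])
  rw [h1, h2]
  refine le_trans (le_of_eq ?_) (h4.trans (le_abs_self _))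
  field_simp

theorem norm_bernoulliChar_le {p : ℝ} (h0 : 0 ≤ p) (h1 : p ≤ 1) (x : ℝ) :
    ‖bernoulliChar p (2 * Real.pi * x)‖ ≤ Real.exp (-(8 * (p * (1 - p)) * (x - round x) ^ 2)) := by
  refine le_exp_neg_of_sq_le ?_
  rw [norm_sq_bernoulliChar]
  have hpq : 0 ≤ p * (1 - p) := mul_nonneg h0 (by linarith)
  have h2 : Real.cos (2 * Real.pi * x) = 1 - 2 * Real.sin (Real.pi * x) ^ 2 := by
    rw [mul_assoc, Real.cos_two_mul, Real.cos_sq']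
    ring
  have h3 : 4 * (x - round x) ^ 2 ≤ Real.sin (Real.pi * x) ^ 2 := by
    have := pow_le_pow_left₀ (by positivity) (two_mul_abs_sub_round_le_abs_sin x) 2
    rw [mul_pow, sq_abs, sq_abs] at this
    linarith
  rw [h2]
  nlinarith [mul_le_mul_of_nonneg_left h3 hpq]

theorem norm_bernoulliChar_sub_le {p y : ℝ} (h0 : 0 ≤ p) (h1 : p ≤ 1) (hy : |y| ≤ 1) :
    ‖bernoulliChar p y - Real.exp (-(p * (1 - p) * y ^ 2 / 2))‖ ≤ p * (1 - p) * |y| ^ 3 := by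
  have hpq : 0 ≤ p * (1 - p) := mul_nonneg h0 (by linarith)
  have key : ∀ a : ℝ, 0 ≤ |a| → |a| ≤ 1 →
      ‖Complex.exp (a * y * Complex.I)
        - (1 + a * y * Complex.I - (a * y) ^ 2 / 2)‖ ≤ |a| ^ 2 * (2 / 9 * |y| ^ 3) := by
    intro a ha0 ha
    have hn : ‖(a * y * Complex.I : ℂ)‖ = |a| * |y| := by simp
    have h2 := Complex.exp_bound (x := a * y * Complex.I) (n := 3)
      (by rw [hn]; exact mul_le_one₀ ha (abs_nonneg y) hy) (by norm_num)
    rw [hn] at h2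
    have h3 : ∑ m ∈ Finset.range 3, (a * y * Complex.I : ℂ) ^ m / (m.factorial : ℂ)
        = 1 + a * y * Complex.I - (a * y) ^ 2 / 2 := by
      simp only [Finset.sum_range_succ, Finset.sum_range_zero, Nat.factorial]
      push_cast
      linear_combination (a * y) ^ 2 / 2 * Complex.I_sq
    rw [h3] at h2
    refine h2.trans ?_
    have h4 : |a| ^ 3 ≤ |a| ^ 2 := pow_le_pow_of_le_one ha0 ha (by norm_num)
    have h5 : 0 ≤ |y| ^ 3 := by positivity
    have h6 : ((3 : ℕ).succ : ℝ) * (((3 : ℕ).factorial : ℝ) * (3 : ℕ))⁻¹ = 2 / 9 := by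
      norm_num [Nat.factorial]
    rw [mul_pow, h6, mul_assoc, mul_comm (|y| ^ 3)]
    gcongr
  have hk1 := key (-p) (abs_nonneg _) (by rw [abs_neg, abs_of_nonneg h0]; exact h1)
  have hk2 := key (1 - p) (abs_nonneg _) (by rw [abs_of_nonneg] <;> linarith)
  set u := p * (1 - p) * y ^ 2 / 2 with hu
  have hy3 : 0 ≤ |y| ^ 3 := by positivity
  have hpq4 : p * (1 - p) ≤ 1 / 4 := by nlinarith [sq_nonneg (2 * p - 1)]
  have hy2 : y ^ 2 ≤ 1 := (sq_le_one_iff_abs_le_one y).2 hy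
  have hy4 : y ^ 2 * y ^ 2 ≤ |y| ^ 3 := by
    rw [← sq_abs]
    calc |y| ^ 2 * |y| ^ 2 = |y| ^ 3 * |y| := by ring
      _ ≤ |y| ^ 3 * 1 := by gcongr
      _ = _ := mul_one _
  have hu0 : 0 ≤ u := by positivity
  have hu1 : u ≤ 1 := by nlinarith [sq_nonneg y]
  have hexp : |Real.exp (-u) - (1 - u)| ≤ p * (1 - p) * (1 / 16 * |y| ^ 3) := by
    have h2 := Real.abs_exp_sub_one_sub_id_le (x := -u) (by rwa [abs_neg, abs_of_nonneg hu0])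
    have h3 : Real.exp (-u) - (1 - u) = Real.exp (-u) - 1 - -u := by ring
    rw [h3]
    refine h2.trans ?_
    have h5 : (-u) ^ 2 = p * (1 - p) * (p * (1 - p)) * (y ^ 2 * y ^ 2) / 4 := by
      rw [hu]
      ring
    rw [h5]
    have h6 : p * (1 - p) * (p * (1 - p)) * (y ^ 2 * y ^ 2)
        ≤ p * (1 - p) * (1 / 4) * |y| ^ 3 := by gcongr
    linarith
  have hdec : bernoulliChar p y - Real.exp (-u)
      = (1 - p) * (Complex.exp (((-p : ℝ) : ℂ) * y * Complex.I)
          - (1 + ((-p : ℝ) : ℂ) * y * Complex.I - (((-p : ℝ) : ℂ) * y) ^ 2 / 2))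
        + p * (Complex.exp (((1 - p : ℝ) : ℂ) * y * Complex.I)
          - (1 + ((1 - p : ℝ) : ℂ) * y * Complex.I - (((1 - p : ℝ) : ℂ) * y) ^ 2 / 2))
        - ((Real.exp (-u) - (1 - u) : ℝ) : ℂ) := by
    rw [bernoulliChar, hu]
    push_cast
    ring_nf
  rw [hdec]
  refine (norm_sub_le _ _).trans (le_trans (add_le_add (norm_add_le _ _) le_rfl) ?_)
  rw [norm_mul, norm_mul, Complex.norm_real, Real.norm_eq_abs, Complex.norm_real,
    Real.norm_eq_abs, abs_of_nonneg h0, show (1 - p : ℂ) = ((1 - p : ℝ) : ℂ) by push_cast; rfl,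
    Complex.norm_real, Real.norm_eq_abs, abs_of_nonneg (show 0 ≤ 1 - p by linarith)]
  have e1 := mul_le_mul_of_nonneg_left hk1 (show 0 ≤ 1 - p by linarith)
  have e2 := mul_le_mul_of_nonneg_left hk2 h0
  rw [sq_abs] at e1 e2
  have e3 : (1 - p) * ((-p) ^ 2 * (2 / 9 * |y| ^ 3)) + p * ((1 - p) ^ 2 * (2 / 9 * |y| ^ 3))
      = p * (1 - p) * (2 / 9 * |y| ^ 3) := by ring
  have e4 := mul_nonneg hpq hy3
  linarith

theorem norm_prod_sub_prod_le {B : Type*} (s : Finset B) (a g : B → ℂ) (M E : B → ℝ)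
    (ha : ∀ b ∈ s, ‖a b‖ ≤ M b) (hg : ∀ b ∈ s, ‖g b‖ ≤ M b)
    (hE : ∀ b ∈ s, ‖a b - g b‖ ≤ E b * M b) :
    ‖∏ b ∈ s, a b - ∏ b ∈ s, g b‖ ≤ (∑ b ∈ s, E b) * ∏ b ∈ s, M b := by
  classical
  induction s using Finset.induction_on with
  | empty => simp
  | insert b s hb ih =>
    rw [Finset.prod_insert hb, Finset.prod_insert hb, Finset.prod_insert hb, Finset.sum_insert hb]
    have hM : ∀ c ∈ insert b s, 0 ≤ M c := fun c hc => (norm_nonneg _).trans (ha c hc)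
    have ih' := ih (fun c hc => ha c (Finset.mem_insert_of_mem hc))
      (fun c hc => hg c (Finset.mem_insert_of_mem hc))
      fun c hc => hE c (Finset.mem_insert_of_mem hc)
    have h1 : ‖∏ c ∈ s, g c‖ ≤ ∏ c ∈ s, M c := by
      rw [norm_prod]
      exact Finset.prod_le_prod (fun _ _ => norm_nonneg _)
        fun c hc => hg c (Finset.mem_insert_of_mem hc)
    have hMs : 0 ≤ ∏ c ∈ s, M c :=
      Finset.prod_nonneg fun c hc => hM c (Finset.mem_insert_of_mem hc)
    have hb' := Finset.mem_insert_self b s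
    calc ‖a b * ∏ c ∈ s, a c - g b * ∏ c ∈ s, g c‖
        = ‖a b * (∏ c ∈ s, a c - ∏ c ∈ s, g c) + (a b - g b) * ∏ c ∈ s, g c‖ := by ring_nf
      _ ≤ ‖a b‖ * ‖∏ c ∈ s, a c - ∏ c ∈ s, g c‖ + ‖a b - g b‖ * ‖∏ c ∈ s, g c‖ := by
          refine (norm_add_le _ _).trans ?_
          rw [norm_mul, norm_mul]
      _ ≤ M b * ((∑ c ∈ s, E c) * ∏ c ∈ s, M c) + E b * M b * ∏ c ∈ s, M c := by
          refine add_le_add (mul_le_mul (ha b hb') ih' (norm_nonneg _) (hM b hb')) ?_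
          exact mul_le_mul (hE b hb') h1 (norm_nonneg _) ((norm_nonneg _).trans (hE b hb'))
      _ = _ := by ring

open Matrix MeasureTheory in
open scoped MatrixOrder in
/-- The integral of a centred Gaussian density in several variables. -/
theorem Matrix.PosDef.integral_exp_neg_mul {I : Type*} [Fintype I] [DecidableEq I]
    {G : Matrix I I ℝ} (hG : G.PosDef) {s : ℝ} (hs : 0 < s) :
    Integrable (fun θ : I → ℝ => Real.exp (-s * (θ ⬝ᵥ G *ᵥ θ))) ∧
      ∫ θ : I → ℝ, Real.exp (-s * (θ ⬝ᵥ G *ᵥ θ)) = √(Real.pi / s) ^ Fintype.card I / √G.det := by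
  obtain ⟨A, hA⟩ := CStarAlgebra.nonneg_iff_eq_star_mul_self.mp hG.posSemidef.nonneg
  rw [star_eq_conjTranspose, conjTranspose_eq_transpose_of_trivial] at hA
  have hdet : G.det = A.det ^ 2 := by rw [hA, det_mul, det_transpose, sq]
  have hA0 : A.det ≠ 0 := by
    intro h
    have := hG.det_pos
    rw [hdet, h] at this
    norm_num at this
  set h : (I → ℝ) → ℝ := fun y => ∏ i, Real.exp (-s * y i ^ 2) with hh
  have hcomp : (fun θ : I → ℝ => Real.exp (-s * (θ ⬝ᵥ G *ᵥ θ))) = h ∘ toLin' A := by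
    ext θ
    rw [hA, ← mulVec_mulVec, dotProduct_mulVec, vecMul_transpose, Function.comp_apply,
      toLin'_apply]
    change _ = ∏ i, Real.exp (-s * (A *ᵥ θ) i ^ 2)
    rw [← Real.exp_sum, ← Finset.mul_sum]
    simp only [dotProduct, sq]
  have hint : Integrable h := Integrable.fintype_prod fun _ => integrable_exp_neg_mul_sq hs
  have hmeas : AEMeasurable (toLin' A) (volume : Measure (I → ℝ)) :=
    (LinearMap.continuous_of_finiteDimensional _).aemeasurable
  have hmap := Real.map_matrix_volume_pi_eq_smul_volume_pi hA0
  have hint' : Integrable h (Measure.map (toLin' A) volume) := by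
    rw [hmap]
    exact hint.smul_measure ENNReal.ofReal_ne_top
  rw [hcomp]
  refine ⟨hint'.comp_aemeasurable hmeas, ?_⟩
  calc ∫ θ, (h ∘ toLin' A) θ = ∫ y, h y ∂(Measure.map (toLin' A) volume) :=
        (integral_map hmeas hint'.aestronglyMeasurable).symm
    _ = |A.det⁻¹| * ∫ y, h y := by
        rw [hmap, integral_smul_measure, ENNReal.toReal_ofReal (abs_nonneg _), smul_eq_mul]
    _ = |A.det⁻¹| * √(Real.pi / s) ^ Fintype.card I := by
        rw [hh, integral_fintype_prod_volume_eq_pow fun x : ℝ => Real.exp (-s * x ^ 2),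
          integral_gaussian]
    _ = _ := by
        rw [hdet, Real.sqrt_sq_eq_abs, abs_inv]
        ring

/-- The characteristic function of the centred vector `∑ b ∈ T, f b` for a random set `T`
containing each element independently with probability `p`. -/
noncomputable def subsetChar {B I : Type*} [Fintype B] [Fintype I] (p : ℝ) (f : B → I → ℤ)
    (θ : I → ℝ) : ℂ :=
  ∏ b, bernoulliChar p (2 * Real.pi * ∑ i, θ i * f b i)

theorem setIntegral_exp_two_pi_mul (m : ℤ) :
    ∫ x in Set.Ico (0 : ℝ) 1, Complex.exp (2 * Real.pi * m * x * Complex.I)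
      = if m = 0 then 1 else 0 := by
  rw [MeasureTheory.integral_Ico_eq_integral_Ioc, ← intervalIntegral.integral_of_le zero_le_one]
  split_ifs with h
  · simp [h]
  · have hc : (2 * Real.pi * m * Complex.I : ℂ) ≠ 0 := by
      simp [h, Real.pi_ne_zero]
    have h1 := integral_exp_mul_complex (a := 0) (b := 1) hc
    have h2 : Complex.exp (2 * Real.pi * m * Complex.I) = 1 :=
      Complex.exp_eq_one_iff.2 ⟨m, by ring⟩
    simp only [Complex.ofReal_one, mul_one, h2, Complex.ofReal_zero, mul_zero, Complex.exp_zero,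
      sub_self, zero_div] at h1
    rw [← h1]
    congr 1
    ext x
    ring_nf

open Finset in
theorem subsetChar_eq {B I : Type*} [Fintype B] [DecidableEq B] [Fintype I] (p : ℝ)
    (f : B → I → ℤ) (e : I → ℤ) (he : ∀ i, p * ∑ b, (f b i : ℝ) = e i) (θ : I → ℝ) :
    subsetChar p f θ = ∑ T : Finset B, (p ^ #T * (1 - p) ^ (Fintype.card B - #T) : ℂ)
      * ∏ i, Complex.exp (2 * Real.pi * ((∑ b ∈ T, f b i - e i : ℤ) : ℂ) * θ i * Complex.I) := by
  rw [subsetChar]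
  simp only [bernoulliChar, add_comm (((1 : ℂ) - p) * _)]
  rw [prod_add, powerset_univ]
  refine sum_congr rfl fun T _ => ?_
  rw [prod_mul_distrib, prod_mul_distrib, prod_const, prod_const, card_sdiff_of_subset (subset_univ T),
    card_univ, ← Complex.exp_sum, ← Complex.exp_sum, ← Complex.exp_sum,
    mul_mul_mul_comm, ← Complex.exp_add]
  congr 2
  have h1 : ∀ s : Finset B, (∑ b ∈ s, ∑ i, (θ i : ℂ) * f b i) = ∑ i, (θ i : ℂ) * ∑ b ∈ s, (f b i : ℂ) := by
    intro s
    rw [sum_comm]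
    simp only [mul_sum]
  have h2 : (p : ℂ) * ∑ b, ∑ i, (θ i : ℂ) * f b i = ∑ i, (θ i : ℂ) * e i := by
    rw [h1, mul_sum]
    refine sum_congr rfl fun i _ => ?_
    rw [mul_left_comm]
    congr 1
    exact_mod_cast he i
  have h3 := sum_sdiff (subset_univ T) (f := fun b => ∑ i, (θ i : ℂ) * f b i)
  rw [← h3, h1 T] at h2
  push_cast
  rw [← sum_mul, ← sum_mul, ← mul_sum, sum_neg_distrib, ← mul_sum, ← mul_sum, ← mul_sum, h1 T]
  have h4 : ∑ i, 2 * (Real.pi : ℂ) * (∑ b ∈ T, (f b i : ℂ) - e i) * θ i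
      = 2 * Real.pi * (∑ i, (θ i : ℂ) * ∑ b ∈ T, (f b i : ℂ) - ∑ i, (θ i : ℂ) * e i) := by
    rw [← sum_sub_distrib, mul_sum]
    exact sum_congr rfl fun i _ => by ring
  rw [← sum_mul, h4, ← h2]
  ring

open MeasureTheory in
theorem integral_fundamentalDomain_subsetChar {B I : Type*} [Fintype B] [DecidableEq B]
    [Fintype I] (p : ℝ) (f : B → I → ℤ) (e : I → ℤ) (he : ∀ i, p * ∑ b, (f b i : ℝ) = e i) :
    ∫ θ in ZSpan.fundamentalDomain (Pi.basisFun ℝ I), subsetChar p f θ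
      = ((∑ T : Finset B with ∀ i, ∑ b ∈ T, f b i = e i,
          p ^ T.card * (1 - p) ^ (Fintype.card B - T.card) : ℝ) : ℂ) := by
  rw [ZSpan.fundamentalDomain_pi_basisFun, volume_pi, Measure.restrict_pi_pi]
  simp only [subsetChar_eq p f e he]
  have hint : ∀ m : ℤ, Integrable (fun x : ℝ => Complex.exp (2 * Real.pi * m * x * Complex.I))
      (volume.restrict (Set.Ico (0 : ℝ) 1)) := fun m =>
    (Continuous.integrableOn_Icc (by fun_prop)).mono_set Set.Ico_subset_Icc_self
  rw [integral_finsetSum _ fun T _ => ?_]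
  · simp only [integral_const_mul]
    rw [Complex.ofReal_sum, Finset.sum_filter]
    refine Finset.sum_congr rfl fun T _ => ?_
    rw [integral_fintype_prod_eq_prod (f := fun i (x : ℝ) => Complex.exp (2 * Real.pi *
      ((∑ b ∈ T, f b i - e i : ℤ) : ℂ) * x * Complex.I))]
    simp only [setIntegral_exp_two_pi_mul, sub_eq_zero]
    rw [Finset.prod_ite_zero]
    simp only [Finset.mem_univ, true_imp_iff, Finset.prod_const_one]
    split_ifs <;> simp
  · exact (Integrable.fintype_prod (f := fun i (x : ℝ) => Complex.exp (2 * Real.pi *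
      ((∑ b ∈ T, f b i - e i : ℤ) : ℂ) * x * Complex.I)) fun i => hint _).const_mul _

theorem subsetChar_add_int {B I : Type*} [Fintype B] [Fintype I] (p : ℝ) (f : B → I → ℤ)
    (e : I → ℤ) (he : ∀ i, p * ∑ b, (f b i : ℝ) = e i) (z : I → ℤ) (θ : I → ℝ) :
    subsetChar p f (fun i => z i + θ i) = subsetChar p f θ := by
  classical
  rw [subsetChar_eq p f e he, subsetChar_eq p f e he]
  refine Finset.sum_congr rfl fun T _ => ?_
  congr 1
  refine Finset.prod_congr rfl fun i _ => ?_
  set m := ∑ b ∈ T, f b i - e i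
  refine Complex.exp_eq_exp_iff_exists_int.2 ⟨m * z i, ?_⟩
  push_cast
  ring

open MeasureTheory in
/-- A measurable set with disjoint integer translates may be completed, within the unit cube, to a
fundamental domain of the integer lattice. -/
theorem isAddFundamentalDomain_union_diff {I : Type*} [Fintype I] {D : Set (I → ℝ)}
    (hD : MeasurableSet D)
    (hdisj : ∀ θ ∈ D, ∀ g : Submodule.span ℤ (Set.range (Pi.basisFun ℝ I)), g +ᵥ θ ∈ D → g = 0) :
    IsAddFundamentalDomain (Submodule.span ℤ (Set.range (Pi.basisFun ℝ I)))
      (D ∪ (ZSpan.fundamentalDomain (Pi.basisFun ℝ I) \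
        ⋃ g : Submodule.span ℤ (Set.range (Pi.basisFun ℝ I)), (g +ᵥ ·) ⁻¹' D)) volume := by
  set L := Submodule.span ℤ (Set.range (Pi.basisFun ℝ I))
  have hmem : ∀ (g : L) θ, (g +ᵥ θ ∈ ⋃ h : L, (h +ᵥ ·) ⁻¹' D) ↔ θ ∈ ⋃ h : L, (h +ᵥ ·) ⁻¹' D := by
    intro g θ
    simp only [Set.mem_iUnion, Set.mem_preimage, vadd_vadd]
    exact ⟨fun ⟨h, hh⟩ => ⟨_, hh⟩, fun ⟨h, hh⟩ => ⟨h - g, by rwa [sub_add_cancel]⟩⟩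
  have : Countable L := by infer_instance
  refine IsAddFundamentalDomain.mk' (MeasurableSet.nullMeasurableSet ?_) fun θ => ?_
  · refine hD.union ((ZSpan.fundamentalDomain_measurableSet _).diff ?_)
    exact MeasurableSet.iUnion fun g => (measurable_const_vadd g) hD
  · by_cases h : θ ∈ ⋃ h : L, (h +ᵥ ·) ⁻¹' D
    · obtain ⟨g, hg⟩ := Set.mem_iUnion.1 h
      refine ⟨g, Or.inl hg, fun g' hg' => ?_⟩
      rcases hg' with hg' | hg'
      · have := hdisj _ hg (g' - g) (by rwa [vadd_vadd, sub_add_cancel])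
        exact sub_eq_zero.1 this
      · exact absurd ((hmem g' θ).2 h) hg'.2
    · obtain ⟨g, hg, huniq⟩ := ZSpan.exist_unique_vadd_mem_fundamentalDomain (Pi.basisFun ℝ I) θ
      refine ⟨g, Or.inr ⟨hg, fun h' => h ((hmem g θ).1 h')⟩, fun g' hg' => ?_⟩
      rcases hg' with hg' | hg'
      · exact absurd (Set.mem_iUnion.2 ⟨g', hg'⟩) h
      · exact huniq g' hg'.1

theorem mul_sqrt_self_le_exp {u : ℝ} (hu : 0 ≤ u) : u * √u ≤ Real.exp u := by
  have h1 : √u ≤ 1 + u / 2 := by nlinarith [sq_nonneg (√u - 1), Real.sq_sqrt hu]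
  have h2 := Real.quadratic_le_exp_of_nonneg hu
  nlinarith [mul_le_mul_of_nonneg_left h1 hu]

theorem Real.exp_neg_le_inv_sqrt {w : ℝ} (hw : 0 < w) : Real.exp (-w) ≤ 1 / √w := by
  rw [Real.exp_neg, ← one_div]
  refine one_div_le_one_div_of_le (Real.sqrt_pos.2 hw) ?_
  have h1 : √w ≤ w + 1 := by nlinarith [sq_nonneg (√w - 1), Real.sq_sqrt hw.le, Real.sqrt_nonneg w]
  exact h1.trans (Real.add_one_le_exp w)

/-- Near the origin a product of Bernoulli characteristic functions is close to a Gaussian. -/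
theorem norm_prod_bernoulliChar_sub_le {B : Type*} [Fintype B] (x : B → ℝ) {p ε κ r s : ℝ}
    (hp0 : 0 < p) (hp1 : p < 1) (hε0 : 0 < ε) (hε : ε ≤ 1 / 4) (hκ : 10 * κ ^ 2 ≤ ε)
    (hx : ∀ b, |x b| ≤ κ) (hr : ∀ b, |x b| ≤ r * √(∑ b, x b ^ 2)) (hr0 : 0 ≤ r)
    (hs : s = 2 * Real.pi ^ 2 * (p * (1 - p))) :
    ‖∏ b, bernoulliChar p (2 * Real.pi * x b) - Real.exp (-s * ∑ b, x b ^ 2)‖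
      ≤ 2 * (p * (1 - p)) * (2 * Real.pi) ^ 3 * r / (s * ε * √(s * ε))
        * Real.exp (-(s * (1 - 2 * ε)) * ∑ b, x b ^ 2) := by
  set Q := ∑ b, x b ^ 2 with hQ
  have hpq : 0 < p * (1 - p) := mul_pos hp0 (by linarith)
  have hpq4 : p * (1 - p) ≤ 1 / 4 := by nlinarith [sq_nonneg (2 * p - 1)]
  have hpi2 : Real.pi ^ 2 ≤ 10 := by nlinarith [Real.pi_lt_d2, Real.pi_pos]
  have hs0 : 0 < s := by
    rw [hs]
    positivity
  have hs5 : s ≤ 5 := by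
    rw [hs]
    nlinarith [mul_le_mul hpi2 hpq4 hpq.le (by norm_num)]
  have hQ0 : 0 ≤ Q := Finset.sum_nonneg fun _ _ => sq_nonneg _
  have hsx : ∀ b, p * (1 - p) * (2 * Real.pi * x b) ^ 2 / 2 = s * x b ^ 2 := fun b => by
    rw [hs]
    ring
  have hx2 : ∀ b, x b ^ 2 ≤ κ ^ 2 := fun b => by
    rw [← sq_abs]
    exact pow_le_pow_left₀ (abs_nonneg _) (hx b) 2
  have hy2 : ∀ b, (2 * Real.pi * x b) ^ 2 ≤ 8 * ε := fun b => by
    have := hx2 b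
    have h1 : (2 * Real.pi * x b) ^ 2 = 4 * (Real.pi ^ 2 * x b ^ 2) := by ring
    rw [h1]
    have := mul_le_mul hpi2 this (sq_nonneg _) (by norm_num)
    linarith
  have hy : ∀ b, |2 * Real.pi * x b| ≤ 1 := fun b => by
    have h1 : (2 * Real.pi * x b) ^ 2 = 4 * (Real.pi ^ 2 * x b ^ 2) := by ring
    rw [← sq_le_one_iff_abs_le_one, h1]
    have h3 := mul_le_mul hpi2 (hx2 b) (sq_nonneg _) (by norm_num)
    linarith
  have hM : ∀ b, 1 / 2 ≤ Real.exp (-((1 - ε) * (s * x b ^ 2))) := fun b => by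
    have h1 := Real.add_one_le_exp (-((1 - ε) * (s * x b ^ 2)))
    have h2 : (1 - ε) * (s * x b ^ 2) ≤ 1 * (5 * κ ^ 2) := by
      have := hx2 b
      gcongr
      linarith
    linarith [sq_nonneg κ]
  have key := norm_prod_sub_prod_le Finset.univ (fun b => bernoulliChar p (2 * Real.pi * x b))
    (fun b => ((Real.exp (-(s * x b ^ 2)) : ℝ) : ℂ))
    (fun b => Real.exp (-((1 - ε) * (s * x b ^ 2))))
    (fun b => 2 * (p * (1 - p)) * (2 * Real.pi) ^ 3 * (r * √Q) * x b ^ 2)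
    (fun b _ => by
      rw [← hsx]
      exact norm_bernoulliChar_le_of_abs_le hp0.le hp1.le (hy b) (hy2 b))
    (fun b _ => by
      rw [Complex.norm_real, Real.norm_eq_abs, Real.abs_exp]
      have : 0 ≤ ε * (s * x b ^ 2) := by positivity
      exact Real.exp_le_exp.2 (by linarith))
    (fun b _ => by
      have h1 := norm_bernoulliChar_sub_le hp0.le hp1.le (hy b)
      rw [hsx] at h1
      refine h1.trans ?_
      have h2 : |2 * Real.pi * x b| ^ 3 = (2 * Real.pi) ^ 3 * (|x b| * x b ^ 2) := by
        rw [abs_mul, abs_of_pos Real.two_pi_pos, mul_pow, ← sq_abs (x b)]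
        ring
      have h3 : |x b| * x b ^ 2 ≤ r * √Q * x b ^ 2 :=
        mul_le_mul_of_nonneg_right (hr b) (sq_nonneg _)
      rw [h2]
      calc p * (1 - p) * ((2 * Real.pi) ^ 3 * (|x b| * x b ^ 2))
          ≤ p * (1 - p) * ((2 * Real.pi) ^ 3 * (r * √Q * x b ^ 2)) := by gcongr
        _ = 2 * (p * (1 - p)) * (2 * Real.pi) ^ 3 * (r * √Q) * x b ^ 2 * (1 / 2) := by ring
        _ ≤ _ := by
          have := hM b
          gcongr)
  rw [← Complex.ofReal_prod, ← Real.exp_sum, ← Real.exp_sum, Finset.sum_neg_distrib,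
    Finset.sum_neg_distrib, ← Finset.mul_sum, ← Finset.mul_sum, ← Finset.mul_sum,
    ← Finset.mul_sum, ← hQ] at key
  rw [neg_mul]
  refine key.trans ?_
  have hsε : 0 < s * ε := by positivity
  have h1 := mul_sqrt_self_le_exp (u := s * ε * Q) (by positivity)
  rw [Real.sqrt_mul hsε.le] at h1
  have h2 : √Q * Q ≤ Real.exp (s * ε * Q) / (s * ε * √(s * ε)) := by
    rw [le_div_iff₀ (by positivity)]
    linarith
  have h3 : Real.exp (-(s * (1 - 2 * ε)) * Q)
      = Real.exp (s * ε * Q) * Real.exp (-((1 - ε) * (s * Q))) := by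
    rw [← Real.exp_add]
    congr 1
    ring
  rw [h3]
  calc _ = 2 * (p * (1 - p)) * (2 * Real.pi) ^ 3 * r * (√Q * Q)
          * Real.exp (-((1 - ε) * (s * Q))) := by ring
    _ ≤ 2 * (p * (1 - p)) * (2 * Real.pi) ^ 3 * r * (Real.exp (s * ε * Q) / (s * ε * √(s * ε)))
          * Real.exp (-((1 - ε) * (s * Q))) := by gcongr
    _ = _ := by ring

theorem mem_span_basisFun_iff {I : Type*} [Fintype I] (θ : I → ℝ) :
    θ ∈ Submodule.span ℤ (Set.range (Pi.basisFun ℝ I)) ↔ ∃ z : I → ℤ, θ = fun i => (z i : ℝ) := by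
  rw [Module.Basis.mem_span_iff_repr_mem]
  simp only [Pi.basisFun_repr, algebraMap_int_eq, Set.mem_range, eq_intCast]
  constructor
  · intro h
    choose z hz using h
    exact ⟨z, funext fun i => (hz i).symm⟩
  · rintro ⟨z, rfl⟩ i
    exact ⟨z i, rfl⟩

open MeasureTheory Matrix in
/-- A local central limit theorem: the probability that a random subset attains its expected
weight vector is close to a Gaussian density. -/
theorem abs_sum_filter_sub_le {B I : Type*} [Fintype B] [DecidableEq B] [Fintype I]
    [DecidableEq I] (f : B → I → ℤ) (e : I → ℤ) {p L η ε κ : ℝ} (hp0 : 0 < p) (hp1 : p < 1)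
    (he : ∀ i, p * ∑ b, (f b i : ℝ) = e i)
    (hf : ∀ θ : I → ℝ, (∀ b, ∑ i, θ i * f b i = 0) → θ = 0)
    (hL0 : 0 < L)
    (hL : ∀ (θ : I → ℝ) b, (∑ i, θ i * f b i) ^ 2
      ≤ L ^ 2 / Fintype.card B * ∑ b, (∑ i, θ i * f b i) ^ 2)
    (hη : ∀ θ : I → ℝ, ∑ b, (∑ i, θ i * f b i - round (∑ i, θ i * (f b i : ℝ))) ^ 2
        ≤ η * Fintype.card B → ∃ z : I → ℤ, ∀ b, |∑ i, (θ i - z i) * f b i| ≤ κ)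
    (hε0 : 0 < ε) (hε : ε ≤ 1 / 4) (hκ0 : 0 < κ) (hκ : 10 * κ ^ 2 ≤ ε)
    (hεI : Fintype.card I * ε ≤ 1) (hB : 0 < Fintype.card B) :
    |∑ T : Finset B with ∀ i, ∑ b ∈ T, f b i = e i,
          p ^ T.card * (1 - p) ^ (Fintype.card B - T.card)
        - √(1 / (2 * Real.pi * (p * (1 - p)))) ^ Fintype.card I
          / √((Matrix.of fun i j => ∑ b, (f b i : ℝ) * f b j).det)|
      ≤ (6 * L / (ε * √ε) + L / (κ * √ε)) * Real.exp 2 / √(Fintype.card B * (p * (1 - p)))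
          * (√(1 / (2 * Real.pi * (p * (1 - p)))) ^ Fintype.card I
            / √((Matrix.of fun i j => ∑ b, (f b i : ℝ) * f b j).det))
        + Real.exp (-(8 * η * (Fintype.card B * (p * (1 - p))))) := by
  set n : ℝ := (Fintype.card B : ℝ) with hn
  have hn0 : 0 < n := Nat.cast_pos.2 hB
  set x : (I → ℝ) → B → ℝ := fun θ b => ∑ i, θ i * f b i with hx
  set Q : (I → ℝ) → ℝ := fun θ => ∑ b, x θ b ^ 2 with hQ
  set G : Matrix I I ℝ := Matrix.of fun i j => ∑ b, (f b i : ℝ) * f b j with hG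
  set A : Matrix B I ℝ := Matrix.of fun b i => (f b i : ℝ) with hA
  have hxA : ∀ θ, A *ᵥ θ = x θ := fun θ => by
    ext b
    simp only [hA, hx, mulVec, dotProduct, of_apply, mul_comm]
  have hGA : G = Aᴴ * A := by
    ext i j
    simp [hG, hA, mul_apply]
  have hQG : ∀ θ, Q θ = θ ⬝ᵥ G *ᵥ θ := fun θ => by
    rw [hGA, ← mulVec_mulVec, dotProduct_mulVec, conjTranspose_eq_transpose_of_trivial,
      vecMul_transpose, hxA]
    simp only [hQ, dotProduct, sq]
  have hGpos : G.PosDef := by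
    rw [hGA]
    refine PosDef.conjTranspose_mul_self A fun θ θ' h => ?_
    have h1 : A *ᵥ (θ - θ') = 0 := by rw [mulVec_sub, h, sub_self]
    rw [hxA] at h1
    exact sub_eq_zero.1 (hf _ fun b => congrFun h1 b)
  have hpq : 0 < p * (1 - p) := mul_pos hp0 (by linarith)
  set s : ℝ := 2 * Real.pi ^ 2 * (p * (1 - p)) with hs
  have hs0 : 0 < s := by positivity
  set W : ℝ := n * (p * (1 - p)) with hW
  have hW0 : 0 < W := by positivity
  set J : ℝ := √(1 / (2 * Real.pi * (p * (1 - p)))) ^ Fintype.card I / √G.det with hJ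
  have hJ0 : 0 ≤ J := by positivity
  obtain ⟨hgint, hgJ⟩ := hGpos.integral_exp_neg_mul hs0
  obtain ⟨hgint', hgJ'⟩ := hGpos.integral_exp_neg_mul (s := s * (1 - 2 * ε))
    (mul_pos hs0 (by linarith))
  simp only [← hQG] at hgint hgJ hgint' hgJ'
  have hgJ1 : ∫ θ, Real.exp (-s * Q θ) = J := by
    rw [hgJ, hJ, hs]
    congr 3
    field_simp
  have hgJ2 : ∫ θ, Real.exp (-(s * (1 - 2 * ε)) * Q θ) ≤ Real.exp 2 * J := by
    rw [hgJ', hJ, ← mul_div_assoc]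
    gcongr
    have h1 : (1 : ℝ) ≤ (1 - 2 * ε) * Real.exp (2 * ε) ^ 2 := by
      rw [← Real.exp_nat_mul, show ((2 : ℕ) : ℝ) * (2 * ε) = 4 * ε by push_cast; ring]
      have h2 := Real.quadratic_le_exp_of_nonneg (x := 4 * ε) (by positivity)
      have h3 := mul_le_mul_of_nonneg_left h2 (show 0 ≤ 1 - 2 * ε by linarith)
      nlinarith [mul_pos hε0 hε0]
    have h2 : √(Real.pi / (s * (1 - 2 * ε)))
        ≤ √(1 / (2 * Real.pi * (p * (1 - p)))) * Real.exp (2 * ε) := by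
      refine Real.sqrt_le_iff.2 ⟨by positivity, ?_⟩
      rw [mul_pow, Real.sq_sqrt (by positivity), hs, div_le_iff₀ (mul_pos (by positivity) (by linarith))]
      have h3 : Real.pi = 1 / (2 * Real.pi * (p * (1 - p)))
          * (2 * Real.pi ^ 2 * (p * (1 - p))) * 1 := by
        generalize p * (1 - p) = a at hpq
        field_simp
      calc Real.pi = _ := h3
        _ ≤ 1 / (2 * Real.pi * (p * (1 - p))) * (2 * Real.pi ^ 2 * (p * (1 - p)))
            * ((1 - 2 * ε) * Real.exp (2 * ε) ^ 2) := by gcongr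
        _ = _ := by ring
    calc √(Real.pi / (s * (1 - 2 * ε))) ^ Fintype.card I
        ≤ (√(1 / (2 * Real.pi * (p * (1 - p)))) * Real.exp (2 * ε)) ^ Fintype.card I := by gcongr
      _ = Real.exp (2 * (Fintype.card I * ε)) * √(1 / (2 * Real.pi * (p * (1 - p)))) ^ Fintype.card I := by
        rw [mul_pow, ← Real.exp_nat_mul, mul_comm]
        congr 2
        ring
      _ ≤ _ := by
        gcongr
        linarith
  set D : Set (I → ℝ) := {θ | ∀ b, |x θ b| ≤ κ} with hD
  have hDm : MeasurableSet D := by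
    rw [hD, Set.ofPred_forall]
    refine MeasurableSet.iInter fun b => measurableSet_le (Continuous.measurable ?_) measurable_const
    simp only [hx]
    fun_prop
  set A1 : ℝ := 6 * L / (ε * √ε) / √W with hA1
  set A2 : ℝ := L / (κ * √ε) / √W with hA2
  have hxQ : ∀ θ b, |x θ b| ≤ L / √n * √(Q θ) := fun θ b => by
    rw [← Real.sqrt_sq_eq_abs]
    refine (Real.sqrt_le_sqrt (hL θ b)).trans_eq ?_
    rw [Real.sqrt_mul (by positivity), Real.sqrt_div (by positivity), Real.sqrt_sq hL0.le]
  have hnear : ∀ θ ∈ D, ‖subsetChar p f θ - ((Real.exp (-s * Q θ) : ℝ) : ℂ)‖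
      ≤ A1 * Real.exp (-(s * (1 - 2 * ε)) * Q θ) := fun θ hθ => by
    refine (norm_prod_bernoulliChar_sub_le (x θ) hp0 hp1 hε0 hε hκ hθ (hxQ θ) (by positivity)
      hs).trans ?_
    gcongr
    have h1 : √(s * ε) = √2 * Real.pi * √(p * (1 - p)) * √ε := by
      rw [Real.sqrt_mul hs0.le, hs, Real.sqrt_mul (by positivity), Real.sqrt_mul (by norm_num),
        Real.sqrt_sq Real.pi_pos.le]
    have h2 : √W = √n * √(p * (1 - p)) := Real.sqrt_mul hn0.le _
    have h3 : 2 * (p * (1 - p)) * (2 * Real.pi) ^ 3 * (L / √n) / (s * ε * √(s * ε))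
        = 8 / √2 * (L / (ε * √ε) / √W) := by
      rw [h1, h2, hs]
      have := Real.sqrt_pos.2 hpq
      generalize p * (1 - p) = a at *
      field_simp
      ring
    have h4 : 8 / √2 ≤ 6 := by
      rw [div_le_iff₀ (by positivity)]
      nlinarith [Real.sq_sqrt (show (0 : ℝ) ≤ 2 by norm_num), Real.sqrt_nonneg 2]
    rw [h3, hA1]
    calc _ ≤ 6 * (L / (ε * √ε) / √W) := by gcongr
      _ = _ := by ring
  have hfar : ∀ θ ∈ Dᶜ, Real.exp (-s * Q θ) ≤ A2 * Real.exp (-(s * (1 - 2 * ε)) * Q θ) := by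
    intro θ hθ
    simp only [hD, Set.mem_compl_iff, Set.mem_ofPred_eq, not_forall, not_le] at hθ
    obtain ⟨b, hb⟩ := hθ
    have h1 : κ ^ 2 * n ≤ L ^ 2 * Q θ := by
      have h2 : κ ^ 2 ≤ L ^ 2 / n * Q θ := by
        refine le_trans ?_ (hL θ b)
        rw [← sq_abs (∑ i, _)]
        exact pow_le_pow_left₀ hκ0.le hb.le 2
      calc κ ^ 2 * n ≤ L ^ 2 / n * Q θ * n := by gcongr
        _ = _ := by field_simp
    have hpi : 1 ≤ Real.pi ^ 2 := one_le_pow₀ (by linarith [Real.pi_gt_three])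
    have h3 : ε * κ ^ 2 * W / L ^ 2 ≤ s * (2 * ε) * Q θ := by
      rw [div_le_iff₀ (by positivity)]
      calc ε * κ ^ 2 * W = 1 * (ε * (p * (1 - p)) * (κ ^ 2 * n)) := by
            rw [hW]
            ring
        _ ≤ (4 * Real.pi ^ 2) * (ε * (p * (1 - p)) * (L ^ 2 * Q θ)) := by
            gcongr
            linarith
        _ = _ := by
            rw [hs]
            ring
    have h4 := Real.exp_neg_le_inv_sqrt (w := ε * κ ^ 2 * W / L ^ 2) (by positivity)
    have h5 : 1 / √(ε * κ ^ 2 * W / L ^ 2) = A2 := by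
      rw [hA2, Real.sqrt_div (by positivity), Real.sqrt_mul (by positivity),
        Real.sqrt_mul (by positivity), Real.sqrt_sq hκ0.le, Real.sqrt_sq hL0.le]
      field_simp
    rw [h5] at h4
    calc Real.exp (-s * Q θ)
        = Real.exp (-(s * (2 * ε) * Q θ)) * Real.exp (-(s * (1 - 2 * ε)) * Q θ) := by
          rw [← Real.exp_add]
          congr 1
          ring
      _ ≤ _ := by
          gcongr
          exact (Real.exp_le_exp.2 (by linarith)).trans h4
  set E := ZSpan.fundamentalDomain (Pi.basisFun ℝ I) with hE
  set R := E \ ⋃ g : Submodule.span ℤ (Set.range (Pi.basisFun ℝ I)), (g +ᵥ ·) ⁻¹' D with hR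
  have hRm : MeasurableSet R := by
    have : Countable (Submodule.span ℤ (Set.range (Pi.basisFun ℝ I))) := by infer_instance
    refine (ZSpan.fundamentalDomain_measurableSet _).diff (MeasurableSet.iUnion fun g => ?_)
    exact (measurable_const_vadd g) hDm
  have hint : ∀ θ ∈ R, ‖subsetChar p f θ‖ ≤ Real.exp (-(8 * η * W)) := by
    intro θ hθ
    have h1 : η * n ≤ ∑ b, (x θ b - round (x θ b)) ^ 2 := by
      by_contra! h
      obtain ⟨z, hz⟩ := hη θ h.le
      refine hθ.2 (Set.mem_iUnion.2 ⟨⟨fun i => ((-z i : ℤ) : ℝ),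
        (mem_span_basisFun_iff _).2 ⟨fun i => -z i, rfl⟩⟩, fun b => ?_⟩)
      refine (congrArg abs (Finset.sum_congr rfl fun i _ => ?_)).trans_le (hz b)
      simp [Submodule.vadd_def, sub_eq_neg_add]
    rw [subsetChar, norm_prod]
    refine (Finset.prod_le_prod (fun _ _ => norm_nonneg _) fun b _ =>
      norm_bernoulliChar_le hp0.le hp1.le _).trans ?_
    rw [← Real.exp_sum, Real.exp_le_exp, Finset.sum_neg_distrib, ← Finset.mul_sum, neg_le_neg_iff]
    calc 8 * η * W = 8 * (p * (1 - p)) * (η * n) := by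
          rw [hW]
          ring
      _ ≤ _ := by gcongr
  have hdisj : ∀ θ ∈ D, ∀ g : Submodule.span ℤ (Set.range (Pi.basisFun ℝ I)),
      g +ᵥ θ ∈ D → g = 0 := by
    rintro θ hθ ⟨g, hg⟩ hgθ
    obtain ⟨z, rfl⟩ := (mem_span_basisFun_iff g).1 hg
    have h1 : ∀ b, ∑ i, (z i : ℝ) * f b i = 0 := by
      intro b
      have h2 : x (fun i => z i + θ i) b = ∑ i, (z i : ℝ) * f b i + x θ b := by
        simp only [hx, add_mul, Finset.sum_add_distrib]
      have h3 := abs_le.1 (hθ b)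
      have h4 := abs_le.1 (show |x (fun i => z i + θ i) b| ≤ κ from hgθ b)
      rw [h2] at h4
      have h5 : |((∑ i, z i * f b i : ℤ) : ℝ)| < 1 := by
        push_cast
        have h6 : κ < 1 / 2 := by nlinarith
        rw [abs_lt]
        constructor <;> linarith
      have h7 : ∑ i, z i * f b i = 0 := by
        rw [← Int.cast_abs] at h5
        exact Int.abs_lt_one_iff.1 (by exact_mod_cast h5)
      exact_mod_cast h7
    exact Subtype.ext (hf _ h1)
  have hper : ∀ (g : Submodule.span ℤ (Set.range (Pi.basisFun ℝ I))) θ,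
      subsetChar p f (g +ᵥ θ) = subsetChar p f θ := by
    rintro ⟨g, hg⟩ θ
    obtain ⟨z, rfl⟩ := (mem_span_basisFun_iff g).1 hg
    exact subsetChar_add_int p f e he z θ
  have : VAddInvariantMeasure (Submodule.span ℤ (Set.range (Pi.basisFun ℝ I))) (I → ℝ) volume :=
    ⟨fun g t _ => measure_preimage_add volume (g : I → ℝ) t⟩
  have hdom := (isAddFundamentalDomain_union_diff hDm hdisj).setIntegral_eq
    (ZSpan.isAddFundamentalDomain (Pi.basisFun ℝ I) volume) hper
  rw [integral_fundamentalDomain_subsetChar p f e he, ← hE, ← hR] at hdom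
  have hEvol : volume E = 1 := by
    rw [hE, ZSpan.fundamentalDomain_pi_basisFun, volume_pi_pi]
    simp
  have hRvol : volume R ≤ 1 := (measure_mono Set.sdiff_subset).trans_eq hEvol
  have hcont : Continuous (subsetChar p f) := by
    unfold subsetChar bernoulliChar
    fun_prop
  have hRint : IntegrableOn (subsetChar p f) R := by
    exact Measure.integrableOn_of_bounded (ne_top_of_le_ne_top ENNReal.one_ne_top hRvol)
      hcont.aestronglyMeasurable ((ae_restrict_iff' hRm).2 (Filter.Eventually.of_forall hint))
  have hDint : IntegrableOn (subsetChar p f) D := by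
    have h1 : IntegrableOn (fun θ => subsetChar p f θ - ((Real.exp (-s * Q θ) : ℝ) : ℂ)) D := by
      refine Integrable.mono' (hgint'.const_mul A1).integrableOn
        (hcont.aestronglyMeasurable.restrict.sub hgint.ofReal.aestronglyMeasurable.restrict) ?_
      exact (ae_restrict_iff' hDm).2 (Filter.Eventually.of_forall hnear)
    refine (h1.add hgint.ofReal.integrableOn).congr (Filter.Eventually.of_forall fun θ => ?_)
    exact sub_add_cancel _ _
  have hDR : Disjoint D R := by
    refine Set.disjoint_left.2 fun θ hθ hθR => hθR.2 (Set.mem_iUnion.2 ⟨0, ?_⟩)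
    rwa [Set.mem_preimage, zero_vadd]
  rw [setIntegral_union hDR hRm hDint hRint] at hdom
  have hJsplit := integral_add_compl hDm hgint
  rw [hgJ1] at hJsplit
  have b1 : ‖(∫ θ in D, subsetChar p f θ) - ((∫ θ in D, Real.exp (-s * Q θ) : ℝ) : ℂ)‖
      ≤ A1 * (Real.exp 2 * J) := by
    have h1 := integral_sub hDint (hgint.ofReal (𝕜 := ℂ)).integrableOn
    rw [← integral_complex_ofReal]
    refine (congrArg norm h1).symm.trans_le ?_
    refine (norm_integral_le_of_norm_le (hgint'.const_mul A1).integrableOn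
      ((ae_restrict_iff' hDm).2 (Filter.Eventually.of_forall hnear))).trans ?_
    refine (setIntegral_le_integral (hgint'.const_mul A1)
      (Filter.Eventually.of_forall fun θ => by positivity)).trans ?_
    rw [integral_const_mul]
    gcongr
  have b2 : |∫ θ in Dᶜ, Real.exp (-s * Q θ)| ≤ A2 * (Real.exp 2 * J) := by
    rw [abs_of_nonneg (integral_nonneg fun _ => (Real.exp_pos _).le)]
    refine (setIntegral_mono_on hgint.integrableOn (hgint'.const_mul A2).integrableOn hDm.compl
      hfar).trans ?_
    refine (setIntegral_le_integral (hgint'.const_mul A2)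
      (Filter.Eventually.of_forall fun θ => by positivity)).trans ?_
    rw [integral_const_mul]
    gcongr
  have b3 : ‖∫ θ in R, subsetChar p f θ‖ ≤ Real.exp (-(8 * η * W)) := by
    refine (norm_setIntegral_le_of_norm_le_const (hRvol.trans_lt ENNReal.one_lt_top) hint).trans ?_
    have h1 : volume.real R ≤ 1 := ENNReal.toReal_mono ENNReal.one_ne_top hRvol
    exact mul_le_of_le_one_right (Real.exp_pos _).le h1
  rw [← Real.norm_eq_abs, ← Complex.norm_real, Complex.ofReal_sub, ← hdom]
  have h1 : (∫ θ in D, subsetChar p f θ) + (∫ θ in R, subsetChar p f θ) - (J : ℂ)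
      = ((∫ θ in D, subsetChar p f θ) - ((∫ θ in D, Real.exp (-s * Q θ) : ℝ) : ℂ))
        - ((∫ θ in Dᶜ, Real.exp (-s * Q θ) : ℝ) : ℂ) + ∫ θ in R, subsetChar p f θ := by
    rw [← hJsplit]
    push_cast
    ring
  rw [h1]
  refine (norm_add_le _ _).trans (add_le_add ((norm_sub_le _ _).trans ?_) b3)
  rw [Complex.norm_real, Real.norm_eq_abs]
  refine (add_le_add b1 b2).trans_eq ?_
  rw [hA1, hA2]
  ring

open Finset in
/-- The Gaussian prediction for the slice `V.powersetCard k`. -/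
theorem StdFamily.abs_sum_filter_sub_le {α : Type*} [DecidableEq α] {V : Finset α}
    {F : Finset (Finset α)} (h : StdFamily V F) {t k : ℕ} {Y p : ℝ} (R : Regime #V k t Y)
    (hp0 : 0 < p) (hp1 : p < 1) (e : Finset α → ℤ)
    (he : ∀ S ∈ F.filter (#· ≤ t), p * ∑ b ∈ V.powersetCard k, incl ℝ S b = e S) {J : ℝ}
    (hJ : J = √(1 / (2 * Real.pi * (p * (1 - p)))) ^ (#V).choose t
      / √(∏ S ∈ F.filter (#· ≤ t),
        ((#V - t - #S).choose (k - t) : ℝ) / (k - #S).choose (k - t))) :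
    |∑ T ∈ univ.filter fun T : Finset (V.powersetCard k) =>
        ∀ S ∈ F.filter (#· ≤ t), ∑ b ∈ T, incl ℤ S (b : Finset α) = e S,
          p ^ #T * (1 - p) ^ ((#V).choose k - #T) - J|
      ≤ 256 * Y ^ 21 / √((#V).choose k * (p * (1 - p))) * J
        + Real.exp (-((#V).choose k * (p * (1 - p)) / (2 * Y ^ 40))) := by
  have hlt := R.lt
  have hle := R.add_le
  have hY := R.two_le
  have hY0 : 0 < Y := by linarith
  set I := F.filter fun S => #S ≤ t with hI
  have hcB : Fintype.card (V.powersetCard k) = (#V).choose k := by simp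
  have hcI : Fintype.card I = (#V).choose t := by
    rw [Fintype.card_coe]
    exact h.card_filter_le t (by omega)
  have hsum : ∀ (g : Finset α → ℝ) (b : Finset α),
      ∑ S : I, g S * ((incl ℤ (S : Finset α) b : ℤ) : ℝ) = ∑ S ∈ I, g S * incl ℝ S b :=
    fun g b => by
      simp only [intCast_incl]
      exact sum_coe_sort I fun S => g S * incl ℝ S b
  have hext : ∀ θ : I → ℝ, ∃ g : Finset α → ℝ, θ = fun S : I => g S := fun θ =>
    ⟨fun S => if hS : S ∈ I then θ ⟨S, hS⟩ else 0, by
      funext S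
      simp [S.2]⟩
  have hext' : ∀ z : Finset α → ℤ, ∀ g : Finset α → ℝ, ∀ b : Finset α,
      ∑ S : I, (g S - z S) * ((incl ℤ (S : Finset α) b : ℤ) : ℝ)
        = ∑ S ∈ I, (g S - z S) * incl ℝ S b :=
    fun z g b => hsum (fun S => g S - z S) b
  have hdet : (Matrix.of fun S S' : I => ∑ b : V.powersetCard k,
      ((incl ℤ (S : Finset α) (b : Finset α) : ℤ) : ℝ)
        * ((incl ℤ (S' : Finset α) (b : Finset α) : ℤ) : ℝ)).det
      = ∏ S ∈ I, ((#V - t - #S).choose (k - t) : ℝ) / (k - #S).choose (k - t) := by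
    rw [← h.det_gram hlt.le hle]
    congr 1
    ext S S'
    simp only [intCast_incl, Matrix.of_apply]
    exact sum_coe_sort (V.powersetCard k) fun b => incl ℝ (S : Finset α) b * incl ℝ (S' : Finset α) b
  have key := _root_.abs_sum_filter_sub_le
    (fun (b : V.powersetCard k) (S : I) => incl ℤ (S : Finset α) (b : Finset α))
    (fun S : I => e S) (L := Y ^ 3) (η := 1 / (16 * Y ^ 40)) (ε := 1 / (2 * Y))
    (κ := 1 / (4 * Y ^ 17)) hp0 hp1 ?_ ?_ (by positivity) ?_ ?_ (by positivity) ?_ (by positivity)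
    ?_ ?_ ?_
  · rw [hdet, hcI, hcB, ← hJ] at key
    have hJ0 : 0 ≤ J := by
      rw [hJ]
      positivity
    have hpq : 0 < p * (1 - p) := mul_pos hp0 (by linarith)
    have hpred : ∀ T : Finset (V.powersetCard k),
        (∀ S : I, ∑ b ∈ T, incl ℤ (S : Finset α) (b : Finset α) = e S)
          ↔ ∀ S ∈ I, ∑ b ∈ T, incl ℤ S (b : Finset α) = e S := fun T => by
      simp only [Subtype.forall]
    simp only [hpred] at key
    refine key.trans (add_le_add ?_ (Real.exp_le_exp.2 (le_of_eq ?_)))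
    · refine mul_le_mul_of_nonneg_right (div_le_div_of_nonneg_right ?_ (Real.sqrt_nonneg _)) hJ0
      have hs : 1 / √(1 / (2 * Y)) ≤ 2 * Y := by
        rw [Real.sqrt_div zero_le_one, Real.sqrt_one, one_div_one_div]
        exact Real.sqrt_le_iff.2 ⟨by positivity, by nlinarith⟩
      have he2 : Real.exp 2 ≤ 8 := by
        rw [show (2 : ℝ) = (2 : ℕ) * 1 by norm_num, Real.exp_nat_mul]
        have := Real.exp_one_lt_d9
        have := Real.exp_pos 1
        nlinarith
      have hYp : Y ^ 5 ≤ Y ^ 21 := pow_le_pow_right₀ (by linarith) (by norm_num)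
      calc (6 * Y ^ 3 / (1 / (2 * Y) * √(1 / (2 * Y)))
            + Y ^ 3 / (1 / (4 * Y ^ 17) * √(1 / (2 * Y)))) * Real.exp 2
          = (12 * Y ^ 4 + 4 * Y ^ 20) * (1 / √(1 / (2 * Y))) * Real.exp 2 := by
            field_simp
            ring
        _ ≤ (12 * Y ^ 4 + 4 * Y ^ 20) * (2 * Y) * 8 := by gcongr
        _ = 192 * Y ^ 5 + 64 * Y ^ 21 := by ring
        _ ≤ _ := by linarith
    · field_simp
      ring
  · rintro ⟨S, hS⟩
    rw [← he S hS]
    congr 1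
    simp only [intCast_incl]
    exact sum_coe_sort (V.powersetCard k) fun b => incl ℝ S b
  · intro θ hθ
    obtain ⟨g, rfl⟩ := hext θ
    simp only [hsum] at hθ
    obtain ⟨c, -, hc⟩ := h.exists_inverse (k := k) (by omega)
    funext ⟨S', hS'⟩
    have hI' : F.filter (fun S => #S ≤ t) ⊆ F.filter fun S => #S ≤ min k (#V - k) := fun S hS => by
      simp only [mem_filter] at hS ⊢
      exact ⟨hS.1, hS.2.trans (by omega)⟩
    have h1 : ∑ b ∈ V.powersetCard k, (∑ S ∈ I, g S * incl ℝ S b) * (c b S' : ℝ) = 0 :=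
      sum_eq_zero fun b hb => by rw [hθ ⟨b, hb⟩, zero_mul]
    have h2 : ∀ S ∈ I, ∑ b ∈ V.powersetCard k, incl ℝ S b * (c b S' : ℝ)
        = if S = S' then 1 else 0 := fun S hS => by
      have h3 := congrArg (Int.cast : ℤ → ℝ) (hc S (hI' hS) S' (hI' hS'))
      push_cast [intCast_incl] at h3
      exact h3
    simp only [sum_mul] at h1
    rw [sum_comm] at h1
    simp only [mul_assoc, ← mul_sum] at h1
    rw [sum_congr rfl fun S hS => by rw [h2 S hS]] at h1
    simpa [hS'] using h1
  · intro θ b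
    obtain ⟨g, rfl⟩ := hext θ
    simp only [hsum]
    rw [hcB, ← pow_mul]
    refine (StdFamily.sq_sum_le R g b.2).trans_eq ?_
    congr 1
    exact (sum_coe_sort (V.powersetCard k) fun b => (∑ S ∈ I, g S * incl ℝ S b) ^ 2).symm
  · intro θ hθ
    obtain ⟨g, rfl⟩ := hext θ
    simp only [hsum] at hθ
    rw [hcB] at hθ
    obtain ⟨z, hz⟩ := h.exists_int_approx R g ((sum_coe_sort (V.powersetCard k) fun b =>
      (∑ S ∈ I, g S * incl ℝ S b - round (∑ S ∈ I, g S * incl ℝ S b)) ^ 2).symm.trans_le hθ)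
    exact ⟨fun S => z S, fun b => (congrArg abs (hext' z g b)).trans_le (hz b b.2)⟩
  · rw [div_le_div_iff₀ (by positivity) (by norm_num)]
    linarith
  · have hYp : Y ^ 2 ≤ Y ^ 34 := pow_le_pow_right₀ (by linarith) (by norm_num)
    rw [div_pow, mul_pow, ← pow_mul, ← mul_div_assoc, div_le_div_iff₀ (by positivity) (by positivity)]
    norm_num
    nlinarith
  · rw [hcI, mul_one_div, div_le_one (by positivity)]
    linarith [R.choose_le_self]
  · rw [hcB]
    exact Nat.choose_pos (by omega)

theorem Nat.choose_sub_sub_le {n k t : ℕ} (htk : t ≤ k) (hkn : k ≤ n) (s : ℕ) :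
    (n - t - s).choose (k - t) ≤ n.choose k :=
  calc (n - t - s).choose (k - t) ≤ (n - t).choose (k - t) := choose_le_choose _ (by omega)
    _ = (n - t).choose (n - k) := by
      rw [← choose_symm (by omega), show n - t - (k - t) = n - k by omega]
    _ ≤ n.choose (n - k) := choose_le_choose _ (by omega)
    _ = n.choose k := choose_symm hkn

open Finset in
/-- The minor-arc contribution is negligible against the Gaussian main term. -/
theorem StdFamily.exp_neg_le {α : Type*} [DecidableEq α] {V : Finset α}
    {F : Finset (Finset α)} (h : StdFamily V F) {t k : ℕ} {Y p : ℝ} (R : Regime #V k t Y)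
    (hpq : 0 < p * (1 - p)) (hW : 144 * Y ^ 82 ≤ (#V).choose k * (p * (1 - p))) :
    Real.exp (-((#V).choose k * (p * (1 - p)) / (2 * Y ^ 40)))
      ≤ 1 / √((#V).choose k * (p * (1 - p)))
        * (√(1 / (2 * Real.pi * (p * (1 - p)))) ^ (#V).choose t
          / √(∏ S ∈ F.filter (#· ≤ t),
            ((#V - t - #S).choose (k - t) : ℝ) / (k - #S).choose (k - t))) := by
  have hlt := R.lt
  have hle := R.add_le
  have hY := R.two_le
  have hY0 : 0 < Y := by linarith
  set d := (#V).choose t with hd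
  set n : ℝ := ((#V).choose k : ℝ) with hn
  set a := p * (1 - p) with ha
  have hn0 : 0 < n := Nat.cast_pos.2 (Nat.choose_pos (by omega))
  have hW1 : 1 ≤ n * a := by
    refine le_trans ?_ hW
    have : 1 ≤ Y ^ 82 := one_le_pow₀ (by linarith)
    linarith
  set W := n * a with hWdef
  have hfac : ∀ S ∈ F.filter (#· ≤ t),
      (0 : ℝ) < ((#V - t - #S).choose (k - t) : ℝ) / (k - #S).choose (k - t) := fun S hS => by
    have hS' := (mem_filter.1 hS).2
    have h1 := Nat.choose_pos (show k - t ≤ #V - t - #S by omega)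
    have h2 := Nat.choose_pos (show k - t ≤ k - #S by omega)
    positivity
  have hdet0 := prod_pos hfac
  have hdet : ∏ S ∈ F.filter (#· ≤ t),
      ((#V - t - #S).choose (k - t) : ℝ) / (k - #S).choose (k - t) ≤ n ^ d := by
    rw [hd, ← h.card_filter_le t (by omega), ← prod_const]
    refine prod_le_prod (fun S hS => (hfac S hS).le) fun S hS => ?_
    have hS' := (mem_filter.1 hS).2
    have h2 := Nat.choose_pos (show k - t ≤ k - #S by omega)
    refine (div_le_self (Nat.cast_nonneg _) (by exact_mod_cast h2)).trans ?_
    exact Nat.cast_le.2 (Nat.choose_sub_sub_le hlt.le (by omega) #S)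
  set P := ∏ S ∈ F.filter (#· ≤ t),
      ((#V - t - #S).choose (k - t) : ℝ) / (k - #S).choose (k - t) with hP
  have hJ : √(1 / (7 * W)) ^ d ≤ √(1 / (2 * Real.pi * a)) ^ d / √P := by
    rw [le_div_iff₀ (Real.sqrt_pos.2 hdet0)]
    calc √(1 / (7 * W)) ^ d * √P ≤ √(1 / (7 * W)) ^ d * √(n ^ d) := by gcongr
      _ = (√(1 / (7 * W)) * √n) ^ d := by
        rw [mul_pow]
        congr 1
        rw [Real.sqrt_eq_iff_mul_self_eq (by positivity) (by positivity), ← mul_pow,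
          Real.mul_self_sqrt hn0.le]
      _ = √(1 / (7 * a)) ^ d := by
        rw [← Real.sqrt_mul (by positivity), hWdef]
        congr 2
        field_simp
      _ ≤ _ := by
        have : 2 * Real.pi ≤ 7 := by linarith [Real.pi_lt_d2]
        gcongr
  refine le_trans ?_ (mul_le_mul_of_nonneg_left hJ (by positivity))
  have hu : √(7 * W) ≤ Real.exp √(7 * W) := by linarith [Real.add_one_le_exp √(7 * W)]
  have h2 : 1 / Real.exp √(7 * W) ≤ √(1 / (7 * W)) := by
    rw [Real.sqrt_div zero_le_one, Real.sqrt_one]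
    exact one_div_le_one_div_of_le (Real.sqrt_pos.2 (by positivity)) hu
  have h3 : 1 / Real.exp √(7 * W) ≤ 1 / √W := by
    refine one_div_le_one_div_of_le (Real.sqrt_pos.2 (by positivity)) (le_trans ?_ hu)
    exact Real.sqrt_le_sqrt (by linarith)
  calc Real.exp (-(W / (2 * Y ^ 40)))
      ≤ Real.exp (-(((d + 1 : ℕ) : ℝ) * √(7 * W))) := by
        rw [Real.exp_le_exp, neg_le_neg_iff, le_div_iff₀ (by positivity)]
        have h4 : ((d + 1 : ℕ) : ℝ) ≤ 2 * Y := by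
          push_cast
          linarith [R.choose_le_self]
        have h5 : √(7 * W) ≤ 3 * √W := by
          rw [Real.sqrt_mul (by norm_num)]
          gcongr
          exact Real.sqrt_le_iff.2 ⟨by norm_num, by norm_num⟩
        have h6 : 12 * Y ^ 41 ≤ √W := by
          refine Real.le_sqrt_of_sq_le (le_trans (le_of_eq ?_) hW)
          ring
        calc ((d + 1 : ℕ) : ℝ) * √(7 * W) * (2 * Y ^ 40)
            ≤ (2 * Y) * (3 * √W) * (2 * Y ^ 40) := by gcongr
          _ = (12 * Y ^ 41) * √W := by ring
          _ ≤ √W * √W := by gcongr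
          _ = W := Real.mul_self_sqrt (by positivity)
    _ = 1 / Real.exp √(7 * W) * (1 / Real.exp √(7 * W)) ^ d := by
        rw [Real.exp_neg, Real.exp_nat_mul, pow_succ, one_div_pow]
        field_simp
    _ ≤ _ := by gcongr

open Finset in
theorem sum_incl_powersetCard {R : Type*} [Ring R] {α : Type*} [DecidableEq α] {V S : Finset α}
    {k : ℕ} (hS : S ⊆ V) (hk : #S ≤ k) :
    ∑ b ∈ V.powersetCard k, incl R S b = ((#V - #S).choose (k - #S) : R) := by
  unfold incl
  rw [← sum_filter, sum_const, nsmul_eq_mul, mul_one, card_filter_powersetCard_subset _ _ _ hS hk]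

open Finset in
theorem sum_incl_eq_card_filter {α : Type*} [DecidableEq α] (S : Finset α)
    (T : Finset (Finset α)) : ∑ b ∈ T, incl ℤ S b = #(T.filter (S ⊆ ·)) := by
  unfold incl
  rw [← sum_filter, sum_const, nsmul_eq_mul, mul_one]

open Finset in
/-- In a design, every set of at most `t` points lies in the average number of blocks. -/
theorem choose_mul_card_filter_of_forall_card_filter_eq {α : Type*} [DecidableEq α] {V : Finset α}
    {t k lam : ℕ} (htk : t ≤ k) {T : Finset (Finset α)} (hT : T ⊆ V.powersetCard k)
    (hlam : ∀ A ∈ V.powersetCard t, #(T.filter (A ⊆ ·)) = lam) {S : Finset α} (hS : S ⊆ V)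
    (hSt : #S ≤ t) :
    (#V).choose #S * #(T.filter (S ⊆ ·)) = k.choose #S * #T := by
  have key : ∀ S ⊆ V, #S ≤ t →
      #(T.filter (S ⊆ ·)) * (k - #S).choose (t - #S) = lam * (#V - #S).choose (t - #S) := by
    intro S hS hSt
    have h1 := sum_card_bipartiteAbove_eq_sum_card_bipartiteBelow
      (s := (V.powersetCard t).filter (S ⊆ ·)) (t := T) (fun A b => A ⊆ b)
    simp only [bipartiteAbove, bipartiteBelow] at h1
    rw [sum_congr rfl fun A hA => hlam A (mem_filter.1 hA).1, sum_const, smul_eq_mul,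
      card_filter_powersetCard_subset _ _ _ hS hSt] at h1
    rw [mul_comm lam, h1, card_filter, sum_mul]
    refine sum_congr rfl fun b hb => ?_
    obtain ⟨hbV, hbk⟩ := mem_powersetCard.1 (hT hb)
    have h2 : ((V.powersetCard t).filter (S ⊆ ·)).filter (· ⊆ b)
        = (b.powersetCard t).filter (S ⊆ ·) := by
      ext A
      simp only [mem_filter, mem_powersetCard]
      exact ⟨fun h => ⟨⟨h.2, h.1.1.2⟩, h.1.2⟩, fun h => ⟨⟨⟨h.1.1.trans hbV, h.1.2⟩, h.2⟩, h.1.1⟩⟩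
    rw [h2]
    split_ifs with h
    · rw [card_filter_powersetCard_subset _ _ _ h hSt, hbk, one_mul]
    · rw [zero_mul, eq_comm, card_eq_zero, filter_eq_empty_iff]
      exact fun A hA hSA => h (hSA.trans (mem_powersetCard.1 hA).1)
  rcases Nat.lt_or_ge #V k with hk | hk
  · rw [powersetCard_eq_empty.2 hk, subset_empty] at hT
    simp [hT]
  have h1 := key S hS hSt
  have h2 := key ∅ (empty_subset V) (by simp)
  simp only [card_empty, Nat.sub_zero, empty_subset, filter_true] at h2
  have h3 : (#V).choose t * t.choose #S = (#V).choose #S * (#V - #S).choose (t - #S) :=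
    Nat.choose_mul hSt
  have h4 : k.choose t * t.choose #S = k.choose #S * (k - #S).choose (t - #S) :=
    Nat.choose_mul hSt
  refine Nat.eq_of_mul_eq_mul_right (Nat.choose_pos (show t - #S ≤ k - #S by omega)) ?_
  calc (#V).choose #S * #(T.filter (S ⊆ ·)) * (k - #S).choose (t - #S)
      = (#V).choose #S * (#(T.filter (S ⊆ ·)) * (k - #S).choose (t - #S)) := mul_assoc _ _ _
    _ = lam * ((#V).choose #S * (#V - #S).choose (t - #S)) := by
      rw [h1]
      ring
    _ = lam * (#V).choose t * t.choose #S := by rw [← h3, mul_assoc]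
    _ = #T * (k.choose t * t.choose #S) := by rw [← h2, mul_assoc]
    _ = _ := by
      rw [h4]
      ring

open Finset in
/-- If every set of the standard family lies in the average number of blocks, then the blocks
form a design. -/
theorem StdFamily.exists_card_filter_eq {α : Type*} [DecidableEq α] {V : Finset α}
    {F : Finset (Finset α)} (h : StdFamily V F) {t k : ℕ} {p : ℝ} (ht : 2 * t ≤ #V) (htk : t ≤ k)
    {T : Finset (Finset α)} (hT : T ⊆ V.powersetCard k)
    (hp : ∀ S ∈ F.filter (#· ≤ t),
      p * ∑ b ∈ V.powersetCard k, incl ℝ S b = #(T.filter (S ⊆ ·))) :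
    ∃ lam : ℕ, ∀ A ∈ V.powersetCard t, #(T.filter (A ⊆ ·)) = lam := by
  obtain ⟨c, hc⟩ := h.incl_eq_sum (k := k) ht
  have hc' : ∀ A ∈ V.powersetCard t, ∀ b ∈ V.powersetCard k,
      incl ℝ A b = ∑ S ∈ F.filter (#· ≤ t), c A S * incl ℝ S b := fun A hA b hb => by
    have := congrArg (Int.cast : ℤ → ℝ) (hc A hA b hb)
    push_cast [intCast_incl] at this
    exact this
  have hcard : ∀ A, (#(T.filter (A ⊆ ·)) : ℝ) = ∑ b ∈ T, incl ℝ A b := fun A => by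
    unfold incl
    rw [← sum_filter, sum_const, nsmul_eq_mul, mul_one]
  have key : ∀ A ∈ V.powersetCard t,
      (#(T.filter (A ⊆ ·)) : ℝ) = p * (#V - t).choose (k - t) := fun A hA => by
    obtain ⟨hA1, hA2⟩ := mem_powersetCard.1 hA
    have h1 := sum_incl_powersetCard (R := ℝ) hA1 (hA2.trans_le htk)
    rw [hA2, sum_congr rfl fun b hb => hc' A hA b hb, sum_comm] at h1
    rw [← h1, hcard, sum_congr rfl fun b hb => hc' A hA b (hT hb), sum_comm, mul_sum]
    refine sum_congr rfl fun S hS => ?_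
    rw [← mul_sum, ← hcard, ← hp S hS, ← mul_sum]
    ring
  obtain ⟨A₀, hA₀⟩ := powersetCard_nonempty.2 (show t ≤ #V by omega)
  exact ⟨#(T.filter (A₀ ⊆ ·)), fun A hA => by exact_mod_cast (key A hA).trans (key A₀ hA₀).symm⟩

open Finset in
/-- The number of incidences with a set expected of a random family of blocks of density
`N / (#V).choose k`. -/
theorem density_mul_sum_incl {α : Type*} [DecidableEq α] {V S : Finset α} {k N : ℕ} {e : ℤ}
    (hS : S ⊆ V) (hk : #S ≤ k) (hkV : k ≤ #V)
    (he : ((#V).choose #S : ℤ) * e = (k.choose #S : ℤ) * N) :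
    (N : ℝ) / (#V).choose k * ∑ b ∈ V.powersetCard k, incl ℝ S b = e := by
  have h1 : ((#V).choose k : ℝ) * k.choose #S = (#V).choose #S * (#V - #S).choose (k - #S) := by
    exact_mod_cast Nat.choose_mul hk
  have h2 : ((#V).choose #S : ℝ) * e = k.choose #S * N := by exact_mod_cast he
  have h3 : (0 : ℝ) < (#V).choose #S := Nat.cast_pos.2 (Nat.choose_pos (hk.trans hkV))
  have h4 : (0 : ℝ) < (#V).choose k := Nat.cast_pos.2 (Nat.choose_pos hkV)
  rw [sum_incl_powersetCard hS hk, div_mul_eq_mul_div, div_eq_iff h4.ne']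
  refine mul_left_cancel₀ h3.ne' ?_
  calc ((#V).choose #S : ℝ) * (N * (#V - #S).choose (k - #S))
      = N * ((#V).choose #S * (#V - #S).choose (k - #S)) := by ring
    _ = (k.choose #S * N) * (#V).choose k := by
      rw [← h1]
      ring
    _ = _ := by
      rw [← h2]
      ring

open Finset in
/-- Designs of size `N` are the families of blocks with prescribed incidences with the standard
family. -/
theorem StdFamily.isDesign_iff {v k t N : ℕ} {F : Finset (Finset (Fin v))}
    (h : StdFamily univ F) (ht : 2 * t ≤ v) (htk : t ≤ k) (hkv : k ≤ v) {e : Finset (Fin v) → ℤ}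
    (he : ∀ S ∈ F.filter (#· ≤ t), (v.choose #S : ℤ) * e S = (k.choose #S : ℤ) * N)
    (T : Finset (Finset (Fin v))) :
    ((∃ lam, IsDesign v k t lam T) ∧ #T = N)
      ↔ T ⊆ univ.powersetCard k ∧ ∀ S ∈ F.filter (#· ≤ t), ∑ b ∈ T, incl ℤ S b = e S := by
  simp only [sum_incl_eq_card_filter]
  constructor
  · rintro ⟨⟨lam, hk, hlam⟩, rfl⟩
    have hT : T ⊆ univ.powersetCard k := fun b hb => mem_powersetCard.2 ⟨subset_univ b, hk b hb⟩
    refine ⟨hT, fun S hS => ?_⟩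
    have hSt := (mem_filter.1 hS).2
    have h1 := choose_mul_card_filter_of_forall_card_filter_eq htk hT
      (fun A hA => hlam A (mem_powersetCard.1 hA).2) (subset_univ S) hSt
    rw [card_univ, Fintype.card_fin] at h1
    have h2 : (v.choose #S : ℤ) ≠ 0 := by
      exact_mod_cast (Nat.choose_pos (show #S ≤ v by omega)).ne'
    refine mul_left_cancel₀ h2 ?_
    rw [he S hS]
    exact_mod_cast h1
  · rintro ⟨hT, hST⟩
    have hN : #T = N := by
      have h0 : ∅ ∈ F.filter (#· ≤ t) := mem_filter.2 ⟨h.empty_mem, by simp⟩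
      have h1 := he ∅ h0
      have h2 := hST ∅ h0
      simp only [empty_subset, filter_true, card_empty, Nat.choose_zero_right, Nat.cast_one,
        one_mul] at h1 h2
      exact_mod_cast h2.trans h1
    refine ⟨?_, hN⟩
    obtain ⟨lam, hlam⟩ := h.exists_card_filter_eq (p := (N : ℝ) / (#(univ : Finset (Fin v))).choose k)
      (by simpa using ht) htk hT fun S hS => by
        rw [density_mul_sum_incl (subset_univ S) ((mem_filter.1 hS).2.trans htk) (by simpa using hkv)
          (by simpa using he S hS), ← hST S hS, Int.cast_natCast]
    exact ⟨lam, fun b hb => (mem_powersetCard.1 (hT hb)).2, fun A hA =>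
      hlam A (mem_powersetCard.2 ⟨subset_univ A, hA⟩)⟩

open Finset in
theorem Nat.card_subtype_subset_and {α : Type*} [Fintype α] [DecidableEq α] (P : Finset α)
    (Q : Finset α → Prop) [DecidablePred fun T : Finset P => Q (T.map (Function.Embedding.subtype _))] :
    Nat.card {T : Finset α // T ⊆ P ∧ Q T}
      = #(univ.filter fun T : Finset P => Q (T.map (Function.Embedding.subtype _))) := by
  classical
  rw [Nat.card_eq_fintype_card, Fintype.card_subtype]
  symm
  refine card_bij (fun T _ => T.map (Function.Embedding.subtype _)) ?_ ?_ ?_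
  · intro T hT
    simp only [mem_filter, mem_univ, true_and] at hT ⊢
    refine ⟨fun b hb => ?_, hT⟩
    obtain ⟨b', -, rfl⟩ := mem_map.1 hb
    exact b'.2
  · intro T _ T' _ hTT'
    exact map_injective _ hTT'
  · intro T hT
    simp only [mem_filter, mem_univ, true_and] at hT
    have h1 : (T.subtype (· ∈ P)).map (Function.Embedding.subtype _) = T := by
      rw [subtype_map, filter_true_of_mem fun b hb => hT.1 hb]
    exact ⟨T.subtype (· ∈ P), by simpa [h1] using hT.2, h1⟩

open Finset in
theorem StdFamily.sum_filter_eq_card_mul {v k t N : ℕ} {F : Finset (Finset (Fin v))}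
    (h : StdFamily univ F) (ht : 2 * t ≤ v) (htk : t ≤ k) (hkv : k ≤ v) {e : Finset (Fin v) → ℤ}
    (he : ∀ S ∈ F.filter (#· ≤ t), (v.choose #S : ℤ) * e S = (k.choose #S : ℤ) * N) (p : ℝ)
    [DecidablePred fun T : Finset ((univ : Finset (Fin v)).powersetCard k) =>
      ∀ S ∈ F.filter (#· ≤ t), ∑ b ∈ T, incl ℤ S (b : Finset (Fin v)) = e S] :
    ∑ T ∈ univ.filter fun T : Finset ((univ : Finset (Fin v)).powersetCard k) =>
        ∀ S ∈ F.filter (#· ≤ t), ∑ b ∈ T, incl ℤ S (b : Finset (Fin v)) = e S,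
          p ^ #T * (1 - p) ^ (v.choose k - #T)
      = Nat.card {T : Finset (Finset (Fin v)) // (∃ lam : ℕ, IsDesign v k t lam T) ∧ #T = N}
        * (p ^ N * (1 - p) ^ (v.choose k - N)) := by
  have h1 : ∀ T ∈ univ.filter fun T : Finset ((univ : Finset (Fin v)).powersetCard k) =>
      ∀ S ∈ F.filter (#· ≤ t), ∑ b ∈ T, incl ℤ S (b : Finset (Fin v)) = e S, #T = N := by
    intro T hT
    have h0 : ∅ ∈ F.filter (#· ≤ t) := mem_filter.2 ⟨h.empty_mem, by simp⟩
    have h2 := (mem_filter.1 hT).2 ∅ h0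
    have h3 := he ∅ h0
    simp only [incl, empty_subset, if_true, sum_const, card_empty, Nat.choose_zero_right,
      Nat.cast_one, one_mul, nsmul_eq_mul, mul_one] at h2 h3
    exact_mod_cast h2.trans h3
  rw [sum_congr rfl fun T hT => by rw [h1 T hT], sum_const, nsmul_eq_mul]
  congr 2
  simp only [h.isDesign_iff ht htk hkv he]
  classical
  rw [Nat.card_subtype_subset_and _ fun T => ∀ S ∈ F.filter (#· ≤ t), ∑ b ∈ T, incl ℤ S b = e S]
  simp only [sum_map, Function.Embedding.subtype_apply]

open Finset in
theorem StdFamily.card_filter_eq {α : Type*} [DecidableEq α] {V : Finset α}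
    {F : Finset (Finset α)} (h : StdFamily V F) {s : ℕ} (hs : 2 * s ≤ #V) :
    (#(F.filter (#· = s)) : ℝ)
      = (#V).choose s - if s = 0 then (0 : ℝ) else ((#V).choose (s - 1) : ℝ) := by
  rw [eq_sub_iff_add_eq]
  have := h.card_add s (by omega)
  split_ifs at this ⊢ with h0 <;> exact_mod_cast this

open Finset in
/-- The Gaussian main term in closed form. -/
theorem StdFamily.gaussian_eq {α : Type*} [DecidableEq α] {V : Finset α}
    {F : Finset (Finset α)} (h : StdFamily V F) {t k : ℕ} (ht : 2 * t ≤ #V) {a : ℝ} (ha : 0 < a) :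
    √(1 / a) ^ (#V).choose t / √(∏ S ∈ F.filter (#· ≤ t),
        ((#V - t - #S).choose (k - t) : ℝ) / (k - #S).choose (k - t))
      = 1 / a ^ (((#V).choose t : ℝ) / 2)
        * ∏ s ∈ range (t + 1), (((k - s).choose (k - t) : ℝ) / ((#V - t - s).choose (k - t) : ℝ))
            ^ ((1 / 2 : ℝ) * (((#V).choose s : ℝ)
              - if s = 0 then (0 : ℝ) else ((#V).choose (s - 1) : ℝ))) := by
  rw [div_eq_mul_inv]
  congr 1
  · rw [Real.sqrt_eq_rpow, ← Real.rpow_natCast, ← Real.rpow_mul (by positivity), one_div,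
      Real.inv_rpow ha.le, one_div]
    ring_nf
  · have hmaps : ∀ S ∈ F.filter (#· ≤ t), #S ∈ range (t + 1) := fun S hS =>
      mem_range_succ_iff.2 (mem_filter.1 hS).2
    rw [← Real.sqrt_inv, ← prod_inv_distrib, ← prod_fiberwise_of_maps_to hmaps, Real.sqrt_eq_rpow,
      ← Real.finsetProd_rpow _ _ fun s _ => prod_nonneg fun S _ => by positivity]
    refine prod_congr rfl fun s hs => ?_
    have hst := mem_range_succ_iff.1 hs
    have h1 : (F.filter (#· ≤ t)).filter (#· = s) = F.filter (#· = s) := by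
      rw [filter_filter]
      refine filter_congr fun S _ => ⟨fun h => h.2, fun h => ⟨by omega, h⟩⟩
    rw [h1, ← h.card_filter_eq (by omega), mul_comm (1 / 2 : ℝ), Real.rpow_mul (by positivity),
      Real.rpow_natCast, ← prod_const]
    congr 1
    refine prod_congr rfl fun S hS => ?_
    rw [(mem_filter.1 hS).2, inv_div]

theorem half_min_le_mul_density {N n : ℕ} (hN : N ≤ n) (hn : 0 < n) :
    ((min N (n - N) : ℕ) : ℝ) / 2 ≤ n * (N / n * (1 - N / n)) := by
  have hn' : (0 : ℝ) < n := Nat.cast_pos.2 hn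
  have h1 : (n : ℝ) * (N / n * (1 - N / n)) = N * (n - N) / n := by
    field_simp
  rw [h1, Nat.cast_min, Nat.cast_sub hN, div_le_div_iff₀ two_pos hn']
  have h2 : (0 : ℝ) ≤ N := Nat.cast_nonneg N
  have h3 : (N : ℝ) ≤ n := Nat.cast_le.2 hN
  rcases le_total (N : ℝ) (n - N) with h | h
  · rw [min_eq_left h]
    nlinarith
  · rw [min_eq_right h]
    nlinarith

open Finset in
/-- The asymptotic count of designs in the main range of parameters. -/
theorem Regime.exists_card_isDesign_eq {v t k N : ℕ} {Y : ℝ} (R : Regime v k t Y)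
    (hdvd : ∀ s : ℕ, 1 ≤ s → s ≤ t → (v.choose s : ℤ) ∣ (k.choose s : ℤ) * N)
    (hN : Y ^ 92 ≤ ((min N (v.choose k - N) : ℕ) : ℝ)) :
    ∃ δ : ℝ, |δ| ≤ Y ^ 92 / √((min N (v.choose k - N) : ℕ) : ℝ) ∧
      (Nat.card {T : Finset (Finset (Fin v)) //
          (∃ lam : ℕ, IsDesign v k t lam T) ∧ T.card = N} : ℝ)
        = 1 / ((2 * Real.pi * ((N : ℝ) / (v.choose k : ℝ))
                  * (1 - (N : ℝ) / (v.choose k : ℝ))) ^ ((v.choose t : ℝ) / 2)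
                * ((N : ℝ) / (v.choose k : ℝ)) ^ N
                * (1 - (N : ℝ) / (v.choose k : ℝ)) ^ (v.choose k - N))
            * (∏ s ∈ Finset.range (t + 1),
                (((k - s).choose (k - t) : ℝ) / ((v - t - s).choose (k - t) : ℝ))
                  ^ ((1 / 2 : ℝ) * ((v.choose s : ℝ)
                      - if s = 0 then (0 : ℝ) else (v.choose (s - 1) : ℝ))))
            * (1 + δ) := by
  have hlt := R.lt
  have hle := R.add_le
  have hY := R.two_le
  have hY0 : 0 < Y := by linarith
  obtain ⟨F, h⟩ := exists_stdFamily (univ : Finset (Fin v))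
  have hcard : #(univ : Finset (Fin v)) = v := by simp
  have hm0 : (0 : ℝ) < ((min N (v.choose k - N) : ℕ) : ℝ) := lt_of_lt_of_le (by positivity) hN
  have hm0' := Nat.cast_pos.1 hm0
  have hN0 : 0 < N := by omega
  have hNn : N < v.choose k := by omega
  have hW := half_min_le_mul_density hNn.le (by omega)
  set m : ℝ := ((min N (v.choose k - N) : ℕ) : ℝ) with hm
  set p : ℝ := (N : ℝ) / (v.choose k : ℝ) with hp
  have hn0 : (0 : ℝ) < v.choose k := Nat.cast_pos.2 (by omega)
  have hp0 : 0 < p := div_pos (Nat.cast_pos.2 hN0) hn0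
  have hp1 : p < 1 := (div_lt_one hn0).2 (Nat.cast_lt.2 hNn)
  have hpq : 0 < p * (1 - p) := mul_pos hp0 (by linarith)
  have hdvd' : ∀ s ≤ t, (v.choose s : ℤ) ∣ (k.choose s : ℤ) * N := fun s hs => by
    rcases Nat.eq_zero_or_pos s with rfl | h0
    · simp
    · exact hdvd s h0 hs
  have hex : ∃ e : Finset (Fin v) → ℤ, ∀ S ∈ F.filter (#· ≤ t),
      (v.choose #S : ℤ) * e S = (k.choose #S : ℤ) * N :=
    ⟨fun S => (k.choose #S : ℤ) * N / v.choose #S, fun S hS =>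
      Int.mul_ediv_cancel' (hdvd' _ (mem_filter.1 hS).2)⟩
  obtain ⟨e, he⟩ := hex
  set J : ℝ := √(1 / (2 * Real.pi * (p * (1 - p)))) ^ v.choose t
      / √(∏ S ∈ F.filter (#· ≤ t),
        ((v - t - #S).choose (k - t) : ℝ) / (k - #S).choose (k - t)) with hJ
  have hJeq := h.gaussian_eq (t := t) (k := k) (by omega)
    (show 0 < 2 * Real.pi * (p * (1 - p)) by positivity)
  have hYW : 144 * Y ^ 82 ≤ v.choose k * (p * (1 - p)) := by
    have h10 : (2 : ℝ) ^ 10 ≤ Y ^ 10 := pow_le_pow_left₀ (by norm_num) hY 10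
    have h82 : 0 < Y ^ 82 := by positivity
    have : Y ^ 92 = Y ^ 82 * Y ^ 10 := by ring
    nlinarith
  have hest := h.abs_sum_filter_sub_le (p := p) (by rwa [hcard]) hp0 hp1 e (fun S hS => by
    have := density_mul_sum_incl (subset_univ S) ((mem_filter.1 hS).2.trans hlt.le)
      (by omega) (by rw [hcard]; exact he S hS)
    rwa [hcard] at this) rfl
  have hexp := h.exp_neg_le (k := k) (t := t) (by rwa [hcard]) hpq (by rwa [hcard])
  rw [hcard] at hest hexp hJeq
  rw [h.sum_filter_eq_card_mul (by omega) hlt.le (by omega) he] at hest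
  rw [← hJ] at hest hexp hJeq
  set X : ℝ := (Nat.card {T : Finset (Finset (Fin v)) //
          (∃ lam : ℕ, IsDesign v k t lam T) ∧ T.card = N} : ℝ) with hX
  set W : ℝ := v.choose k * (p * (1 - p)) with hWdef
  have hW0 : 0 < W := by positivity
  have hJ0 : 0 < J := by
    by_contra hJ0
    have := Real.exp_pos (-(W / (2 * Y ^ 40)))
    have : 1 / √W * J ≤ 0 := mul_nonpos_of_nonneg_of_nonpos (by positivity) (not_lt.1 hJ0)
    linarith
  have hq : 0 < 1 - p := by linarith
  refine ⟨X * (p ^ N * (1 - p) ^ (v.choose k - N)) / J - 1, ?_, ?_⟩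
  · rw [div_sub_one hJ0.ne', abs_div, abs_of_pos hJ0, div_le_iff₀ hJ0]
    refine hest.trans ((add_le_add_right hexp _).trans ?_)
    have h1 : 1 / √W ≤ 2 / √m := by
      rw [div_le_div_iff₀ (Real.sqrt_pos.2 hW0) (Real.sqrt_pos.2 hm0), one_mul]
      refine Real.sqrt_le_iff.2 ⟨by positivity, ?_⟩
      rw [mul_pow, Real.sq_sqrt hW0.le]
      linarith
    have h2 : 256 * Y ^ 21 + 1 ≤ Y ^ 92 / 2 := by
      have h10 : (2 : ℝ) ^ 10 ≤ Y ^ 10 := pow_le_pow_left₀ (by norm_num) hY 10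
      have h21 : 1 ≤ Y ^ 21 := one_le_pow₀ (by linarith)
      have h31 : Y ^ 31 ≤ Y ^ 92 := pow_le_pow_right₀ (by linarith) (by norm_num)
      have : Y ^ 31 = Y ^ 21 * Y ^ 10 := by ring
      nlinarith
    calc 256 * Y ^ 21 / √W * J + 1 / √W * J = (256 * Y ^ 21 + 1) * (1 / √W) * J := by ring
      _ ≤ Y ^ 92 / 2 * (2 / √m) * J := by gcongr
      _ = _ := by ring
  · rw [mul_assoc (2 * Real.pi)]
    calc X = 1 / (p ^ N * (1 - p) ^ (v.choose k - N)) * J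
          * (1 + (X * (p ^ N * (1 - p) ^ (v.choose k - N)) / J - 1)) := by
          rw [add_sub_cancel]
          field_simp
      _ = _ := by
          congr 1
          rw [hJeq, ← mul_assoc, mul_assoc (_ ^ ((v.choose t : ℝ) / 2)), one_div_mul_one_div_rev]

open Finset in
/-- Outside the main range of parameters there are few blocks. -/
theorem Nat.choose_le_sum_of_not_lt {v t k : ℕ} (htk : t ≤ k) (hkv : k ≤ v)
    (h : ¬(t < k ∧ k + t ≤ v)) : v.choose k ≤ ∑ j ∈ range (t + 1), v.choose j := by
  rcases htk.eq_or_lt with rfl | hlt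
  · exact single_le_sum (f := fun j => v.choose j) (fun _ _ => Nat.zero_le _)
      (self_mem_range_succ t)
  · rw [← Nat.choose_symm hkv]
    exact single_le_sum (f := fun j => v.choose j) (fun _ _ => Nat.zero_le _)
      (mem_range.2 (by omega))

/-- The number of simple `t-(v,k,λ)` designs of size `N` (when `(C(k,s)/C(v,s))·N` is an
integer for `1 ≤ s ≤ t` and `min(N, C(v,k)−N) ≥ (cv/t)^(ct)`) equals
`1/((2πp(1−p))^(C(v,t)/2) p^N (1−p)^(C(v,k)−N)) · ∏_{s=0}^{t}
[C(k−s,k−t)/C(v−t−s,k−t)]^((C(v,s)−C(v,s−1))/2)` up to a factor `1+δ`,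
where `p = N/C(v,k)`, `|δ| ≤ (cv/t)^(ct)/√(min(N, C(v,k)−N))` and `C(v,−1) = 0`. -/
theorem count_designs :
    ∃ c : ℝ, 0 < c ∧
      ∀ v t k N : ℕ, 1 ≤ v → 1 ≤ t → t ≤ v → t ≤ k → k ≤ v →
        (∀ s : ℕ, 1 ≤ s → s ≤ t → (v.choose s : ℤ) ∣ (k.choose s : ℤ) * N) →
        (c * v / t) ^ (c * t) ≤ ((min N (v.choose k - N) : ℕ) : ℝ) →
        ∃ δ : ℝ,
          |δ| ≤ (c * v / t) ^ (c * t) / Real.sqrt ((min N (v.choose k - N) : ℕ) : ℝ) ∧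
          (Nat.card {T : Finset (Finset (Fin v)) //
              (∃ lam : ℕ, IsDesign v k t lam T) ∧ T.card = N} : ℝ)
            = 1 / ((2 * Real.pi * ((N : ℝ) / (v.choose k : ℝ))
                      * (1 - (N : ℝ) / (v.choose k : ℝ))) ^ ((v.choose t : ℝ) / 2)
                    * ((N : ℝ) / (v.choose k : ℝ)) ^ N
                    * (1 - (N : ℝ) / (v.choose k : ℝ)) ^ (v.choose k - N))
                * (∏ s ∈ Finset.range (t + 1),
                    (((k - s).choose (k - t) : ℝ) / ((v - t - s).choose (k - t) : ℝ))
                      ^ ((1 / 2 : ℝ) * ((v.choose s : ℝ)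
                          - if s = 0 then (0 : ℝ) else (v.choose (s - 1) : ℝ))))
                * (1 + δ) := by
  refine ⟨276, by norm_num, fun v t k N hv ht htv htk hkv hdvd hm => ?_⟩
  have ht0 : (0 : ℝ) < t := by exact_mod_cast ht
  have hvt : (1 : ℝ) ≤ v / t := by
    rw [le_div_iff₀ ht0, one_mul]
    exact_mod_cast htv
  have h3 : (3 : ℝ) ≤ 3 * v / t := by
    rw [mul_div_assoc]
    linarith
  have hY : (3 : ℝ) ≤ (3 * v / t) ^ t := h3.trans (le_self_pow₀ (by linarith) (by omega))
  have hX : ((3 * v / t : ℝ) ^ t) ^ 92 ≤ (276 * v / t) ^ ((276 : ℝ) * t) := by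
    have h1 : (3 * v / t : ℝ) ≤ 276 * v / t := by
      gcongr
      norm_num
    rw [show (276 : ℝ) * t = ((276 * t : ℕ) : ℝ) by push_cast; rfl, Real.rpow_natCast, ← pow_mul]
    calc (3 * v / t : ℝ) ^ (t * 92) ≤ (276 * v / t) ^ (t * 92) := by gcongr
      _ ≤ _ := pow_le_pow_right₀ (by linarith) (by omega)
  by_cases hr : t < k ∧ k + t ≤ v
  · obtain ⟨δ, hδ, hcount⟩ :=
      (Regime.of_lt ht hr.1 hr.2).exists_card_isDesign_eq hdvd (hX.trans hm)
    exact ⟨δ, hδ.trans (by gcongr), hcount⟩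
  · have h1 : ((min N (v.choose k - N) : ℕ) : ℝ) ≤ (3 * v / t) ^ t :=
      calc ((min N (v.choose k - N) : ℕ) : ℝ) ≤ v.choose k := Nat.cast_le.2 (by omega)
        _ ≤ ∑ j ∈ Finset.range (t + 1), (v.choose j : ℝ) := by
          exact_mod_cast Nat.choose_le_sum_of_not_lt htk hkv hr
        _ ≤ (Real.exp 1 * v / t) ^ t := Nat.sum_choose_le_exp_mul_div_pow ht htv
        _ ≤ _ := by
          gcongr
          linarith [Real.exp_one_lt_d9]
    exact absurd ((hX.trans hm).trans h1)
      (not_le.2 (lt_self_pow₀ (by linarith) (by norm_num)))
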